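/- arXiv:2503.16813 — 8 statements merged into one kernel-verified Lean document; each statement's English description precedes it below -/
import Mathlib

section
/- Let d ≥ 1 be an integer, p ≥ 3 an odd natural number, α = (p−1)/4, and let r be a real number with r > 1 and αd > r−1. Then there exist C^∞ functions U_R : ℝ → ℝ and S : ℝ → ℝ such that U_R is odd, S is even, S(ζ) > 0 for all ζ, S(0) = 1, U_R(0) = 0, U_R′(0) = −(r−1)/(αd), the pair (U_R, S) satisfies for every ζ > 0 the system 0 = −(r−1)U_R(ζ) − ζU_R′(ζ) − U_R(ζ)U_R′(ζ) + αS(ζ)S′(ζ) and 0 = −(r−1)S(ζ) − ζS′(ζ) − S′(ζ)U_R(ζ) − αS(ζ)U_R′(ζ) − α(d−1)S(ζ)U_R(ζ)/ζ, and moreover U_R(ζ) → 0 and S(ζ) → 0 as ζ → ∞. -/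
open Filter Topology Set
namespace NLSProfile

/-- weighted radial average -/
noncomputable def avg (k : ℕ) (G : ℝ → ℝ) (ξ : ℝ) : ℝ := ∫ τ in (0:ℝ)..1, τ ^ k * G (τ * ξ)

lemma avg_continuous (k : ℕ) {G : ℝ → ℝ} (hG : Continuous G) : Continuous (avg k G) := by
  unfold avg
  apply intervalIntegral.continuous_parametric_intervalIntegral_of_continuous'
  simp only [Function.uncurry_def]
  fun_prop

lemma avg_hasDerivAt (k : ℕ) {G : ℝ → ℝ} (hG : ContDiff ℝ 1 G) (ξ : ℝ) :
    HasDerivAt (avg k G) (avg (k+1) (deriv G) ξ) ξ := by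
  have hGd : Continuous (deriv G) := hG.continuous_deriv le_rfl
  have hGc : Continuous G := hG.continuous
  have hGD : Differentiable ℝ G := hG.differentiable (by norm_num)
  obtain ⟨C, hC⟩ := (isCompact_Icc (a := -(|ξ|+1)) (b := |ξ|+1)).exists_bound_of_continuousOn
    hGd.continuousOn
  have := intervalIntegral.hasDerivAt_integral_of_dominated_loc_of_deriv_le
    (μ := MeasureTheory.volume) (a := 0) (b := 1) (x₀ := ξ) (s := Metric.ball ξ 1)
    (F := fun x τ => τ ^ k * G (τ * x)) (F' := fun x τ => τ ^ (k+1) * deriv G (τ * x))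
    (bound := fun _ => C) (Metric.ball_mem_nhds _ one_pos)
    (Eventually.of_forall fun x => (by fun_prop : Continuous fun τ => τ ^ k * G (τ * x)).aestronglyMeasurable)
    ((by fun_prop : Continuous fun τ => τ ^ k * G (τ * ξ)).intervalIntegrable _ _)
    ((by fun_prop : Continuous fun τ => τ ^ (k+1) * deriv G (τ * ξ)).aestronglyMeasurable)
    ?_ (by simp) ?_
  · exact this.2
  · refine Eventually.of_forall fun τ hτ x hx => ?_
    rw [uIoc_of_le zero_le_one] at hτ
    have hx' : |x| ≤ |ξ| + 1 := by
      have h1 : |x - ξ| < 1 := by simpa [Real.dist_eq] using hx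
      have := abs_sub_abs_le_abs_sub x ξ
      linarith
    have h2 : |τ * x| ≤ |ξ| + 1 := by
      rw [abs_mul, abs_of_pos hτ.1]
      nlinarith [hτ.1, hτ.2, abs_nonneg x]
    have h3 := hC (τ * x) (abs_le.mp h2)
    rw [norm_mul]
    have h4 : ‖τ ^ (k+1)‖ ≤ 1 := by
      rw [norm_pow, Real.norm_of_nonneg hτ.1.le]
      exact pow_le_one₀ hτ.1.le hτ.2
    calc _ ≤ 1 * C := mul_le_mul h4 h3 (norm_nonneg _) zero_le_one
      _ = C := one_mul C
  · refine Eventually.of_forall fun τ _ x _ => ?_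
    have h1 : HasDerivAt (fun x => τ * x) τ x := by
      simpa using (hasDerivAt_id x).const_mul τ
    have h2 := ((hGD (τ * x)).hasDerivAt.comp x h1).const_mul (τ ^ k)
    exact h2.congr_deriv (by ring)

lemma avg_contDiff (n : ℕ) : ∀ (k : ℕ) (G : ℝ → ℝ), ContDiff ℝ n G → ContDiff ℝ n (avg k G) := by
  induction n with
  | zero =>
    intro k G hG
    exact contDiff_zero.2 (avg_continuous k (contDiff_zero.1 hG))
  | succ n ih =>
    intro k G hG
    have h1 : ContDiff ℝ 1 G := hG.of_le (by push_cast; exact le_add_self)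
    have hd := avg_hasDerivAt k h1
    have hG' : ContDiff ℝ ((n:WithTop ℕ∞)+1) G := by exact_mod_cast hG
    push_cast
    rw [contDiff_succ_iff_deriv] at hG' ⊢
    refine ⟨fun x => (hd x).differentiableAt, by simp, ?_⟩
    have : deriv (avg k G) = avg (k+1) (deriv G) := funext fun x => (hd x).deriv
    rw [this]
    exact ih _ _ hG'.2.2

lemma avg_pow (k : ℕ) (G : ℝ → ℝ) (ξ : ℝ) :
    ξ ^ (k+1) * avg k G ξ = ∫ t in (0:ℝ)..ξ, t ^ k * G t := by
  have h := intervalIntegral.mul_integral_comp_mul_right (a := 0) (b := 1)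
    (f := fun t => t ^ k * G t) ξ
  rw [zero_mul, one_mul] at h
  rw [← h, pow_succ', mul_assoc]
  congr 1
  unfold avg
  rw [← intervalIntegral.integral_const_mul]
  congr 1
  ext τ
  ring

lemma avg_pow_hasDerivAt (k : ℕ) {G : ℝ → ℝ} (hG : Continuous G) (ξ : ℝ) :
    HasDerivAt (fun x => x ^ (k+1) * avg k G x) (ξ ^ k * G ξ) ξ := by
  have h : (fun x => x ^ (k+1) * avg k G x) = fun x => ∫ t in (0:ℝ)..x, t ^ k * G t :=
    funext fun x => avg_pow k G x
  rw [h]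
  have hc : Continuous fun t => t ^ k * G t := by fun_prop
  exact hc.integral_hasStrictDerivAt 0 ξ |>.hasDerivAt

lemma avg_zero (k : ℕ) (G : ℝ → ℝ) : avg k G 0 = G 0 / (k+1) := by
  unfold avg
  simp
  ring

lemma id_mul_avg_hasDerivAt (k : ℕ) {G : ℝ → ℝ} (hG : Continuous G) (ξ : ℝ) :
    HasDerivAt (fun x => x * avg k G x) (G ξ - k * avg k G ξ) ξ := by
  have hne : ∀ x : ℝ, x ≠ 0 →
      HasDerivAt (fun x => x * avg k G x) (G x - k * avg k G x) x := by
    intro x hx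
    have h1 := (avg_pow_hasDerivAt k hG x).div (hasDerivAt_pow k x) (pow_ne_zero k hx)
    have h2 : HasDerivAt (fun x => x * avg k G x)
      ((x ^ k * G x * x ^ k - x ^ (k + 1) * avg k G x * (k * x ^ (k - 1))) / (x ^ k) ^ 2) x := by
      apply h1.congr_of_eventuallyEq
      filter_upwards [isOpen_ne.mem_nhds hx] with y hy
      have : y ^ k ≠ 0 := pow_ne_zero k hy
      simp only [Pi.div_apply]
      field_simp
      ring
    convert h2 using 1
    have : x ^ k ≠ 0 := pow_ne_zero k hx
    rcases k with _ | k
    · simp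
    · simp only [Nat.add_sub_cancel]
      field_simp
      ring
  by_cases h : ξ = 0
  · subst h
    have hc := avg_continuous k hG
    exact hasDerivAt_of_hasDerivAt_of_ne (f := fun x => x * avg k G x)
      (g := fun x => G x - k * avg k G x) (fun y hy => hne y hy)
      (by fun_prop) (by fun_prop)
  · exact hne ξ h

lemma id_mul_avg_contDiff (n k : ℕ) {G : ℝ → ℝ} (hG : ContDiff ℝ n G) :
    ContDiff ℝ (n+1) (fun x => x * avg k G x) := by
  rw [contDiff_succ_iff_deriv]
  have hd := id_mul_avg_hasDerivAt k hG.continuous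
  refine ⟨fun x => (hd x).differentiableAt, by simp, ?_⟩
  rw [show deriv (fun x => x * avg k G x) = fun x => G x - k * avg k G x from
    funext fun x => (hd x).deriv]
  exact hG.sub (contDiff_const.mul (avg_contDiff n k G hG))

/-- trapping lemma -/
lemma trap {f f' : ℝ → ℝ} (hf : Continuous f) (h0 : f 0 ≤ 0)
    (hd : ∀ t, 0 < t → HasDerivAt f (f' t) t) (hneg : ∀ t, 0 < t → 0 < f t → f' t < 0)
    {b : ℝ} (hb : 0 ≤ b) : f b ≤ 0 := by
  by_contra! hfb
  obtain ⟨t, ht, hmax⟩ := (isCompact_Icc (a := (0:ℝ)) (b := b)).exists_isMaxOn ⟨0, by simp [hb]⟩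
    hf.continuousOn
  have hft : 0 < f t := lt_of_lt_of_le hfb (hmax (by simp [hb]))
  have ht0 : 0 < t := by
    rcases ht.1.eq_or_lt with h | h
    · rw [← h] at hft; linarith
    · exact h
  have h1 := hasDerivAt_iff_tendsto_slope.1 (hd t ht0)
  have h2 : Tendsto (slope f t) (𝓝[<] t) (𝓝 (f' t)) :=
    h1.mono_left (nhdsWithin_mono _ (fun x (hx : x < t) => hx.ne))
  have h3 : ∀ᶠ y in 𝓝[<] t, slope f t y < 0 := h2.eventually_lt_const (hneg t ht0 hft)
  have h4 : ∀ᶠ y in 𝓝[<] t, y ∈ Ioo 0 t := Ioo_mem_nhdsLT ht0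
  obtain ⟨y, hy1, hy2⟩ := (h3.and h4).exists
  have h5 := hmax (show y ∈ Icc 0 b from ⟨hy2.1.le, hy2.2.le.trans ht.2⟩)
  change f y ≤ f t at h5
  rw [slope_def_field] at hy1
  have : 0 ≤ (f y - f t) / (y - t) := div_nonneg_of_nonpos (by linarith) (by linarith [hy2.2])
  linarith

/-- decay lemma -/
lemma decay {f f' : ℝ → ℝ} {c : ℝ} (hc : 0 < c)
    (hd : ∀ t, 1 ≤ t → HasDerivAt f (f' t) t) (h0 : ∀ t, 1 ≤ t → 0 ≤ f t)
    (hle : ∀ t, 1 ≤ t → t * f' t ≤ - c * f t) : Tendsto f atTop (𝓝 0) := by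
  have hD : ∀ t, 1 ≤ t → HasDerivAt (fun t => f t * t ^ c)
      (f' t * t ^ c + f t * (c * t ^ (c-1))) t := fun t ht =>
    (hd t ht).mul (Real.hasDerivAt_rpow_const (Or.inl (by linarith)))
  have hanti : AntitoneOn (fun t => f t * t ^ c) (Ici 1) := by
    apply antitoneOn_of_deriv_nonpos (convex_Ici 1)
    · exact fun t ht => (hD t ht).continuousAt.continuousWithinAt
    · intro t ht
      rw [interior_Ici] at ht
      exact (hD t (le_of_lt ht)).differentiableAt.differentiableWithinAt
    · intro t ht
      rw [interior_Ici] at ht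
      have ht1 : 1 ≤ t := le_of_lt ht
      have htp : 0 < t := by linarith
      rw [(hD t ht1).deriv]
      have e : t ^ c = t * t ^ (c-1) := by
        rw [Real.rpow_sub_one htp.ne']; field_simp
      rw [e]
      have := Real.rpow_nonneg htp.le (c-1)
      nlinarith [hle t ht1]
  have hb : ∀ t, 1 ≤ t → f t ≤ f 1 * t ^ (-c) := by
    intro t ht
    have h1 := hanti (mem_Ici.2 (le_refl (1:ℝ))) (mem_Ici.2 ht) ht
    simp only [Real.one_rpow, mul_one] at h1
    have htp : 0 < t := by linarith
    rw [Real.rpow_neg htp.le, ← div_eq_mul_inv, le_div_iff₀ (Real.rpow_pos_of_pos htp c)]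
    exact h1
  have hlim : Tendsto (fun t : ℝ => f 1 * t ^ (-c)) atTop (𝓝 0) := by
    simpa using (tendsto_rpow_neg_atTop hc).const_mul (f 1)
  refine tendsto_of_tendsto_of_tendsto_of_le_of_le' tendsto_const_nhds hlim ?_ ?_
  · filter_upwards [eventually_ge_atTop 1] with t ht using h0 t ht
  · filter_upwards [eventually_ge_atTop 1] with t ht using hb t ht

/-- existence for the singular integral equation -/
lemma exists_fixed (k : ℕ) (hk : 1 ≤ k) (g : ℝ → ℝ → ℝ) (hg : Continuous fun q : ℝ × ℝ => g q.1 q.2)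
    (B L : ℝ) (hL : 0 < L) (hB : ∀ t x, |g t x| ≤ B) (hLip : ∀ t x y, |g t x - g t y| ≤ L * |x - y|)
    (heven : ∀ t x, g (-t) x = g t x) :
    ∃ v : ℝ → ℝ, Continuous v ∧ (∀ t, v (-t) = v t) ∧
      ∀ ξ, v ξ = ξ ^ 2 * avg k (fun t => g t (v t)) ξ := by
  have hB0 : 0 ≤ B := (abs_nonneg _).trans (hB 0 0)
  -- the operator
  let T : (ℝ → ℝ) → ℝ → ℝ := fun w ξ =>
    Real.exp (-(L * ξ ^ 2)) * (ξ ^ 2 * avg k (fun t => g t (Real.exp (L * t ^ 2) * w t)) ξ)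
  have hTc : ∀ w : ℝ → ℝ, Continuous w → Continuous (T w) := by
    intro w hw
    have h1 : Continuous (fun t => g t (Real.exp (L * t ^ 2) * w t)) :=
      hg.comp (by fun_prop : Continuous fun t : ℝ => (t, Real.exp (L * t ^ 2) * w t))
    have h2 := avg_continuous k h1
    simp only [T]
    fun_prop
  have hkey : ∀ ξ : ℝ, Real.exp (-(L * ξ ^ 2)) * ξ ^ 2 ≤ 1 / L := by
    intro ξ
    rw [le_div_iff₀ hL, Real.exp_neg, mul_assoc, inv_mul_le_iff₀ (Real.exp_pos _)]
    nlinarith [Real.add_one_le_exp (L * ξ ^ 2)]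
  have hTb : ∀ w : ℝ → ℝ, ∀ ξ, ‖T w ξ‖ ≤ 1 / L * B := by
    intro w ξ
    have h1 : ‖avg k (fun t => g t (Real.exp (L * t ^ 2) * w t)) ξ‖ ≤ B * |1 - 0| := by
      apply intervalIntegral.norm_integral_le_of_norm_le_const
      intro τ hτ
      rw [uIoc_of_le zero_le_one] at hτ
      rw [norm_mul, norm_pow, Real.norm_of_nonneg hτ.1.le, Real.norm_eq_abs]
      calc _ ≤ 1 * B := mul_le_mul (pow_le_one₀ hτ.1.le hτ.2) (hB _ _) (abs_nonneg _) zero_le_one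
        _ = B := one_mul B
    rw [sub_zero, abs_one, mul_one] at h1
    have h2 : 0 ≤ Real.exp (-(L * ξ ^ 2)) * ξ ^ 2 := by positivity
    simp only [T]
    rw [← mul_assoc, norm_mul, Real.norm_of_nonneg h2]
    exact mul_le_mul (hkey ξ) h1 (norm_nonneg _) (by positivity)
  let Φ : BoundedContinuousFunction ℝ ℝ → BoundedContinuousFunction ℝ ℝ := fun w =>
    BoundedContinuousFunction.ofNormedAddCommGroup (T w) (hTc w w.continuous) _ (hTb w)
  have hInt : ∀ ξ : ℝ, ξ ^ 2 * ∫ τ in (0:ℝ)..1, τ * Real.exp (L * (τ * ξ) ^ 2)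
      = (Real.exp (L * ξ ^ 2) - 1) / (2 * L) := by
    intro ξ
    have hd : ∀ τ ∈ uIcc (0:ℝ) 1, HasDerivAt (fun τ => Real.exp (L * (τ * ξ) ^ 2) / (2 * L))
        (ξ ^ 2 * (τ * Real.exp (L * (τ * ξ) ^ 2))) τ := by
      intro τ _
      have h1 : HasDerivAt (fun τ => L * (τ * ξ) ^ 2) (L * (2 * (τ * ξ) * ξ)) τ := by
        have := ((((hasDerivAt_id τ).mul_const ξ).pow 2).const_mul L)
        simpa using this
      exact (h1.exp.div_const (2 * L)).congr_deriv (by field_simp)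
    have h := intervalIntegral.integral_eq_sub_of_hasDerivAt hd
      ((by fun_prop : Continuous fun τ => ξ ^ 2 * (τ * Real.exp (L * (τ * ξ) ^ 2))).intervalIntegrable _ _)
    rw [← intervalIntegral.integral_const_mul, h]
    simp
    ring
  have hcontr : ContractingWith (1/2) Φ := by
    refine ⟨by rw [← NNReal.coe_lt_coe]; norm_num, LipschitzWith.of_dist_le_mul fun w₁ w₂ => ?_⟩
    rw [BoundedContinuousFunction.dist_le (by positivity)]
    intro ξ
    have c1 : ∀ w : BoundedContinuousFunction ℝ ℝ,
        Continuous fun t => g t (Real.exp (L * t ^ 2) * w t) := fun w =>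
      hg.comp (by fun_prop : Continuous fun t : ℝ => (t, Real.exp (L * t ^ 2) * w t))
    have hdiff : |avg k (fun t => g t (Real.exp (L * t ^ 2) * w₁ t)) ξ -
        avg k (fun t => g t (Real.exp (L * t ^ 2) * w₂ t)) ξ| ≤
        ∫ τ in (0:ℝ)..1, (L * dist w₁ w₂) * (τ * Real.exp (L * (τ * ξ) ^ 2)) := by
      unfold avg
      have i1 := c1 w₁
      have i2 := c1 w₂
      rw [← intervalIntegral.integral_sub, ← Real.norm_eq_abs]
      · apply intervalIntegral.norm_integral_le_of_norm_le zero_le_one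
        · refine Eventually.of_forall fun τ hτ => ?_
          rw [← mul_sub, norm_mul, norm_pow, Real.norm_of_nonneg hτ.1.le, Real.norm_eq_abs]
          have a1 := hLip (τ * ξ) (Real.exp (L * (τ * ξ) ^ 2) * w₁ (τ * ξ))
            (Real.exp (L * (τ * ξ) ^ 2) * w₂ (τ * ξ))
          rw [← mul_sub, abs_mul, abs_of_pos (Real.exp_pos _)] at a1
          have a2 : |w₁ (τ * ξ) - w₂ (τ * ξ)| ≤ dist w₁ w₂ := by
            rw [← Real.dist_eq]; exact BoundedContinuousFunction.dist_coe_le_dist _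
          have a3 : τ ^ k ≤ τ := by
            simpa using pow_le_pow_of_le_one hτ.1.le hτ.2 hk
          calc _ ≤ τ * (L * (Real.exp (L * (τ * ξ) ^ 2) * dist w₁ w₂)) := by
                apply mul_le_mul a3 (a1.trans _) (abs_nonneg _) hτ.1.le
                gcongr
            _ = _ := by ring
        · exact (by fun_prop : Continuous fun τ => (L * dist w₁ w₂) * (τ * Real.exp (L * (τ * ξ) ^ 2))).intervalIntegrable _ _
      · exact ((continuous_pow k).mul (i1.comp (continuous_mul_const ξ))).intervalIntegrable _ _
      · exact ((continuous_pow k).mul (i2.comp (continuous_mul_const ξ))).intervalIntegrable _ _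
    rw [intervalIntegral.integral_const_mul] at hdiff
    have hE : 0 < Real.exp (L * ξ ^ 2) := Real.exp_pos _
    have hEE : Real.exp (-(L * ξ ^ 2)) * Real.exp (L * ξ ^ 2) = 1 := by
      rw [← Real.exp_add]; simp
    change dist (T w₁ ξ) (T w₂ ξ) ≤ _
    simp only [T]
    rw [Real.dist_eq, ← mul_sub, ← mul_sub, abs_mul, abs_mul, abs_of_pos (Real.exp_pos _),
      abs_of_nonneg (sq_nonneg ξ)]
    have hD : 0 ≤ dist w₁ w₂ := dist_nonneg
    calc _ ≤ Real.exp (-(L * ξ ^ 2)) * (ξ ^ 2 * ((L * dist w₁ w₂) *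
            ∫ τ in (0:ℝ)..1, τ * Real.exp (L * (τ * ξ) ^ 2))) := by gcongr
      _ = Real.exp (-(L * ξ ^ 2)) * ((L * dist w₁ w₂) * ((Real.exp (L * ξ ^ 2) - 1) / (2 * L))) := by
          rw [← hInt ξ]; ring
      _ = (1/2) * dist w₁ w₂ * (Real.exp (-(L * ξ ^ 2)) * Real.exp (L * ξ ^ 2) - Real.exp (-(L * ξ ^ 2))) := by
          field_simp
      _ ≤ (1/2) * dist w₁ w₂ * 1 := by
          rw [hEE]
          have := Real.exp_pos (-(L * ξ ^ 2))
          gcongr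
          linarith
      _ = _ := by simp
  obtain ⟨w, hw⟩ : ∃ w, Φ w = w := ⟨_, hcontr.fixedPoint_isFixedPt⟩
  have hwT : ∀ ξ, T w ξ = w ξ := fun ξ => congrArg (fun f : BoundedContinuousFunction ℝ ℝ => f ξ) hw
  let w' : BoundedContinuousFunction ℝ ℝ := w.compContinuous ⟨fun t => -t, continuous_neg⟩
  have hw'T : Φ w' = w' := by
    ext ξ
    change T w' ξ = w (-ξ)
    rw [← hwT (-ξ)]
    simp only [T, avg, neg_sq]
    congr 2
    apply intervalIntegral.integral_congr
    intro τ _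
    have e1 : w' (τ * ξ) = w (-(τ * ξ)) := rfl
    have e2 : τ * -ξ = -(τ * ξ) := by ring
    simp only [e1, e2, heven, neg_sq]
  have hww : w' = w := hcontr.fixedPoint_unique' hw'T hw
  refine ⟨fun t => Real.exp (L * t ^ 2) * w t, by fun_prop, fun t => ?_, fun ξ => ?_⟩
  · have : w (-t) = w t := congrArg (fun f : BoundedContinuousFunction ℝ ℝ => f t) hww
    simp only [neg_sq, this]
  · have := hwT ξ
    simp only [T] at this
    simp only
    rw [← this, ← mul_assoc, ← Real.exp_add]
    simp


noncomputable def HH (α r d u : ℝ) : ℝ := (1 + u) * (r - 1 + α * (d - 1) * u) - α * (r - 1) * u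
noncomputable def QQ (α r d u : ℝ) : ℝ := (1 + u) ^ 2 + HH α r d u
noncomputable def NN (α r d κ u : ℝ) : ℝ := d * (u + κ) * QQ α r d u - u * (1 + u) * (r + u)

lemma HH_contDiff (α r d : ℝ) {n : WithTop ℕ∞} : ContDiff ℝ n (HH α r d) := by
  unfold HH; fun_prop
lemma QQ_contDiff (α r d : ℝ) {n : WithTop ℕ∞} : ContDiff ℝ n (QQ α r d) := by
  unfold QQ HH; fun_prop
lemma NN_contDiff (α r d κ : ℝ) {n : WithTop ℕ∞} : ContDiff ℝ n (NN α r d κ) := by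
  unfold NN QQ HH; fun_prop

lemma HH_lower {α r d κ : ℝ} (hα : 0 < α) (hr : 1 < r) (hd : 1 ≤ d) (hκ0 : 0 < κ) (hκ1 : κ < 1)
    (hκ : α * κ * d = r - 1) {u : ℝ} (hu : u ∈ Icc (-κ) 0) :
    (1 - κ) * (α * κ) ≤ HH α r d u := by
  unfold HH
  obtain ⟨h1, h2⟩ := hu
  have a1 : α * κ ≤ r - 1 + α * (d - 1) * u := by
    have : 0 ≤ α * (d - 1) * (u + κ) := by
      apply mul_nonneg (mul_nonneg hα.le (by linarith)) (by linarith)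
    nlinarith
  have a2 : (1 - κ) * (α * κ) ≤ (1 + u) * (r - 1 + α * (d - 1) * u) :=
    mul_le_mul (by linarith) a1 (by positivity) (by linarith)
  have a3 : 0 ≤ α * (r - 1) * (-u) :=
    mul_nonneg (mul_nonneg hα.le (by linarith)) (by linarith)
  linarith

lemma exists_u {α r κ : ℝ} (d : ℕ) (hα : 0 < α) (hr : 1 < r) (hd : 1 ≤ d) (hκ0 : 0 < κ) (hκ1 : κ < 1)
    (hκ : α * κ * d = r - 1) :
    ∃ u : ℝ → ℝ, ContDiff ℝ (⊤ : ℕ∞) u ∧ (∀ t, u (-t) = u t) ∧ (∀ t, u t ∈ Icc (-κ) 0) ∧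
      u 0 = -κ ∧ ∀ ξ, 0 < ξ → HasDerivAt u (-(α ^ 2 * d * (u ξ + κ) +
        ξ ^ 2 * (u ξ * (1 + u ξ) * (r + u ξ))) / (ξ * (α ^ 2 + ξ ^ 2 * QQ α r d (u ξ)))) ξ := by
  have hd1 : (1:ℝ) ≤ d := by exact_mod_cast hd
  set h0 : ℝ := (1 - κ) * (α * κ) with hh0
  have hh0p : 0 < h0 := mul_pos (by linarith) (mul_pos hα hκ0)
  have hQl : ∀ u ∈ Icc (-κ) 0, h0 ≤ QQ α r d u := fun u hu => by
    have := HH_lower hα hr hd1 hκ0 hκ1 hκ hu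
    unfold QQ; nlinarith [sq_nonneg (1 + u)]
  have hQc : Continuous (QQ α r d) := (QQ_contDiff α r d (n := 0)).continuous
  have hNc : Continuous (NN α r d κ) := (NN_contDiff α r d κ (n := 0)).continuous
  obtain ⟨BN, hBN⟩ := (isCompact_Icc (a := -κ) (b := (0:ℝ))).exists_bound_of_continuousOn hNc.continuousOn
  obtain ⟨LN, hLN⟩ := (NN_contDiff α r d κ (n := 1)).contDiffOn.exists_lipschitzOnWith (by norm_num)
    (convex_Icc (-κ) 0) isCompact_Icc
  obtain ⟨LQ, hLQ⟩ := (QQ_contDiff α r d (n := 1)).contDiffOn.exists_lipschitzOnWith (by norm_num)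
    (convex_Icc (-κ) 0) isCompact_Icc
  have hBN0 : 0 ≤ BN := (norm_nonneg _).trans (hBN 0 ⟨by linarith, le_rfl⟩)
  -- clamp
  let cl : ℝ → ℝ := fun x => max (-κ) (min x 0)
  have hclm : ∀ x, cl x ∈ Icc (-κ) 0 := fun x => ⟨le_max_left _ _, max_le (by linarith) (min_le_right _ _)⟩
  have hcll : ∀ x y, |cl x - cl y| ≤ |x - y| := fun x y => by
    have e1 := abs_max_sub_max_le_max (-κ) (min x 0) (-κ) (min y 0)
    have e2 := abs_min_sub_min_le_max x 0 y 0
    simp only [sub_self, abs_zero] at e1 e2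
    rw [max_eq_right (abs_nonneg (min x 0 - min y 0))] at e1
    rw [max_eq_left (abs_nonneg (x - y))] at e2
    exact e1.trans e2
  have hclc : Continuous cl := by fun_prop
  have hclid : ∀ x ∈ Icc (-κ) 0, cl x = x := fun x hx => by
    simp only [cl]; rw [min_eq_left hx.2, max_eq_right hx.1]
  have hα2 : 0 < α ^ 2 := by positivity
  have hT : ∀ t, ∀ u ∈ Icc (-κ) 0, 0 < α ^ 2 + t ^ 2 * QQ α r d u := fun t u hu => by
    have := (hh0p.le.trans (hQl u hu)); positivity
  let g : ℝ → ℝ → ℝ := fun t x => NN α r d κ (cl (x - κ)) / (α ^ 2 + t ^ 2 * QQ α r d (cl (x - κ)))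
  have hex : ∃ v : ℝ → ℝ, Continuous v ∧ (∀ t, v (-t) = v t) ∧
      ∀ ξ, v ξ = ξ ^ 2 * avg (d+1) (fun t => g t (v t)) ξ := by
    refine exists_fixed (d + 1) (by omega) g ?_ (BN / α ^ 2)
      (LN / α ^ 2 + BN * LQ / (h0 * α ^ 2) + 1) (by positivity) ?_ ?_ ?_
    · apply Continuous.div
      · exact hNc.comp (hclc.comp (by fun_prop))
      · have := hQc.comp (hclc.comp (by fun_prop : Continuous fun q : ℝ × ℝ => q.2 - κ))
        simp only [Function.comp_def] at this
        fun_prop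
      · exact fun q => (hT _ _ (hclm _)).ne'
    · intro t x
      have hm := hclm (x - κ)
      have := hh0p.le.trans (hQl _ hm)
      simp only [g]
      rw [abs_div, abs_of_pos (hT t _ hm)]
      exact div_le_div₀ hBN0 (hBN _ hm) hα2 (by nlinarith [mul_nonneg (sq_nonneg t) this])
    · intro t x y
      have hx := hclm (x - κ)
      have hy := hclm (y - κ)
      have hxy : |cl (x - κ) - cl (y - κ)| ≤ |x - y| := by simpa using hcll (x - κ) (y - κ)
      simp only [g]
      set a := cl (x - κ)
      set b := cl (y - κ)
      have n1 : |NN α r d κ a - NN α r d κ b| ≤ LN * |x - y| :=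
        (by simpa [Real.dist_eq] using hLN.dist_le_mul a hx b hy :
          |NN α r d κ a - NN α r d κ b| ≤ LN * |a - b|).trans (by gcongr)
      have n2 : |QQ α r d a - QQ α r d b| ≤ LQ * |x - y| :=
        (by simpa [Real.dist_eq] using hLQ.dist_le_mul a hx b hy :
          |QQ α r d a - QQ α r d b| ≤ LQ * |a - b|).trans (by gcongr)
      have n3 : |NN α r d κ b| ≤ BN := hBN b hy
      have q1 := hQl a hx
      have q2 := hQl b hy
      have t1 := hT t a hx
      have t2 := hT t b hy
      have s1 : α ^ 2 ≤ α ^ 2 + t ^ 2 * QQ α r d a := by nlinarith [mul_nonneg (sq_nonneg t) (hh0p.le.trans q1)]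
      have s2 : α ^ 2 ≤ α ^ 2 + t ^ 2 * QQ α r d b := by nlinarith [mul_nonneg (sq_nonneg t) (hh0p.le.trans q2)]
      have s3 : h0 * t ^ 2 ≤ α ^ 2 + t ^ 2 * QQ α r d b := by nlinarith [mul_le_mul_of_nonneg_left q2 (sq_nonneg t)]
      have e : NN α r d κ a / (α ^ 2 + t ^ 2 * QQ α r d a) - NN α r d κ b / (α ^ 2 + t ^ 2 * QQ α r d b)
          = (NN α r d κ a - NN α r d κ b) / (α ^ 2 + t ^ 2 * QQ α r d a)
            - NN α r d κ b * (QQ α r d a - QQ α r d b) * (t ^ 2 / (α ^ 2 + t ^ 2 * QQ α r d b))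
              / (α ^ 2 + t ^ 2 * QQ α r d a) := by
        field_simp
        ring
      rw [e]
      have m1 : |(NN α r d κ a - NN α r d κ b) / (α ^ 2 + t ^ 2 * QQ α r d a)| ≤ LN * |x - y| / α ^ 2 := by
        rw [abs_div, abs_of_pos t1]
        exact div_le_div₀ (by positivity) n1 hα2 s1
      have m3 : t ^ 2 / (α ^ 2 + t ^ 2 * QQ α r d b) ≤ 1 / h0 := by
        rw [div_le_div_iff₀ t2 hh0p]; linarith
      have m2 : |NN α r d κ b * (QQ α r d a - QQ α r d b) * (t ^ 2 / (α ^ 2 + t ^ 2 * QQ α r d b))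
              / (α ^ 2 + t ^ 2 * QQ α r d a)| ≤ BN * (LQ * |x - y|) * (1 / h0) / α ^ 2 := by
        rw [abs_div, abs_of_pos t1, abs_mul, abs_mul, abs_of_nonneg (by positivity : 0 ≤ t ^ 2 / (α ^ 2 + t ^ 2 * QQ α r d b))]
        refine div_le_div₀ (by positivity) ?_ hα2 s1
        gcongr
      calc _ ≤ _ := abs_sub _ _
        _ ≤ LN * |x - y| / α ^ 2 + BN * (LQ * |x - y|) * (1 / h0) / α ^ 2 := add_le_add m1 m2
        _ = (LN / α ^ 2 + BN * LQ / (h0 * α ^ 2)) * |x - y| := by field_simp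
        _ ≤ _ := by nlinarith [abs_nonneg (x - y)]
    · intro t x; simp [g]
  obtain ⟨v, hvc, hve, hv⟩ := hex
  let u : ℝ → ℝ := fun t => v t - κ
  have huc : Continuous u := by fun_prop
  have hgvc : Continuous fun t => g t (v t) := by
    apply Continuous.div
    · exact hNc.comp (hclc.comp (by fun_prop))
    · have := hQc.comp (hclc.comp (by fun_prop : Continuous fun t => v t - κ))
      simp only [Function.comp_def] at this
      fun_prop
    · exact fun q => (hT _ _ (hclm _)).ne'
  have hode : ∀ ξ, 0 < ξ → HasDerivAt v ((-d * v ξ + ξ ^ 2 * g ξ (v ξ)) / ξ) ξ := by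
    intro ξ hξ
    have h1 := (avg_pow_hasDerivAt (d+1) hgvc ξ).div (hasDerivAt_pow d ξ) (pow_ne_zero d hξ.ne')
    have h2 := h1.congr_of_eventuallyEq (f₁ := v) (by
      filter_upwards [lt_mem_nhds hξ] with y hy
      have hyd : y ^ d ≠ 0 := pow_ne_zero d (ne_of_gt hy)
      simp only [Pi.div_apply]
      rw [hv y]
      field_simp
      ring)
    refine h2.congr_deriv ?_
    have hyd : ξ ^ d ≠ 0 := pow_ne_zero d hξ.ne'
    have e1 : ξ ^ (d + 1 + 1) * avg (d + 1) (fun t => g t (v t)) ξ = ξ ^ d * v ξ := by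
      conv_rhs => rw [hv ξ]
      ring
    rw [e1]
    obtain ⟨m, rfl⟩ : ∃ m, d = m + 1 := ⟨d - 1, by omega⟩
    simp only [Nat.add_sub_cancel]
    have hym : ξ ^ m ≠ 0 := pow_ne_zero m hξ.ne'
    field_simp
    ring
  have hv0 : v 0 = 0 := by rw [hv 0]; simp
  have hlow : ∀ t, 0 ≤ t → 0 ≤ v t := by
    intro t ht
    have := trap (f := fun t => - v t) (f' := fun ξ => -((-d * v ξ + ξ ^ 2 * g ξ (v ξ)) / ξ))
      hvc.neg (by simp [hv0]) (fun t ht => (hode t ht).neg) ?_ ht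
    · simpa using this
    intro t ht hvt
    have hvt' : v t < 0 := by simpa using hvt
    have hc : cl (v t - κ) = -κ := by
      simp only [cl]; rw [min_eq_left (by linarith), max_eq_left (by linarith)]
    have hg : 0 < g t (v t) := by
      simp only [g]; rw [hc]
      refine div_pos ?_ (hT t _ ⟨le_rfl, by linarith⟩)
      unfold NN
      have : 0 < κ * (1 - κ) * (r - κ) := mul_pos (mul_pos hκ0 (by linarith)) (by linarith)
      nlinarith
    have : 0 < -d * v t := by nlinarith
    have : 0 < (-d * v t + t ^ 2 * g t (v t)) / t := by positivity
    linarith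
  have hup : ∀ t, 0 ≤ t → u t ≤ 0 := by
    intro t ht
    refine trap (f := u) (f' := fun ξ => ((-d * v ξ + ξ ^ 2 * g ξ (v ξ)) / ξ))
      huc (by simp [u, hv0, hκ0.le]) (fun t ht => (hode t ht).sub_const κ) ?_ ht
    intro t ht hut
    have hc : cl (v t - κ) = 0 := by
      simp only [cl]
      rw [min_eq_right (by exact hut.le), max_eq_right (by linarith)]
    have hTt := hT t 0 ⟨by linarith, le_rfl⟩
    have hg : t ^ 2 * g t (v t) ≤ d * κ := by
      simp only [g]; rw [hc]
      rw [← mul_div_assoc, div_le_iff₀ hTt]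
      unfold NN
      have : 0 ≤ d * κ * α ^ 2 := by positivity
      nlinarith
    apply div_neg_of_neg_of_pos _ ht
    have : κ < v t := by simpa [u] using hut
    nlinarith
  have hmem : ∀ t, u t ∈ Icc (-κ) 0 := by
    intro t
    have hpos : ∀ t, 0 ≤ t → u t ∈ Icc (-κ) 0 := fun t ht =>
      ⟨by have := hlow t ht; simp only [u]; linarith, hup t ht⟩
    rcases le_total 0 t with h | h
    · exact hpos t h
    · have := hpos (-t) (by linarith)
      simpa only [u, hve] using this
  have hgu : ∀ t, g t (v t) = NN α r d κ (u t) / (α ^ 2 + t ^ 2 * QQ α r d (u t)) := fun t => by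
    simp only [g]
    rw [show cl (v t - κ) = u t from hclid _ (hmem t)]
  have hsm : ∀ n : ℕ, ContDiff ℝ n v := by
    intro n
    induction n with
    | zero => exact contDiff_zero.2 hvc
    | succ n ih =>
      have hu : ContDiff ℝ n u := ih.sub contDiff_const
      have hG : ContDiff ℝ n (fun t => g t (v t)) := by
        rw [funext hgu]
        refine ContDiff.div ((NN_contDiff α r d κ).comp hu)
          (contDiff_const.add ((contDiff_id.pow 2).mul ((QQ_contDiff α r d).comp hu))) ?_
        exact fun t => (hT t _ (hmem t)).ne'
      have := contDiff_id.mul (id_mul_avg_contDiff n (d+1) hG)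
      have e : v = fun x => id x * (x * avg (d+1) (fun t => g t (v t)) x) := by
        ext x
        conv_lhs => rw [hv x]
        simp only [id]; ring
      rw [e]
      exact_mod_cast this
  refine ⟨u, (contDiff_infty.2 hsm).sub contDiff_const, fun t => by simp only [u, hve], hmem,
    by simp [u, hv0], fun ξ hξ => ?_⟩
  refine ((hode ξ hξ).sub_const κ).congr_deriv ?_
  have hTt := (hT ξ _ (hmem ξ)).ne'
  rw [hgu ξ]
  have e : v ξ = u ξ + κ := by simp [u]
  rw [e]
  have hξ' := hξ.ne'
  field_simp
  unfold NN
  ring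

lemma avg_even (k : ℕ) {G : ℝ → ℝ} (hG : ∀ t, G (-t) = G t) (ξ : ℝ) : avg k G (-ξ) = avg k G ξ := by
  unfold avg
  congr 1
  ext τ
  rw [mul_neg, hG]

end NLSProfile

open NLSProfile

set_option maxHeartbeats 2000000 in
/-- **Main theorem** (existence of smooth decaying self-similar profiles for the
hydrodynamic formulation of the focusing NLS).  Let `d ≥ 1`, `p ≥ 3` an odd natural
number, `α = (p-1)/4`, `r > 1` with `α d > r - 1`.  Then there exist `C^∞` functions
`U_R, S : ℝ → ℝ`, with `U_R` odd and `S` even, `S > 0`, `S 0 = 1`, `U_R 0 = 0`,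
`U_R' 0 = -(r-1)/(α d)`, solving for every `ζ > 0` the stationary self-similar system
`0 = -(r-1) U_R - ζ U_R' - U_R U_R' + α S S'` and
`0 = -(r-1) S - ζ S' - S' U_R - α S U_R' - α (d-1) S U_R / ζ`,
and decaying at infinity: `U_R ζ → 0` and `S ζ → 0` as `ζ → ∞`. -/
theorem focusing_NLS_selfsimilar_profile
    (d : ℕ) (hd : 1 ≤ d) (p : ℕ) (hp3 : 3 ≤ p) (hpodd : Odd p)
    (α : ℝ) (hα : α = ((p : ℝ) - 1) / 4)
    (r : ℝ) (hr : 1 < r) (hrd : α * d > r - 1) :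
    ∃ U S : ℝ → ℝ,
      ContDiff ℝ (⊤ : ℕ∞) U ∧ ContDiff ℝ (⊤ : ℕ∞) S ∧
      (∀ ζ : ℝ, U (-ζ) = -U ζ) ∧ (∀ ζ : ℝ, S (-ζ) = S ζ) ∧
      (∀ ζ : ℝ, 0 < S ζ) ∧ S 0 = 1 ∧ U 0 = 0 ∧
      deriv U 0 = -(r - 1) / (α * d) ∧
      (∀ ζ : ℝ, 0 < ζ →
        0 = -(r - 1) * U ζ - ζ * deriv U ζ - U ζ * deriv U ζ + α * S ζ * deriv S ζ ∧
        0 = -(r - 1) * S ζ - ζ * deriv S ζ - deriv S ζ * U ζ - α * S ζ * deriv U ζ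
              - α * ((d : ℝ) - 1) * S ζ * U ζ / ζ) ∧
      Filter.Tendsto U Filter.atTop (nhds 0) ∧
      Filter.Tendsto S Filter.atTop (nhds 0) := by
  have hα0 : 0 < α := by
    have : (3:ℝ) ≤ p := by exact_mod_cast hp3
    rw [hα]; linarith
  have hd1 : (1:ℝ) ≤ d := by exact_mod_cast hd
  have hd0 : (0:ℝ) < d := by linarith
  clear hα hpodd hp3
  set κ : ℝ := (r - 1) / (α * d) with hκdef
  have hκ0 : 0 < κ := div_pos (by linarith) (by positivity)
  have hκ1 : κ < 1 := by rw [hκdef, div_lt_one (by positivity)]; exact hrd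
  have hκ : α * κ * d = r - 1 := by rw [hκdef]; field_simp
  obtain ⟨u, husm, hue, hum, hu0, hud⟩ := exists_u d hα0 hr hd hκ0 hκ1 hκ
  set h0 : ℝ := (1 - κ) * (α * κ) with hh0
  have hh0p : 0 < h0 := mul_pos (by linarith) (mul_pos hα0 hκ0)
  have hHl : ∀ t, h0 ≤ HH α r d (u t) := fun t => HH_lower hα0 hr hd1 hκ0 hκ1 hκ (hum t)
  have hQl : ∀ t, h0 ≤ QQ α r d (u t) := fun t => by
    have := hHl t
    unfold QQ; nlinarith [sq_nonneg (1 + u t)]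
  obtain ⟨Qm, hQm'⟩ := (isCompact_Icc (a := -κ) (b := (0:ℝ))).exists_bound_of_continuousOn
    (QQ_contDiff α r d (n := 0)).continuous.continuousOn
  have hQm : ∀ t, QQ α r d (u t) ≤ Qm := fun t => (le_abs_self _).trans (hQm' _ (hum t))
  have hQm0 : 0 < Qm := hh0p.trans_le ((hQl 0).trans (hQm 0))
  have hα2 : 0 < α ^ 2 := by positivity
  have hT : ∀ t, 0 < α ^ 2 + t ^ 2 * QQ α r d (u t) := fun t => by
    have := (hh0p.le.trans (hQl t)); positivity
  have hTu : ∀ t, 1 ≤ t → α ^ 2 + t ^ 2 * QQ α r d (u t) ≤ t ^ 2 * (α ^ 2 + Qm) := fun t ht => by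
    have h1 := mul_le_mul_of_nonneg_left (hQm t) (sq_nonneg t)
    have h2 : (1:ℝ) ≤ t ^ 2 := one_le_pow₀ ht
    have h3 := mul_le_mul_of_nonneg_right h2 hα2.le
    linarith
  have hTl : ∀ t, t ^ 2 * h0 ≤ α ^ 2 + t ^ 2 * QQ α r d (u t) := fun t => by
    have := mul_le_mul_of_nonneg_left (hQl t) (sq_nonneg t)
    nlinarith
  -- the function K and its integral
  let K : ℝ → ℝ := fun t => HH α r d (u t) / (α ^ 2 + t ^ 2 * QQ α r d (u t))
  have hKsm : ContDiff ℝ (⊤ : ℕ∞) K := ContDiff.div ((HH_contDiff α r d).comp husm)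
    (contDiff_const.add ((contDiff_id.pow 2).mul ((QQ_contDiff α r d).comp husm)))
    fun t => (hT t).ne'
  have hKe : ∀ t, K (-t) = K t := fun t => by simp only [K, hue, neg_sq]
  have hKpos : ∀ t, 0 < K t := fun t => div_pos (hh0p.trans_le (hHl t)) (hT t)
  let E : ℝ → ℝ := fun ξ => Real.exp (-(ξ ^ 2 * avg 1 K ξ))
  have hEpos : ∀ ξ, 0 < E ξ := fun ξ => Real.exp_pos _
  have hasm : ContDiff ℝ (⊤ : ℕ∞) (avg 1 K) :=
    contDiff_infty.2 fun n => avg_contDiff n 1 K (contDiff_infty.1 hKsm n)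
  have hEsm : ContDiff ℝ (⊤ : ℕ∞) E :=
    Real.contDiff_exp.comp ((contDiff_id.pow 2).mul hasm).neg
  have hEe : ∀ t, E (-t) = E t := fun t => by simp only [E, neg_sq, avg_even 1 hKe]
  have hE0 : E 0 = 1 := by simp [E]
  have hEd : ∀ t, HasDerivAt E (-(t * K t) * E t) t := fun t => by
    have := (avg_pow_hasDerivAt 1 hKsm.continuous t).neg.exp
    refine this.congr_deriv ?_
    simp only [E, pow_one, Pi.neg_apply]
    ring
  have hEle : ∀ t, 0 ≤ t → E t ≤ 1 := fun t ht => by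
    have hanti : AntitoneOn E (Set.Ici 0) := by
      apply antitoneOn_of_deriv_nonpos (convex_Ici 0) hEsm.continuous.continuousOn
      · exact fun t _ => (hEd t).differentiableAt.differentiableWithinAt
      · intro t ht
        rw [interior_Ici] at ht
        rw [(hEd t).deriv]
        have := mul_pos (mul_pos (Set.mem_Ioi.1 ht) (hKpos t)) (hEpos t)
        linarith
    have := hanti (Set.mem_Ici.2 (le_refl (0:ℝ))) (Set.mem_Ici.2 ht) ht
    rwa [hE0] at this
  let Z : ℝ → ℝ := fun ξ => ξ * E ξ
  have hZsm : ContDiff ℝ (⊤ : ℕ∞) Z := contDiff_id.mul hEsm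
  let Z' : ℝ → ℝ := fun t => E t * ((α ^ 2 + t ^ 2 * (1 + u t) ^ 2) / (α ^ 2 + t ^ 2 * QQ α r d (u t)))
  have hZd : ∀ t, HasDerivAt Z (Z' t) t := fun t => by
    refine ((hasDerivAt_id t).mul (hEd t)).congr_deriv ?_
    have := (hT t).ne'
    simp only [Z', K, id]
    field_simp
    unfold QQ
    ring
  have hZ'pos : ∀ t, 0 < Z' t := fun t =>
    mul_pos (hEpos t) (div_pos (by positivity) (hT t))
  have hZo : ∀ t, Z (-t) = - Z t := fun t => by simp only [Z, hEe]; ring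
  have hZmono : StrictMono Z := strictMono_of_deriv_pos fun t => by
    rw [(hZd t).deriv]; exact hZ'pos t
  have hZ0 : Z 0 = 0 := by simp [Z]
  have hZpos : ∀ t, 0 < t → 0 < Z t := fun t ht => mul_pos ht (hEpos t)
  have hZtop : Tendsto Z atTop atTop := by
    have h1 : Tendsto (fun t => (Z t)⁻¹) atTop (𝓝 0) := by
      apply decay (c := (1 - κ) ^ 2 / (α ^ 2 + Qm)) (f' := fun t => - Z' t / (Z t) ^ 2)
      · have : 0 < 1 - κ := by linarith
        positivity
      · exact fun t ht => (hZd t).inv (hZpos t (by linarith)).ne'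
      · exact fun t ht => (inv_pos.2 (hZpos t (by linarith))).le
      · intro t ht
        have htp : 0 < t := by linarith
        have e : t * (- Z' t / (Z t) ^ 2) =
          -((α ^ 2 + t ^ 2 * (1 + u t) ^ 2) / (α ^ 2 + t ^ 2 * QQ α r d (u t))) * (Z t)⁻¹ := by
          have := (hEpos t).ne'
          simp only [Z', Z]
          field_simp
        rw [e]
        apply mul_le_mul_of_nonneg_right _ (inv_pos.2 (hZpos t htp)).le
        apply neg_le_neg
        rw [div_le_div_iff₀ (by positivity) (hT t)]
        have h2 : (1 - κ) ^ 2 ≤ (1 + u t) ^ 2 :=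
          pow_le_pow_left₀ (by linarith) (by linarith [(hum t).1]) 2
        calc (1 - κ) ^ 2 * (α ^ 2 + t ^ 2 * QQ α r d (u t))
            ≤ (1 + u t) ^ 2 * (t ^ 2 * (α ^ 2 + Qm)) :=
              mul_le_mul h2 (hTu t ht) (hT t).le (by positivity)
          _ ≤ _ := by nlinarith [mul_pos hα2 (by positivity : 0 < α ^ 2 + Qm)]
    have h2 : Tendsto (fun t => (Z t)⁻¹) atTop (𝓝[>] 0) := by
      rw [tendsto_nhdsWithin_iff]
      refine ⟨h1, ?_⟩
      filter_upwards [eventually_gt_atTop 0] with t ht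
      exact inv_pos.2 (hZpos t ht)
    have h3 := h2.inv_tendsto_nhdsGT_zero
    refine h3.congr fun t => ?_
    simp
  have hZbot : Tendsto Z atBot atBot := by
    have : Z = fun t => - Z (-t) := funext fun t => by rw [hZo]; ring
    rw [this]
    exact tendsto_neg_atTop_atBot.comp (hZtop.comp tendsto_neg_atBot_atTop)
  have hZsurj : Function.Surjective Z := hZsm.continuous.surjective hZtop hZbot
  let Oi : ℝ ≃o ℝ := hZmono.orderIsoOfSurjective Z hZsurj
  have hOi : ∀ t, Oi t = Z t := fun t => rfl
  let Ξ : ℝ → ℝ := fun ζ => Oi.symm ζ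
  have hZΞ : ∀ ζ, Z (Ξ ζ) = ζ := fun ζ => Oi.apply_symm_apply ζ
  have hΞZ : ∀ t, Ξ (Z t) = t := fun t => Oi.symm_apply_apply t
  have hΞsm : ContDiff ℝ (⊤ : ℕ∞) Ξ :=
    Oi.toHomeomorph.contDiff_symm_deriv (f' := Z') (fun t => (hZ'pos t).ne') hZd hZsm
  have hΞd : ∀ ζ, HasDerivAt Ξ (Z' (Ξ ζ))⁻¹ ζ := fun ζ =>
    HasDerivAt.of_local_left_inverse hΞsm.continuous.continuousAt (hZd _) (hZ'pos _).ne'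
      (Eventually.of_forall hZΞ)
  have hΞtop : Tendsto Ξ atTop atTop := Oi.symm.tendsto_atTop
  have hΞo : ∀ ζ, Ξ (-ζ) = - Ξ ζ := fun ζ => by
    apply hZmono.injective
    rw [hZo, hZΞ, hZΞ]
  have hΞ0 : Ξ 0 = 0 := by
    apply hZmono.injective
    rw [hZΞ, hZ0]
  have hΞpos : ∀ ζ, 0 < ζ → 0 < Ξ ζ := fun ζ hζ => by
    rw [← hZmono.lt_iff_lt, hZΞ, hZ0]; exact hζ
  have hUd : ∀ ζ, ∀ u', HasDerivAt u u' (Ξ ζ) →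
      HasDerivAt (fun ζ => ζ * u (Ξ ζ)) (u (Ξ ζ) + ζ * (u' * (Z' (Ξ ζ))⁻¹)) ζ := fun ζ u' h => by
    refine ((hasDerivAt_id ζ).mul (h.comp ζ (hΞd ζ))).congr_deriv ?_
    simp
  have hSd : ∀ ζ, HasDerivAt (fun ζ => E (Ξ ζ)) (-(Ξ ζ * K (Ξ ζ)) * E (Ξ ζ) * (Z' (Ξ ζ))⁻¹) ζ :=
    fun ζ => (hEd (Ξ ζ)).comp ζ (hΞd ζ)
  refine ⟨fun ζ => ζ * u (Ξ ζ), fun ζ => E (Ξ ζ), contDiff_id.mul (husm.comp hΞsm),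
    hEsm.comp hΞsm, ?_, ?_, fun ζ => hEpos _, ?_, ?_, ?_, ?_, ?_, ?_⟩
  · intro ζ; simp only [hΞo, hue]; ring
  · intro ζ; simp only [hΞo, hEe]
  · simp only [hΞ0, hE0]
  · simp
  · have hdiff : DifferentiableAt ℝ u (Ξ 0) := husm.differentiable (by simp) _
    rw [(hUd 0 _ hdiff.hasDerivAt).deriv, hΞ0, hu0, hκdef]
    ring
  · intro ζ hζ
    have hξ := hΞpos ζ hζ
    rw [(hUd ζ _ (hud _ hξ)).deriv, (hSd ζ).deriv]
    have hz : ζ = Ξ ζ * E (Ξ ζ) := (hZΞ ζ).symm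
    have hTt := hT (Ξ ζ)
    have hEt := hEpos (Ξ ζ)
    have hDt : 0 < α ^ 2 + (Ξ ζ) ^ 2 * (1 + u (Ξ ζ)) ^ 2 := by positivity
    simp only [K, Z']
    generalize Ξ ζ = ξ at *
    generalize E ξ = e at *
    generalize hw : u ξ = w at *
    subst hz
    have hr' : r = α * κ * d + 1 := by linarith
    set T := α ^ 2 + ξ ^ 2 * QQ α r d w with hTdef
    have hTn := hTt.ne'
    have hDn := hDt.ne'
    have hen := hEt.ne'
    have hξn := hξ.ne'
    constructor
    · field_simp
      unfold HH
      rw [hr']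
      ring
    · field_simp
      unfold HH
      rw [hr']
      ring
  · -- decay of U
    set c : ℝ := min ((r - 1) * (1 - κ) / (α ^ 2 + Qm)) (1 / 2) with hcdef
    have hcp : 0 < c := by
      apply lt_min _ (by norm_num)
      have : 0 < 1 - κ := by linarith
      have : 0 < r - 1 := by linarith
      positivity
    set C : ℝ := α ^ 2 * d * κ / h0 with hCdef
    have hC0 : 0 < C := by positivity
    have h1 : Tendsto (fun t => -(Z t * u t) + 2 * C * t⁻¹) atTop (𝓝 0) := by
      refine decay hcp (fun t ht => (((hZd t).mul (hud t (by linarith))).neg.add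
        ((hasDerivAt_inv (by linarith : t ≠ 0)).const_mul (2 * C)))) ?_ ?_
      · intro t ht
        have htp : 0 < t := by linarith
        have := mul_nonneg (hZpos t htp).le (by linarith [(hum t).2] : 0 ≤ - u t)
        have : 0 ≤ 2 * C * t⁻¹ := by positivity
        linarith
      · intro t ht
        have htp : 0 < t := by linarith
        have hTt := hT t
        have hZt := hZpos t htp
        obtain ⟨hu1, hu2⟩ := hum t
        have hZle : Z t ≤ t := by
          have := mul_le_mul_of_nonneg_left (hEle t htp.le) htp.le
          simpa [Z] using this
        set T := α ^ 2 + t ^ 2 * QQ α r d (u t) with hTdef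
        have e : t * (-(Z' t * u t + Z t * (-(α ^ 2 * d * (u t + κ) +
            t ^ 2 * (u t * (1 + u t) * (r + u t))) / (t * T))) + 2 * C * -(t ^ 2)⁻¹)
            = Z t / T * (α ^ 2 * d * κ + α ^ 2 * (d - 1) * u t + (r - 1) * t ^ 2 * u t * (1 + u t))
              - 2 * C / t := by
          simp only [Z', Z]
          rw [← hTdef]
          field_simp
          ring
        rw [e]
        have b1 : α ^ 2 * d * κ + α ^ 2 * (d - 1) * u t + (r - 1) * t ^ 2 * u t * (1 + u t)
            ≤ α ^ 2 * d * κ + (r - 1) * (1 - κ) * (t ^ 2 * u t) := by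
          have i1 : α ^ 2 * (d - 1) * u t ≤ 0 :=
            mul_nonpos_of_nonneg_of_nonpos (mul_nonneg hα2.le (by linarith)) hu2
          have i2 : 0 ≤ (r - 1) * t ^ 2 * (-u t) * (u t + κ) :=
            mul_nonneg (mul_nonneg (mul_nonneg (by linarith) (sq_nonneg t)) (by linarith)) (by linarith)
          nlinarith
        have b2 : Z t / T * (α ^ 2 * d * κ) ≤ C / t := by
          rw [hCdef, div_mul_eq_mul_div, div_div, div_le_div_iff₀ hTt (by positivity)]
          have i1 : Z t * (h0 * t) ≤ T := by
            have := hTl t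
            have := mul_le_mul_of_nonneg_right hZle (by positivity : 0 ≤ h0 * t)
            linarith
          have := mul_le_mul_of_nonneg_left i1 (by positivity : 0 ≤ α ^ 2 * d * κ)
          linarith
        have b3 : c ≤ (r - 1) * (1 - κ) * (t ^ 2 / T) := by
          refine (min_le_left _ _).trans ?_
          rw [← mul_div_assoc, div_le_div_iff₀ (by positivity) hTt]
          have := mul_le_mul_of_nonneg_left (hTu t ht)
            (mul_nonneg (by linarith) (by linarith) : 0 ≤ (r - 1) * (1 - κ))
          linarith
        have b4 : Z t / T * ((r - 1) * (1 - κ) * (t ^ 2 * u t)) ≤ c * (Z t * u t) := by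
          have := mul_le_mul_of_nonneg_right b3
            (mul_nonneg hZt.le (by linarith) : 0 ≤ Z t * (-u t))
          have e2 : Z t / T * ((r - 1) * (1 - κ) * (t ^ 2 * u t)) =
            -((r - 1) * (1 - κ) * (t ^ 2 / T) * (Z t * (-u t))) := by ring
          rw [e2]; linarith
        have b5 : c * (2 * C * t⁻¹) ≤ C / t := by
          have hc2 : c ≤ 1 / 2 := min_le_right _ _
          have := mul_le_mul_of_nonneg_right hc2 (by positivity : 0 ≤ 2 * C * t⁻¹)
          calc _ ≤ _ := this
            _ = C / t := by field_simp
        have b6 := mul_le_mul_of_nonneg_left b1 (div_pos hZt hTt).le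
        have e3 : 2 * C / t = C / t + C / t := by ring
        rw [mul_add] at b6
        rw [e3]
        linarith
    have h2 : Tendsto (fun t : ℝ => 2 * C * t⁻¹) atTop (𝓝 0) := by
      simpa using tendsto_inv_atTop_zero.const_mul (2 * C)
    have h3 : Tendsto (fun t => Z t * u t) atTop (𝓝 0) := by
      have := h2.sub h1
      simpa using this
    have h4 := h3.comp hΞtop
    refine h4.congr fun ζ => ?_
    simp only [Function.comp_apply, hZΞ]
  · have h1 : Tendsto E atTop (𝓝 0) := by
      refine decay (c := h0 / (α ^ 2 + Qm)) (by positivity) (fun t _ => hEd t) (fun t _ => (hEpos t).le) ?_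
      intro t ht
      have : h0 / (α ^ 2 + Qm) ≤ t ^ 2 * K t := by
        simp only [K]
        rw [← mul_div_assoc, div_le_div_iff₀ (by positivity) (hT t)]
        calc _ ≤ h0 * (t ^ 2 * (α ^ 2 + Qm)) := mul_le_mul_of_nonneg_left (hTu t ht) hh0p.le
          _ = t ^ 2 * h0 * (α ^ 2 + Qm) := by ring
          _ ≤ _ := by
            have := hHl t
            gcongr
      have := mul_le_mul_of_nonneg_right this (hEpos t).le
      nlinarith
    exact h1.comp hΞtop
end

section
/- Let α > 0, let d ≥ 1 be an integer, and let r be a real number with r > 1 and αd > r−1. Then there exists a C^∞ solution (Ū, S̄) : ℝ → ℝ² of the autonomous system (⋆): Ū′(ξ) = N_U(Ū(ξ), S̄(ξ))/D(Ū(ξ), S̄(ξ)), S̄′(ξ) = N_S(Ū(ξ), S̄(ξ))/D(Ū(ξ), S̄(ξ)), defined for all ξ ∈ ℝ, such that S̄(ξ) > 0 and −1 < Ū(ξ) < 0 for all ξ, e^{ξ}S̄(ξ) → 1 and Ū(ξ) → −(r−1)/(αd) as ξ → −∞, and (Ū(ξ), S̄(ξ)) → (0, 0) as ξ → +∞. 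-/
/-- `D(u,s) = (1+u)² + α² s²`. -/
noncomputable def Dfun (α u s : ℝ) : ℝ := (1 + u) ^ 2 + α ^ 2 * s ^ 2

/-- `N_U(u,s) = -α² d s² u - α (r-1) s² - u (u+1) (r+u)`. -/
noncomputable def NU (α : ℝ) (d : ℕ) (r u s : ℝ) : ℝ :=
  -α ^ 2 * d * s ^ 2 * u - α * (r - 1) * s ^ 2 - u * (u + 1) * (r + u)

/-- `N_S(u,s) = -α² s³ + (αr - αd - r - 1) s u + (α - αd - 1) s u² - r s`. -/
noncomputable def NS (α : ℝ) (d : ℕ) (r u s : ℝ) : ℝ :=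
  -α ^ 2 * s ^ 3 + (α * r - α * d - r - 1) * s * u + (α - α * d - 1) * s * u ^ 2 - r * s


open Set Filter Topology

lemma aux_uniq {F : ℝ × ℝ → ℝ × ℝ} (hF : ∀ R : ℝ, ∃ K, LipschitzOnWith K F (Metric.closedBall 0 R))
    {f g : ℝ → ℝ × ℝ} {a b t₀ : ℝ} (ht : t₀ ∈ Ioo a b)
    (hf : ∀ t ∈ Icc a b, HasDerivAt f (F (f t)) t)
    (hg : ∀ t ∈ Icc a b, HasDerivAt g (F (g t)) t) (h0 : f t₀ = g t₀) :
    EqOn f g (Icc a b) := by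
  have cf : ContinuousOn f (Icc a b) := fun t ht => (hf t ht).continuousAt.continuousWithinAt
  have cg : ContinuousOn g (Icc a b) := fun t ht => (hg t ht).continuousAt.continuousWithinAt
  obtain ⟨R1, h1⟩ := (isCompact_Icc.image_of_continuousOn cf).isBounded.subset_closedBall 0
  obtain ⟨R2, h2⟩ := (isCompact_Icc.image_of_continuousOn cg).isBounded.subset_closedBall 0
  obtain ⟨K, hK⟩ := hF (max R1 R2)
  refine ODE_solution_unique_of_mem_Icc (v := fun _ => F) (s := fun _ => Metric.closedBall 0 (max R1 R2))
    (fun _ _ => hK) ht cf (fun t ht => hf t (Ioo_subset_Icc_self ht)) ?_ cg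
    (fun t ht => hg t (Ioo_subset_Icc_self ht)) ?_ h0
  · intro t ht
    exact Metric.closedBall_subset_closedBall (le_max_left _ _)
      (h1 (mem_image_of_mem _ (Ioo_subset_Icc_self ht)))
  · intro t ht
    exact Metric.closedBall_subset_closedBall (le_max_right _ _)
      (h2 (mem_image_of_mem _ (Ioo_subset_Icc_self ht)))

lemma aux_global {F : ℝ × ℝ → ℝ × ℝ} (hF : ∀ R : ℝ, ∃ K, LipschitzOnWith K F (Metric.closedBall 0 R))
    {L : ℝ} (hL : ∀ x, ‖F x‖ ≤ L) (t₀ : ℝ) (x₀ : ℝ × ℝ) :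
    ∃ x : ℝ → ℝ × ℝ, x t₀ = x₀ ∧ ∀ t, HasDerivAt x (F (x t)) t := by
  have hL0 : 0 ≤ L := (norm_nonneg _).trans (hL 0)
  have key : ∀ n : ℕ, ∃ x : ℝ → ℝ × ℝ, x t₀ = x₀ ∧
      ∀ t ∈ Ioo (t₀ - (n + 1)) (t₀ + (n + 1)), HasDerivAt x (F (x t)) t := by
    intro n
    have hn : (0:ℝ) ≤ n := n.cast_nonneg
    obtain ⟨K, hK⟩ := hF (‖x₀‖ + L * (n + 1))
    have hmem : t₀ ∈ Icc (t₀ - ((n:ℝ) + 1)) (t₀ + (n + 1)) := ⟨by linarith, by linarith⟩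
    have hP : IsPicardLindelof (fun _ => F) ⟨t₀, hmem⟩ x₀ (⟨L * (n + 1), by positivity⟩) 0 ⟨L, hL0⟩ K := by
      refine ⟨fun t _ => hK.mono ?_, fun x _ => continuousOn_const, fun t _ x _ => hL x, ?_⟩
      · intro y hy
        rw [Metric.mem_closedBall, dist_eq_norm] at hy
        change ‖y - x₀‖ ≤ L * (n+1) at hy
        rw [mem_closedBall_zero_iff]
        calc ‖y‖ = ‖x₀ + (y - x₀)‖ := by congr 1; abel
          _ ≤ ‖x₀‖ + ‖y - x₀‖ := norm_add_le _ _
          _ ≤ _ := by linarith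
      · change L * max (t₀ + ((n:ℝ) + 1) - t₀) (t₀ - (t₀ - (n + 1))) ≤ L * (n+1) - 0
        have : max (t₀ + ((n:ℝ) + 1) - t₀) (t₀ - (t₀ - (n + 1))) = n + 1 := by
          rw [max_eq_left] <;> linarith
        rw [this]; linarith
    obtain ⟨x, hx0, hx⟩ := hP.exists_eq_forall_mem_Icc_hasDerivWithinAt₀
    exact ⟨x, hx0, fun t ht => (hx t (Ioo_subset_Icc_self ht)).hasDerivAt (Icc_mem_nhds ht.1 ht.2)⟩
  choose X hX0 hX using key
  have hcomp : ∀ m n : ℕ, m ≤ n → ∀ t, |t - t₀| < m + 1 → X m t = X n t := by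
    intro m n hmn t ht
    have hmn' : (m:ℝ) ≤ n := by exact_mod_cast hmn
    obtain ⟨c, hc1, hc2⟩ := exists_between ht
    have hc0 : 0 < c := (abs_nonneg _).trans_lt hc1
    refine aux_uniq hF (a := t₀ - c) (b := t₀ + c) (t₀ := t₀) ⟨by linarith, by linarith⟩ ?_ ?_
      ((hX0 m).trans (hX0 n).symm) ?_
    · intro s hs
      exact hX m s ⟨by linarith [hs.1], by linarith [hs.2]⟩
    · intro s hs
      exact hX n s ⟨by linarith [hs.1], by linarith [hs.2]⟩
    · have := abs_lt.1 hc1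
      exact ⟨by linarith, by linarith⟩
  refine ⟨fun t => X ⌈|t - t₀|⌉₊ t, hX0 _, fun t => ?_⟩
  set N := ⌈|t - t₀|⌉₊ + 1 with hN
  have hNb : |t - t₀| < N := by
    have := Nat.le_ceil |t - t₀|
    rw [hN]; push_cast; linarith
  have hev : ∀ᶠ s in 𝓝 t, |s - t₀| < N := by
    have : Continuous fun s : ℝ => |s - t₀| := by fun_prop
    exact this.continuousAt.eventually (gt_mem_nhds hNb)
  have hgl : ∀ s, |s - t₀| < N → X ⌈|s - t₀|⌉₊ s = X N s := by
    intro s hs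
    refine hcomp _ _ (Nat.ceil_le.2 hs.le) _ ?_
    have := Nat.le_ceil |s - t₀|
    linarith
  have h1 : HasDerivAt (X N) (F (X N t)) t := by
    have := abs_lt.1 hNb
    exact hX N t ⟨by linarith, by linarith⟩
  change HasDerivAt (fun t => X ⌈|t - t₀|⌉₊ t) (F (X ⌈|t - t₀|⌉₊ t)) t
  rw [hgl t hNb]
  exact h1.congr_of_eventuallyEq (hev.mono hgl)

/-- If `f' > 0` whenever `f ≤ a`, then `f > a` persists. -/
lemma aux_inv {f f' : ℝ → ℝ} (hf : ∀ t, HasDerivAt f (f' t) t) {a : ℝ}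
    (hpos : ∀ t, f t ≤ a → 0 < f' t) {t₁ t₂ : ℝ} (h12 : t₁ ≤ t₂) (h1 : a < f t₁) : a < f t₂ := by
  by_contra! h
  obtain ⟨m, hm, hmin⟩ := isCompact_Icc.exists_isMinOn (nonempty_Icc.2 h12)
    (fun t _ => (hf t).continuousAt.continuousWithinAt : ContinuousOn f (Icc t₁ t₂))
  have hma : f m ≤ a := (hmin (right_mem_Icc.2 h12)).trans h
  have hne : t₁ < m := lt_of_le_of_ne hm.1 (by rintro rfl; linarith)
  have hd := hpos m hma
  have hs := (hasDerivAt_iff_tendsto_slope.1 (hf m)).eventually (lt_mem_nhds hd)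
  rw [eventually_nhdsWithin_iff] at hs
  have hfr : ∃ᶠ s in 𝓝[<] m, s ∈ Ioo t₁ m :=
    (Ioo_mem_nhdsLT hne : Ioo t₁ m ∈ 𝓝[<] m) |> Filter.Eventually.frequently
  obtain ⟨s, hs1, hs2⟩ := (hfr.and_eventually (hs.filter_mono nhdsWithin_le_nhds)).exists
  have h3 := hs2 (ne_of_lt hs1.2)
  rw [slope_def_field] at h3
  have h4 : f m ≤ f s := hmin ⟨hs1.1.le, hs1.2.le.trans hm.2⟩
  have : (f s - f m) / (s - m) ≤ 0 := div_nonpos_of_nonneg_of_nonpos (by linarith) (by linarith [hs1.2])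
  linarith

lemma aux_decay {W W' g : ℝ → ℝ} {c : ℝ} (hc : 0 < c) (hW0 : ∀ t, 0 ≤ W t)
    (hW : ∀ t, HasDerivAt W (W' t) t) (hle : ∀ᶠ t in atTop, W' t ≤ g t - c * W t)
    (hg : Tendsto g atTop (𝓝 0)) : Tendsto W atTop (𝓝 0) := by
  rw [tendsto_order]
  refine ⟨fun a ha => Eventually.of_forall fun t => ha.trans_le (hW0 t), fun ε hε => ?_⟩
  have h1 := hle.and (hg.eventually (gt_mem_nhds (show 0 < c * (ε / 2) by positivity)))
  obtain ⟨T, hT⟩ := eventually_atTop.1 h1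
  have hder : ∀ t, HasDerivAt (fun t => (W t - ε / 2) * Real.exp (c * t))
      (W' t * Real.exp (c * t) + (W t - ε / 2) * (Real.exp (c * t) * c)) t := by
    intro t
    exact (((hW t).sub_const (ε / 2)).mul (((hasDerivAt_id t).const_mul c).exp)).congr_deriv (by simp)
  have hanti : AntitoneOn (fun t => (W t - ε / 2) * Real.exp (c * t)) (Ici T) := by
    refine antitoneOn_of_deriv_nonpos (convex_Ici T)
      (fun t _ => (hder t).continuousAt.continuousWithinAt)
      (fun t _ => (hder t).differentiableAt.differentiableWithinAt) ?_
    intro t ht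
    rw [interior_Ici] at ht
    rw [(hder t).deriv]
    obtain ⟨h2, h3⟩ := hT t (le_of_lt ht)
    have : W' t + (W t - ε / 2) * c ≤ 0 := by nlinarith
    have he := Real.exp_pos (c * t)
    nlinarith
  have hlim : Tendsto (fun t => (W T - ε / 2) * Real.exp (c * T) * Real.exp (-(c * t))) atTop (𝓝 0) := by
    have : Tendsto (fun t : ℝ => Real.exp (-(c * t))) atTop (𝓝 0) :=
      Real.tendsto_exp_neg_atTop_nhds_zero.comp (tendsto_id.const_mul_atTop hc)
    simpa using this.const_mul ((W T - ε / 2) * Real.exp (c * T))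
  filter_upwards [hlim.eventually (gt_mem_nhds (half_pos hε)), eventually_ge_atTop T] with t h2 h3
  have h4 : (W t - ε / 2) * Real.exp (c * t) ≤ (W T - ε / 2) * Real.exp (c * T) :=
    hanti self_mem_Ici h3 h3
  have h5 : W t - ε / 2 ≤ (W T - ε / 2) * Real.exp (c * T) * Real.exp (-(c * t)) := by
    calc W t - ε / 2 = (W t - ε / 2) * Real.exp (c * t) * Real.exp (-(c * t)) := by
          rw [mul_assoc, ← Real.exp_add]; simp
      _ ≤ _ := mul_le_mul_of_nonneg_right h4 (Real.exp_pos _).le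
  linarith

lemma aux_smooth {α : ℝ} {d : ℕ} {r : ℝ} {U S : ℝ → ℝ}
    (h : ∀ ξ : ℝ,
        HasDerivAt U (NU α d r (U ξ) (S ξ) / Dfun α (U ξ) (S ξ)) ξ ∧
        HasDerivAt S (NS α d r (U ξ) (S ξ) / Dfun α (U ξ) (S ξ)) ξ)
    (hD : ∀ ξ, Dfun α (U ξ) (S ξ) ≠ 0) :
    ContDiff ℝ (⊤ : ℕ∞) U ∧ ContDiff ℝ (⊤ : ℕ∞) S := by
  have key : ∀ n : ℕ, ContDiff ℝ n U ∧ ContDiff ℝ n S := by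
    intro n
    induction n with
    | zero =>
      simp only [Nat.cast_zero, contDiff_zero]
      exact ⟨continuous_iff_continuousAt.2 fun t => (h t).1.continuousAt,
        continuous_iff_continuousAt.2 fun t => (h t).2.continuousAt⟩
    | succ n ih =>
      obtain ⟨hU, hS⟩ := ih
      have hDc : ContDiff ℝ n fun ξ => Dfun α (U ξ) (S ξ) := by
        unfold Dfun; fun_prop
      push_cast
      constructor
      · refine contDiff_succ_iff_deriv.2 ⟨fun t => (h t).1.differentiableAt, by simp, ?_⟩
        rw [show deriv U = _ from funext fun t => (h t).1.deriv]
        refine ContDiff.div ?_ hDc hD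
        unfold NU; fun_prop
      · refine contDiff_succ_iff_deriv.2 ⟨fun t => (h t).2.differentiableAt, by simp, ?_⟩
        rw [show deriv S = _ from funext fun t => (h t).2.deriv]
        refine ContDiff.div ?_ hDc hD
        unfold NS; fun_prop
  exact ⟨contDiff_infty.2 fun n => (key n).1, contDiff_infty.2 fun n => (key n).2⟩


/-- the averaging integral -/
noncomputable def auxI (n : ℕ) (φ : ℝ → ℝ) (x : ℝ) : ℝ := x ^ 2 * ∫ τ in (0:ℝ)..1, τ ^ n * φ (x * τ)

lemma auxI_cont (n : ℕ) {φ : ℝ → ℝ} (hφ : Continuous φ) : Continuous (auxI n φ) := by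
  unfold auxI
  refine (continuous_id.pow 2).mul ?_
  apply intervalIntegral.continuous_parametric_intervalIntegral_of_continuous'
  simp only [Function.uncurry_def]
  fun_prop

lemma auxI_bound (n : ℕ) {φ : ℝ → ℝ} {C x : ℝ} (hx : 0 ≤ x)
    (hb : ∀ y ∈ Icc 0 x, |φ y| ≤ C) : |auxI n φ x| ≤ x ^ 2 * C := by
  unfold auxI
  rw [abs_mul, abs_of_nonneg (sq_nonneg x)]
  refine mul_le_mul_of_nonneg_left ?_ (sq_nonneg x)
  have : ‖∫ τ in (0:ℝ)..1, τ ^ n * φ (x * τ)‖ ≤ C * |1 - 0| := by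
    refine intervalIntegral.norm_integral_le_of_norm_le_const ?_
    intro τ hτ
    rw [uIoc_of_le zero_le_one] at hτ
    have h1 : |φ (x * τ)| ≤ C := hb _ ⟨mul_nonneg hx hτ.1.le, mul_le_of_le_one_right hx hτ.2⟩
    have h2 : τ ^ n ≤ 1 := pow_le_one₀ hτ.1.le hτ.2
    have h3 : 0 ≤ τ ^ n := pow_nonneg hτ.1.le n
    rw [Real.norm_eq_abs, abs_mul, abs_of_nonneg h3]
    have := abs_nonneg (φ (x * τ))
    nlinarith
  simpa using this

lemma auxI_nonneg (n : ℕ) {φ : ℝ → ℝ} {x : ℝ} (hx : 0 ≤ x)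
    (hb : ∀ y ∈ Icc 0 x, 0 ≤ φ y) : 0 ≤ auxI n φ x := by
  unfold auxI
  refine mul_nonneg (sq_nonneg x) (intervalIntegral.integral_nonneg zero_le_one ?_)
  intro τ hτ
  exact mul_nonneg (pow_nonneg hτ.1 n) (hb _ ⟨mul_nonneg hx hτ.1, mul_le_of_le_one_right hx hτ.2⟩)

lemma auxI_sub (n : ℕ) {φ ψ : ℝ → ℝ} (hφ : Continuous φ) (hψ : Continuous ψ) (x : ℝ) :
    auxI n φ x - auxI n ψ x = auxI n (fun y => φ y - ψ y) x := by
  unfold auxI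
  rw [← mul_sub, ← intervalIntegral.integral_sub]
  · simp only [mul_sub]
  · exact Continuous.intervalIntegrable (by fun_prop) _ _
  · exact Continuous.intervalIntegrable (by fun_prop) _ _

lemma auxI_deriv (m : ℕ) {φ : ℝ → ℝ} (hφ : Continuous φ) {x : ℝ} (hx : 0 < x) :
    HasDerivAt (auxI (m + 1) φ) ((-m * auxI (m + 1) φ x) / x + x * φ x) x := by
  have hrep : ∀ y : ℝ, 0 < y → auxI (m + 1) φ y = (∫ ρ in (0:ℝ)..y, ρ ^ (m + 1) * φ ρ) / y ^ m := by
    intro y hy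
    unfold auxI
    have h1 := intervalIntegral.mul_integral_comp_mul_left (a := 0) (b := 1)
      (f := fun ρ => ρ ^ (m + 1) * φ ρ) y
    simp only [mul_zero, mul_one] at h1
    rw [← h1]
    have h2 : ∀ τ : ℝ, (y * τ) ^ (m + 1) * φ (y * τ) = y ^ (m + 1) * (τ ^ (m + 1) * φ (y * τ)) := by
      intro τ; ring
    simp only [h2]
    rw [intervalIntegral.integral_const_mul]
    field_simp
    ring
  have hc : Continuous fun ρ : ℝ => ρ ^ (m + 1) * φ ρ := by fun_prop
  have hd : HasDerivAt (fun y => ∫ ρ in (0:ℝ)..y, ρ ^ (m + 1) * φ ρ) (x ^ (m + 1) * φ x) x :=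
    intervalIntegral.integral_hasDerivAt_right (hc.intervalIntegrable _ _)
      (hc.stronglyMeasurableAtFilter _ _) hc.continuousAt
  have hq := hd.div (hasDerivAt_pow m x) (pow_pos hx m).ne'
  have hev : auxI (m + 1) φ =ᶠ[𝓝 x] fun y => (∫ ρ in (0:ℝ)..y, ρ ^ (m + 1) * φ ρ) / y ^ m := by
    filter_upwards [lt_mem_nhds hx] with y hy using hrep y hy
  refine (hq.congr_of_eventuallyEq hev).congr_deriv ?_
  rw [hrep x hx]
  cases m with
  | zero => simp
  | succ k =>
    simp only [Nat.add_sub_cancel]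
    field_simp
    ring

lemma aux_fixed (d : ℕ) {H1 H2 : (ℝ × ℝ) × ℝ → ℝ} (c1 : Continuous H1) (c2 : Continuous H2)
    {C K : ℝ} (hC : 0 ≤ C) (hK : 0 ≤ K)
    (b1 : ∀ p, ∀ x ∈ Icc (0:ℝ) 1, |H1 (p, x)| ≤ C) (b2 : ∀ p, ∀ x ∈ Icc (0:ℝ) 1, |H2 (p, x)| ≤ C)
    (l1 : ∀ p q, ∀ x ∈ Icc (0:ℝ) 1, |H1 (p, x) - H1 (q, x)| ≤ K * dist p q)
    (l2 : ∀ p q, ∀ x ∈ Icc (0:ℝ) 1, |H2 (p, x) - H2 (q, x)| ≤ K * dist p q) :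
    ∃ X : ℝ, 0 < X ∧ X ≤ 1 ∧ ∃ g : ℝ → ℝ × ℝ, Continuous g ∧ ∀ x ∈ Icc 0 X,
      g x = (auxI (d + 1) (fun y => H1 (g y, y)) x, auxI 1 (fun y => H2 (g y, y)) x) := by
  set X : ℝ := 1 / (2 * (K + 1)) with hXdef
  have hX0 : 0 < X := by positivity
  have hX1 : X ≤ 1 := by
    rw [hXdef, div_le_one (by positivity)]; linarith
  have hXK : X ^ 2 * K ≤ 1 / 2 := by
    have h1 : X * K ≤ 1 / 2 := by
      rw [hXdef, div_mul_eq_mul_div, div_le_iff₀ (by positivity)]; linarith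
    have h2 : 0 ≤ X * K := by positivity
    nlinarith
  set θ : ℝ → ℝ := fun x => max 0 (min x X) with hθ
  have hθc : Continuous θ := by fun_prop
  have hθm : ∀ x, θ x ∈ Icc 0 X := fun x =>
    ⟨le_max_left _ _, max_le hX0.le (min_le_right _ _)⟩
  have hθe : ∀ x ∈ Icc 0 X, θ x = x := by
    intro x hx
    simp only [hθ]
    rw [min_eq_left hx.2, max_eq_right hx.1]
  have hsub : ∀ x ∈ Icc 0 X, ∀ y ∈ Icc 0 x, y ∈ Icc (0:ℝ) 1 := fun x hx y hy =>
    ⟨hy.1, hy.2.trans (hx.2.trans hX1)⟩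
  let V : (ℝ → ℝ × ℝ) → ℝ → ℝ × ℝ := fun g x =>
    (auxI (d + 1) (fun y => H1 (g y, y)) (θ x), auxI 1 (fun y => H2 (g y, y)) (θ x))
  have hVc : ∀ g : ℝ → ℝ × ℝ, Continuous g → Continuous (V g) := by
    intro g hg
    exact ((auxI_cont _ (by fun_prop)).comp hθc).prodMk ((auxI_cont _ (by fun_prop)).comp hθc)
  have hVb : ∀ g : ℝ → ℝ × ℝ, ∀ x, ‖V g x‖ ≤ C := by
    intro g x
    have hx := hθm x
    have hx2 : (θ x) ^ 2 * C ≤ C := by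
      have : (θ x) ^ 2 ≤ 1 := pow_le_one₀ hx.1 (hx.2.trans hX1)
      nlinarith
    refine norm_prod_le_iff.2 ⟨?_, ?_⟩
    · exact (auxI_bound _ hx.1 (fun y hy => b1 _ _ (hsub _ hx y hy))).trans hx2
    · exact (auxI_bound _ hx.1 (fun y hy => b2 _ _ (hsub _ hx y hy))).trans hx2
  let T : BoundedContinuousFunction ℝ (ℝ × ℝ) → BoundedContinuousFunction ℝ (ℝ × ℝ) := fun g =>
    BoundedContinuousFunction.ofNormedAddCommGroup (V g) (hVc g g.continuous) C (hVb g)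
  have hT : ContractingWith (1 / 2) T := by
    refine ⟨by
      rw [div_lt_one] <;> norm_num, LipschitzWith.of_dist_le_mul fun g g' => ?_⟩
    have hcoe : (((1 / 2 : NNReal)) : ℝ) = 1 / 2 := by norm_num
    rw [hcoe]
    refine (BoundedContinuousFunction.dist_le (by positivity)).2 fun x => ?_
    change dist (V g x) (V g' x) ≤ _
    have hx := hθm x
    have hD0 : 0 ≤ dist g g' := dist_nonneg
    have hx2 : (θ x) ^ 2 * (K * dist g g') ≤ 1 / 2 * dist g g' := by
      have h1 : (θ x) ^ 2 ≤ X ^ 2 := pow_le_pow_left₀ hx.1 hx.2 2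
      have h2 : (θ x) ^ 2 * K ≤ 1 / 2 := (mul_le_mul_of_nonneg_right h1 hK).trans hXK
      nlinarith
    have hgg : ∀ y, K * dist (g y) (g' y) ≤ K * dist g g' := fun y =>
      mul_le_mul_of_nonneg_left (BoundedContinuousFunction.dist_coe_le_dist y) hK
    rw [Prod.dist_eq]
    refine max_le ?_ ?_
    · rw [Real.dist_eq, auxI_sub _ (by fun_prop) (by fun_prop)]
      exact (auxI_bound _ hx.1 (fun y hy => (l1 _ _ _ (hsub _ hx y hy)).trans (hgg y))).trans hx2
    · rw [Real.dist_eq, auxI_sub _ (by fun_prop) (by fun_prop)]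
      exact (auxI_bound _ hx.1 (fun y hy => (l2 _ _ _ (hsub _ hx y hy)).trans (hgg y))).trans hx2
  obtain ⟨G, hfix⟩ : ∃ G, T G = G := ⟨_, hT.fixedPoint_isFixedPt⟩
  refine ⟨X, hX0, hX1, G, G.continuous, ?_⟩
  intro x hx
  have h1 : G x = V G x := by
    conv_lhs => rw [← hfix]
    rfl
  rw [h1]
  simp only [V, hθe x hx]


/-- quadratic part of `N_S / s` -/
noncomputable def auxq (α : ℝ) (d : ℕ) (r u : ℝ) : ℝ :=
  (α * r - α * d - r - 1) * u + (α - α * d - 1) * u ^ 2 - r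

lemma NS_eq (α : ℝ) (d : ℕ) (r u s : ℝ) : NS α d r u s = s * (auxq α d r u - α ^ 2 * s ^ 2) := by
  unfold NS auxq; ring

/-- clamp -/
noncomputable def auxc (a b u : ℝ) : ℝ := max a (min u b)

lemma auxc_mem {a b : ℝ} (h : a ≤ b) (u : ℝ) : auxc a b u ∈ Icc a b :=
  ⟨le_max_left _ _, max_le h (min_le_right _ _)⟩

lemma auxc_eq {a b u : ℝ} (h : u ∈ Icc a b) : auxc a b u = u := by
  unfold auxc; rw [min_eq_left h.2, max_eq_right h.1]

lemma auxc_of_le {a b u : ℝ} (h : u ≤ a) : auxc a b u = a := by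
  unfold auxc; exact max_eq_left ((min_le_left _ _).trans h)

lemma auxc_of_ge {a b u : ℝ} (hab : a ≤ b) (h : b ≤ u) : auxc a b u = b := by
  unfold auxc; rw [min_eq_right h, max_eq_right hab]

lemma auxc_cont (a b : ℝ) : Continuous (auxc a b) := by unfold auxc; fun_prop

lemma auxc_lip (a b : ℝ) : LipschitzWith 1 (auxc a b) := by
  unfold auxc
  exact (LipschitzWith.id.min_const b).const_max a

lemma auxc_dist (a b u v : ℝ) : dist (auxc a b u) (auxc a b v) ≤ dist u v := by
  simpa using (auxc_lip a b).dist_le_mul u v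

/-- regular part of the vector field near infinity -/
noncomputable def auxh (α : ℝ) (P : ℝ → ℝ) (p : (ℝ × ℝ) × ℝ) : ℝ :=
  Real.exp (-(2 * p.1.2)) * P p.1.1 /
    (α ^ 2 + (1 + p.1.1) ^ 2 * (p.2 ^ 2 * Real.exp (-(2 * p.1.2))))

lemma auxh_den {α : ℝ} (hα : 0 < α) (p : (ℝ × ℝ) × ℝ) :
    0 < α ^ 2 + (1 + p.1.1) ^ 2 * (p.2 ^ 2 * Real.exp (-(2 * p.1.2))) := by
  positivity

lemma auxh_contDiff {α : ℝ} (hα : 0 < α) {P : ℝ → ℝ} (hP : ContDiff ℝ 1 P) :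
    ContDiff ℝ 1 (auxh α P) := by
  unfold auxh
  refine ContDiff.div ?_ ?_ fun p => (auxh_den hα p).ne'
  · fun_prop
  · fun_prop

lemma auxh_bounds {α : ℝ} (hα : 0 < α) {P : ℝ → ℝ} (hP : ContDiff ℝ 1 P) {u0 : ℝ} (hu0 : u0 ≤ 0) :
    Continuous (fun p : (ℝ × ℝ) × ℝ => auxh α P ((auxc u0 0 (u0 + p.1.1), auxc (-1) 1 p.1.2), p.2)) ∧
    ∃ C K : ℝ, 0 ≤ C ∧ 0 ≤ K ∧
      (∀ p : ℝ × ℝ, ∀ x ∈ Icc (0:ℝ) 1, |auxh α P ((auxc u0 0 (u0 + p.1), auxc (-1) 1 p.2), x)| ≤ C) ∧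
      (∀ p q : ℝ × ℝ, ∀ x ∈ Icc (0:ℝ) 1, |auxh α P ((auxc u0 0 (u0 + p.1), auxc (-1) 1 p.2), x)
        - auxh α P ((auxc u0 0 (u0 + q.1), auxc (-1) 1 q.2), x)| ≤ K * dist p q) := by
  have hc := auxh_contDiff hα hP
  have c1 := auxc_cont u0 0
  have c2 := auxc_cont (-1) 1
  refine ⟨hc.continuous.comp (by fun_prop), ?_⟩
  set s : Set ((ℝ × ℝ) × ℝ) := (Icc u0 0 ×ˢ Icc (-1) 1) ×ˢ Icc 0 1 with hs
  have hsc : IsCompact s := (isCompact_Icc.prod isCompact_Icc).prod isCompact_Icc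
  have hsv : Convex ℝ s := ((convex_Icc _ _).prod (convex_Icc _ _)).prod (convex_Icc _ _)
  obtain ⟨K, hK⟩ := hc.contDiffOn.exists_lipschitzOnWith one_ne_zero hsv hsc
  obtain ⟨C, hC⟩ := hsc.exists_bound_of_continuousOn hc.continuous.continuousOn
  have hm : ∀ p : ℝ × ℝ, ∀ x ∈ Icc (0:ℝ) 1, ((auxc u0 0 (u0 + p.1), auxc (-1) 1 p.2), x) ∈ s :=
    fun p x hx => ⟨⟨auxc_mem hu0 _, auxc_mem (by norm_num) _⟩, hx⟩
  refine ⟨C, K, (norm_nonneg _).trans (hC _ (hm 0 0 (by simp))), K.2, fun p x hx => hC _ (hm p x hx), ?_⟩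
  intro p q x hx
  have h1 := hK.dist_le_mul _ (hm p x hx) _ (hm q x hx)
  rw [Real.dist_eq] at h1
  refine h1.trans (mul_le_mul_of_nonneg_left ?_ K.2)
  rw [Prod.dist_eq, Prod.dist_eq, Prod.dist_eq]
  simp only [dist_self]
  refine max_le (max_le_max ?_ (auxc_dist _ _ _ _)) (le_max_of_le_left dist_nonneg)
  refine (auxc_dist _ _ _ _).trans ?_
  simp

lemma alg_U {α : ℝ} (hα : 0 < α) {d : ℕ} {r u0 u w : ℝ} (h0 : α * d * u0 = -(r - 1)) (hw : 0 < w) :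
    NU α d r u w⁻¹ / Dfun α u w⁻¹ = -d * (u - u0) +
      w ^ 2 * (d * (u - u0) * (1 + u) ^ 2 - u * (u + 1) * (r + u)) / (α ^ 2 + (1 + u) ^ 2 * w ^ 2) := by
  have hr : r = 1 - α * d * u0 := by linarith
  have hd1 : α ^ 2 + (1 + u) ^ 2 * w ^ 2 ≠ 0 := by positivity
  have hd2 : (1 + u) ^ 2 + α ^ 2 * (w⁻¹) ^ 2 ≠ 0 := by positivity
  have hd3 : (1 + u) ^ 2 + α ^ 2 * (w⁻¹) ^ 2 = (α ^ 2 + (1 + u) ^ 2 * w ^ 2) / w ^ 2 := by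
    field_simp
    ring
  unfold NU Dfun
  rw [hd3]
  subst hr
  field_simp
  ring

lemma alg_S {α : ℝ} (hα : 0 < α) {d : ℕ} {r u w : ℝ} (hw : 0 < w) :
    (auxq α d r u - α ^ 2 * (w⁻¹) ^ 2) / Dfun α u w⁻¹ = -1 +
      w ^ 2 * (auxq α d r u + (1 + u) ^ 2) / (α ^ 2 + (1 + u) ^ 2 * w ^ 2) := by
  have hd1 : α ^ 2 + (1 + u) ^ 2 * w ^ 2 ≠ 0 := by positivity
  have hd3 : (1 + u) ^ 2 + α ^ 2 * (w⁻¹) ^ 2 = (α ^ 2 + (1 + u) ^ 2 * w ^ 2) / w ^ 2 := by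
    field_simp
    ring
  unfold Dfun
  rw [hd3]
  field_simp
  ring

lemma aux_local {α : ℝ} (hα : 0 < α) {d : ℕ} {r u0 : ℝ} (h0 : α * d * u0 = -(r - 1))
    (hr : 1 < r) (hu0 : u0 < 0) (hu1 : -1 < u0) :
    ∃ (ξ₁ : ℝ) (U Y : ℝ → ℝ), (∀ ξ < ξ₁,
      HasDerivAt U (NU α d r (U ξ) (Real.exp (Y ξ)) / Dfun α (U ξ) (Real.exp (Y ξ))) ξ ∧
      HasDerivAt Y ((auxq α d r (U ξ) - α ^ 2 * (Real.exp (Y ξ)) ^ 2) /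
        Dfun α (U ξ) (Real.exp (Y ξ))) ξ ∧ U ξ ∈ Icc u0 0) ∧
      Tendsto U atBot (𝓝 u0) ∧ Tendsto (fun ξ => ξ + Y ξ) atBot (𝓝 0) := by
  set P : ℝ → ℝ := fun u => d * (u - u0) * (1 + u) ^ 2 - u * (u + 1) * (r + u) with hPdef
  set Q : ℝ → ℝ := fun u => auxq α d r u + (1 + u) ^ 2 with hQdef
  have hP : ContDiff ℝ 1 P := by simp only [hPdef]; fun_prop
  have hQ : ContDiff ℝ 1 Q := by simp only [hQdef, auxq]; fun_prop
  have hPpos : ∀ u ∈ Icc u0 0, 0 ≤ P u := by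
    intro u hu
    simp only [hPdef]
    have h1 : 0 ≤ d * (u - u0) * (1 + u) ^ 2 :=
      mul_nonneg (mul_nonneg d.cast_nonneg (by linarith [hu.1])) (sq_nonneg _)
    have h2 : 0 ≤ (-u) * ((u + 1) * (r + u)) :=
      mul_nonneg (by linarith [hu.2]) (mul_nonneg (by linarith [hu.1]) (by linarith [hu.1]))
    linarith
  obtain ⟨c1, C1, K1, hC1, hK1, b1, l1⟩ := auxh_bounds hα hP hu0.le
  obtain ⟨c2, C2, K2, hC2, hK2, b2, l2⟩ := auxh_bounds hα hQ hu0.le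
  set C := max C1 C2 with hC
  have hC0 : 0 ≤ C := hC1.trans (le_max_left _ _)
  set H1 : (ℝ × ℝ) × ℝ → ℝ :=
    fun p => auxh α P ((auxc u0 0 (u0 + p.1.1), auxc (-1) 1 p.1.2), p.2) with hH1
  set H2 : (ℝ × ℝ) × ℝ → ℝ :=
    fun p => auxh α Q ((auxc u0 0 (u0 + p.1.1), auxc (-1) 1 p.1.2), p.2) with hH2
  have b1' : ∀ p, ∀ x ∈ Icc (0:ℝ) 1, |H1 (p, x)| ≤ C := fun p x hx => (b1 p x hx).trans (le_max_left _ _)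
  have b2' : ∀ p, ∀ x ∈ Icc (0:ℝ) 1, |H2 (p, x)| ≤ C := fun p x hx => (b2 p x hx).trans (le_max_right _ _)
  obtain ⟨X, hX0, hX1, g, hg, hgx⟩ := aux_fixed d (H1 := H1) (H2 := H2) c1 c2 (C := C) (K := max K1 K2)
    hC0 (hK1.trans (le_max_left _ _)) b1' b2'
    (fun p q x hx => (l1 p q x hx).trans (mul_le_mul_of_nonneg_right (le_max_left _ _) dist_nonneg))
    (fun p q x hx => (l2 p q x hx).trans (mul_le_mul_of_nonneg_right (le_max_right _ _) dist_nonneg))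
  set φ1 : ℝ → ℝ := fun y => H1 (g y, y) with hφ1
  set φ2 : ℝ → ℝ := fun y => H2 (g y, y) with hφ2
  have cφ1 : Continuous φ1 := c1.comp (hg.prodMk continuous_id)
  have cφ2 : Continuous φ2 := c2.comp (hg.prodMk continuous_id)
  have g1b : ∀ x ∈ Icc 0 X, |(g x).1| ≤ x ^ 2 * C := by
    intro x hx
    rw [hgx x hx]
    exact auxI_bound _ hx.1 fun y hy => b1' _ _ ⟨hy.1, hy.2.trans (hx.2.trans hX1)⟩
  have g2b : ∀ x ∈ Icc 0 X, |(g x).2| ≤ x ^ 2 * C := by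
    intro x hx
    rw [hgx x hx]
    exact auxI_bound _ hx.1 fun y hy => b2' _ _ ⟨hy.1, hy.2.trans (hx.2.trans hX1)⟩
  have g1n : ∀ x ∈ Icc 0 X, 0 ≤ (g x).1 := by
    intro x hx
    rw [hgx x hx]
    refine auxI_nonneg _ hx.1 fun y hy => ?_
    simp only [hφ1, hH1, auxh]
    exact div_nonneg (mul_nonneg (Real.exp_pos _).le (hPpos _ (auxc_mem hu0.le _)))
      (by positivity)
  have hg0 : g 0 = 0 := by
    have h0m : (0:ℝ) ∈ Icc 0 X := ⟨le_rfl, hX0.le⟩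
    have h1 := g1b 0 h0m
    have h2 := g2b 0 h0m
    ext
    · simpa using h1
    · simpa using h2
  -- small neighbourhood
  obtain ⟨X', hX'0, hX'X, hX'⟩ : ∃ X' > 0, X' ≤ X ∧ ∀ x ∈ Icc 0 X', x ^ 2 * C ≤ min (-u0) 1 := by
    have hm : 0 < min (-u0) 1 := lt_min (by linarith) one_pos
    refine ⟨min X (min (-u0) 1 / (C + 1)), lt_min hX0 (by positivity), min_le_left _ _, ?_⟩
    intro x hx
    have hx1 : x ≤ 1 := hx.2.trans ((min_le_left _ _).trans hX1)
    have hx2 : x ≤ min (-u0) 1 / (C + 1) := hx.2.trans (min_le_right _ _)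
    rw [le_div_iff₀ (by positivity)] at hx2
    have := hx.1
    have h3 : x ^ 2 ≤ x := by nlinarith
    nlinarith
  refine ⟨Real.log X', fun ξ => u0 + (g (Real.exp ξ)).1, fun ξ => -ξ + (g (Real.exp ξ)).2, ?_, ?_, ?_⟩
  · intro ξ hξ
    set x := Real.exp ξ with hx
    have hx0 : 0 < x := Real.exp_pos ξ
    have hxX' : x < X' := by rw [hx, ← Real.lt_log_iff_exp_lt hX'0]; exact hξ
    have hxm : x ∈ Icc 0 X := ⟨hx0.le, hxX'.le.trans hX'X⟩
    have hsm := hX' x ⟨hx0.le, hxX'.le⟩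
    have hz1 := g1n x hxm
    have hz2 : (g x).1 ≤ -u0 := (le_abs_self _).trans ((g1b x hxm).trans (hsm.trans (min_le_left _ _)))
    have hη : |(g x).2| ≤ 1 := (g2b x hxm).trans (hsm.trans (min_le_right _ _))
    have hmem : u0 + (g x).1 ∈ Icc u0 0 := ⟨by linarith, by linarith⟩
    have hev : ∀ᶠ y in 𝓝 x, y ∈ Icc 0 X := Icc_mem_nhds hx0 (hxX'.trans_le hX'X)
    have hd1 : HasDerivAt (fun y => (g y).1) ((-d * (g x).1) / x + x * φ1 x) x := by
      have h := auxI_deriv d cφ1 hx0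
      have he : (g x).1 = auxI (d + 1) φ1 x := by rw [hgx x hxm]
      rw [← he] at h
      exact h.congr_of_eventuallyEq (hev.mono fun y hy => by simp only [hgx y hy])
    have hd2 : HasDerivAt (fun y => (g y).2) (x * φ2 x) x := by
      have h := auxI_deriv 0 cφ2 hx0
      simp only [Nat.cast_zero, neg_zero, zero_mul, zero_div, zero_add] at h
      exact h.congr_of_eventuallyEq (hev.mono fun y hy => by simp only [hgx y hy])
    have hE := Real.hasDerivAt_exp ξ
    have hD1 := (hd1.comp ξ hE).const_add u0
    have hD2 := (hasDerivAt_neg ξ).add (hd2.comp ξ hE)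
    set w := x * Real.exp (-(g x).2) with hw
    have hw0 : 0 < w := mul_pos hx0 (Real.exp_pos _)
    have hwinv : Real.exp (-ξ + (g x).2) = w⁻¹ := by
      rw [hw, hx, ← Real.exp_add, ← Real.exp_neg]; congr 1; ring
    have hw2 : w ^ 2 = x ^ 2 * Real.exp (-(2 * (g x).2)) := by
      have he : Real.exp (-(2 * (g x).2)) = Real.exp (-(g x).2) ^ 2 := by
        rw [← Real.exp_nat_mul]; congr 1; push_cast; ring
      rw [hw, he, mul_pow]
    have hφ1x : φ1 x = auxh α P ((u0 + (g x).1, (g x).2), x) := by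
      simp only [hφ1, hH1]; rw [auxc_eq hmem, auxc_eq (abs_le.1 hη)]
    have hφ2x : φ2 x = auxh α Q ((u0 + (g x).1, (g x).2), x) := by
      simp only [hφ2, hH2]; rw [auxc_eq hmem, auxc_eq (abs_le.1 hη)]
    refine ⟨hD1.congr_deriv ?_, hD2.congr_deriv ?_, hmem⟩
    · rw [hwinv, alg_U hα h0 hw0, hφ1x, hw2]
      simp only [auxh, hPdef]
      rw [← hx]
      field_simp
      ring
    · rw [hwinv, alg_S hα hw0, hφ2x, hw2]
      simp only [auxh, hQdef]
      rw [← hx]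
      ring
  · have : Tendsto (fun ξ => u0 + (g (Real.exp ξ)).1) atBot (𝓝 (u0 + (g 0).1)) :=
      ((continuous_const.add (continuous_fst.comp hg)).tendsto 0).comp Real.tendsto_exp_atBot
    simpa [hg0] using this
  · have : Tendsto (fun ξ => (g (Real.exp ξ)).2) atBot (𝓝 ((g 0).2)) :=
      ((continuous_snd.comp hg).tendsto 0).comp Real.tendsto_exp_atBot
    simpa [hg0] using this


/-- the vector field in the variables `(u, log s)` -/
noncomputable def auxF (α : ℝ) (d : ℕ) (r : ℝ) (x : ℝ × ℝ) : ℝ × ℝ :=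
  (NU α d r x.1 (Real.exp x.2) / Dfun α x.1 (Real.exp x.2),
    (auxq α d r x.1 - α ^ 2 * (Real.exp x.2) ^ 2) / Dfun α x.1 (Real.exp x.2))

/-- the clamped vector field -/
noncomputable def auxG (α : ℝ) (d : ℕ) (r u0 : ℝ) (x : ℝ × ℝ) : ℝ × ℝ :=
  auxF α d r (auxc u0 0 x.1, x.2)

lemma Dfun_pos {α : ℝ} (hα : 0 < α) (u y : ℝ) : 0 < Dfun α u (Real.exp y) := by
  unfold Dfun; positivity

lemma auxF_contDiff {α : ℝ} (hα : 0 < α) (d : ℕ) (r : ℝ) : ContDiff ℝ 1 (auxF α d r) := by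
  have hD : ContDiff ℝ 1 fun x : ℝ × ℝ => Dfun α x.1 (Real.exp x.2) := by unfold Dfun; fun_prop
  unfold auxF
  refine ContDiff.prodMk ?_ ?_
  · refine ContDiff.div ?_ hD fun x => (Dfun_pos hα _ _).ne'
    unfold NU; fun_prop
  · refine ContDiff.div ?_ hD fun x => (Dfun_pos hα _ _).ne'
    unfold auxq; fun_prop

lemma auxG_lip {α : ℝ} (hα : 0 < α) (d : ℕ) (r : ℝ) {u0 : ℝ} (hu0 : u0 ≤ 0) (R : ℝ) :
    ∃ K, LipschitzOnWith K (auxG α d r u0) (Metric.closedBall 0 R) := by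
  obtain ⟨K, hK⟩ := (auxF_contDiff hα d r).contDiffOn.exists_lipschitzOnWith one_ne_zero
    ((convex_Icc u0 0).prod (convex_Icc (-R) R)) (isCompact_Icc.prod isCompact_Icc)
  have h1 : LipschitzWith 1 (fun x : ℝ × ℝ => (auxc u0 0 x.1, x.2)) := by
    refine LipschitzWith.of_dist_le_mul fun x y => ?_
    simp only [NNReal.coe_one, one_mul]
    rw [Prod.dist_eq, Prod.dist_eq]
    exact max_le_max (auxc_dist _ _ _ _) le_rfl
  refine ⟨K * 1, hK.comp (h1.lipschitzOnWith) ?_⟩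
  intro x hx
  rw [mem_closedBall_zero_iff, norm_prod_le_iff] at hx
  exact ⟨auxc_mem hu0 _, abs_le.1 hx.2⟩

lemma aux_quot {α : ℝ} (hα : 0 < α) {u0 u s N a b : ℝ} (hu1 : -1 < u0) (hu : u0 ≤ u)
    (ha : 0 ≤ a) (hb : 0 ≤ b) (hN : |N| ≤ a * s ^ 2 + b) :
    |N / Dfun α u s| ≤ a / α ^ 2 + b / (1 + u0) ^ 2 := by
  have h1 : 0 < 1 + u0 := by linarith
  have h2 : (1 + u0) ^ 2 ≤ (1 + u) ^ 2 := pow_le_pow_left₀ h1.le (by linarith) 2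
  have hD : 0 < Dfun α u s := by
    unfold Dfun
    have : 0 < (1 + u0) ^ 2 := by positivity
    have h6 : 0 ≤ α ^ 2 * s ^ 2 := by positivity
    linarith
  rw [abs_div, abs_of_pos hD, div_le_iff₀ hD]
  refine hN.trans ?_
  have e1 : a * s ^ 2 = a / α ^ 2 * (α ^ 2 * s ^ 2) := by field_simp
  have e2 : b = b / (1 + u0) ^ 2 * (1 + u0) ^ 2 := by field_simp
  have p1 : 0 ≤ a / α ^ 2 := by positivity
  have p2 : 0 ≤ b / (1 + u0) ^ 2 := by positivity
  have p3 : 0 ≤ α ^ 2 * s ^ 2 := by positivity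
  have p4 : 0 ≤ (1 + u) ^ 2 := by positivity
  calc a * s ^ 2 + b = a / α ^ 2 * (α ^ 2 * s ^ 2) + b / (1 + u0) ^ 2 * (1 + u0) ^ 2 := by
        rw [← e1, ← e2]
    _ ≤ (a / α ^ 2 + b / (1 + u0) ^ 2) * Dfun α u s := by
        unfold Dfun
        nlinarith [mul_nonneg p1 p4, mul_nonneg p2 p3, mul_le_mul_of_nonneg_left h2 p2]

/-- `A(u) = α d u + r - 1` bounds. -/
lemma auxA_bounds {α : ℝ} (hα : 0 < α) {d : ℕ} {r u0 u : ℝ} (h0 : α * d * u0 = -(r - 1))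
    (hu : u ∈ Icc u0 0) : 0 ≤ α * d * u + r - 1 ∧ α * d * u + r - 1 ≤ r - 1 := by
  have hd : 0 ≤ α * d := by positivity
  constructor
  · nlinarith [mul_le_mul_of_nonneg_left hu.1 hd]
  · nlinarith [mul_le_mul_of_nonneg_left hu.2 hd]

lemma NU_eq (α : ℝ) (d : ℕ) (r u s : ℝ) :
    NU α d r u s = -(α * (α * d * u + r - 1)) * s ^ 2 - u * (u + 1) * (r + u) := by
  unfold NU; ring

lemma auxG_bdd {α : ℝ} (hα : 0 < α) (d : ℕ) {r u0 : ℝ} (h0 : α * d * u0 = -(r - 1))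
    (hr : 1 < r) (hu0 : u0 < 0) (hu1 : -1 < u0) : ∃ L, ∀ x, ‖auxG α d r u0 x‖ ≤ L := by
  have hcc : IsCompact (Icc u0 0) := isCompact_Icc
  obtain ⟨B1, hB1⟩ := hcc.exists_bound_of_continuousOn
    (f := fun u : ℝ => u * (u + 1) * (r + u)) (by fun_prop)
  obtain ⟨B2, hB2⟩ := hcc.exists_bound_of_continuousOn
    (f := fun u : ℝ => auxq α d r u) (by unfold auxq; fun_prop)
  have hB10 : 0 ≤ B1 := (norm_nonneg _).trans (hB1 0 ⟨hu0.le, le_rfl⟩)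
  have hB20 : 0 ≤ B2 := (norm_nonneg _).trans (hB2 0 ⟨hu0.le, le_rfl⟩)
  refine ⟨max (α * (r - 1) / α ^ 2 + B1 / (1 + u0) ^ 2) (α ^ 2 / α ^ 2 + B2 / (1 + u0) ^ 2), fun x => ?_⟩
  have hm := auxc_mem hu0.le x.1
  refine norm_prod_le_iff.2 ⟨le_max_of_le_left ?_, le_max_of_le_right ?_⟩
  · refine aux_quot hα hu1 hm.1 (mul_nonneg hα.le (by linarith)) hB10 ?_
    rw [NU_eq]
    have h1 := hB1 _ hm
    have h2 := auxA_bounds hα h0 hm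
    rw [Real.norm_eq_abs] at h1
    refine (abs_sub _ _).trans (add_le_add ?_ h1)
    rw [abs_mul, abs_neg, abs_mul, abs_of_pos hα, abs_of_nonneg h2.1, abs_of_nonneg (sq_nonneg _)]
    exact mul_le_mul_of_nonneg_right (mul_le_mul_of_nonneg_left h2.2 hα.le) (sq_nonneg _)
  · refine aux_quot hα hu1 hm.1 (by positivity) hB20 ?_
    have h1 := hB2 _ hm
    rw [Real.norm_eq_abs] at h1
    refine (abs_sub _ _).trans ?_
    rw [abs_of_nonneg (by positivity : 0 ≤ α ^ 2 * Real.exp x.2 ^ 2)]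
    simp only at *
    linarith

lemma auxE_pos {α : ℝ} (hα : 0 < α) {d : ℕ} (hd : 1 ≤ d) {r u0 u : ℝ} (h0 : α * d * u0 = -(r - 1))
    (hr : 1 < r) (hu1 : -1 < u0) (hu : u ∈ Icc u0 0) :
    0 < -(α * (u * (u + 1) * (r + u)) + auxq α d r u * (α * d * u + r - 1)) := by
  obtain ⟨hA0, hA1⟩ := auxA_bounds hα h0 hu
  set A := α * d * u + r - 1 with hA
  obtain ⟨k, hk⟩ : ∃ k : ℝ, k = (d : ℝ) - 1 := ⟨_, rfl⟩
  have hk0 : 0 ≤ k := by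
    have : (1:ℝ) ≤ d := by exact_mod_cast hd
    linarith
  have hdk : (d:ℝ) = k + 1 := by linarith
  obtain ⟨v, hv⟩ : ∃ v : ℝ, v = -(α * u) := ⟨_, rfl⟩
  have hv0 : 0 ≤ v := by rw [hv]; nlinarith [hu.2]
  set B := A + v with hB
  have hBeq : B = r - 1 - k * v := by rw [hB, hA, hdk, hv]; ring
  have hB0 : 0 < B := by
    rcases hv0.eq_or_lt with h | h
    · rw [hBeq, ← h]; linarith
    · linarith
  have hu2 : 0 < 1 + u := by linarith [hu.1]
  have key : -(α * (u * (u + 1) * (r + u)) + auxq α d r u * A) =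
      (1 + u) * (r + u) * B + v * A * (r - 1) - k * v * A * (1 + u) := by
    unfold auxq
    rw [hB, hv, hA, hdk]; ring
  rw [key]
  have h1 : 0 ≤ v * A * (r - 1) := mul_nonneg (mul_nonneg hv0 hA0) (by linarith)
  have h2 : k * v * A * (1 + u) ≤ (r - 1 - B) * B * (1 + u) := by
    refine mul_le_mul_of_nonneg_right ?_ hu2.le
    have : k * v = r - 1 - B := by linarith
    rw [this]
    exact mul_le_mul_of_nonneg_left (by linarith) (by rw [← this]; positivity)
  have h3 : 0 < (1 + u) * B * ((1 + u) + B) := by positivity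
  nlinarith

theorem aux_main {α : ℝ} (hα : 0 < α) {d : ℕ} (hd : 1 ≤ d) {r u0 : ℝ} (h0 : α * d * u0 = -(r - 1))
    (hr : 1 < r) (hu0 : u0 < 0) (hu1 : -1 < u0) :
    ∃ U Y : ℝ → ℝ, (∀ ξ,
      HasDerivAt U (NU α d r (U ξ) (Real.exp (Y ξ)) / Dfun α (U ξ) (Real.exp (Y ξ))) ξ ∧
      HasDerivAt Y ((auxq α d r (U ξ) - α ^ 2 * (Real.exp (Y ξ)) ^ 2) /
        Dfun α (U ξ) (Real.exp (Y ξ))) ξ ∧ u0 < U ξ ∧ U ξ < 0) ∧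
      Tendsto U atBot (𝓝 u0) ∧ Tendsto (fun ξ => ξ + Y ξ) atBot (𝓝 0) := by
  obtain ⟨ξ₁, V, Z, hVZ, hVlim, hZlim⟩ := aux_local hα h0 hr hu0 hu1
  obtain ⟨L, hL⟩ := auxG_bdd hα d h0 hr hu0 hu1
  have hlip := auxG_lip hα d r hu0.le
  obtain ⟨x, hx0, hx⟩ := aux_global hlip hL (ξ₁ - 2) (V (ξ₁ - 2), Z (ξ₁ - 2))
  have heq : ∀ t < ξ₁ - 1, x t = (V t, Z t) := by
    intro t ht
    have := aux_uniq hlip (f := x) (g := fun t => (V t, Z t)) (a := min t (ξ₁ - 3)) (b := ξ₁ - 1)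
      (t₀ := ξ₁ - 2) ⟨(min_le_right _ _).trans_lt (by linarith), by linarith⟩
      (fun s _ => hx s) ?_ hx0
    · exact this ⟨min_le_left _ _, ht.le⟩
    · intro s hs
      obtain ⟨h1, h2, h3⟩ := hVZ s (by linarith [hs.2])
      have : auxG α d r u0 (V s, Z s) = auxF α d r (V s, Z s) := by
        unfold auxG; simp only; rw [auxc_eq h3]
      rw [this]
      exact h1.prodMk h2
  have hU : ∀ t, HasDerivAt (fun t => (x t).1) (auxG α d r u0 (x t)).1 t := fun t =>
    (hasFDerivAt_fst (𝕜 := ℝ) (p := x t)).comp_hasDerivAt t (hx t)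
  have hY : ∀ t, HasDerivAt (fun t => (x t).2) (auxG α d r u0 (x t)).2 t := fun t =>
    (hasFDerivAt_snd (𝕜 := ℝ) (p := x t)).comp_hasDerivAt t (hx t)
  have hevV : (fun t => (x t).1) =ᶠ[atBot] V := by
    filter_upwards [eventually_lt_atBot (ξ₁ - 1)] with t ht
    rw [heq t ht]
  have hevZ : (fun t => t + (x t).2) =ᶠ[atBot] fun t => t + Z t := by
    filter_upwards [eventually_lt_atBot (ξ₁ - 1)] with t ht
    rw [heq t ht]
  have hUlim : Tendsto (fun t => (x t).1) atBot (𝓝 u0) := hVlim.congr' hevV.symm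
  have hpos : ∀ t, (x t).1 ≤ u0 → 0 < (auxG α d r u0 (x t)).1 := by
    intro t ht
    simp only [auxG, auxF]
    rw [auxc_of_le ht]
    refine div_pos ?_ (Dfun_pos hα _ _)
    rw [NU_eq, show α * d * u0 + r - 1 = 0 by linarith]
    have : 0 < (-u0) * ((u0 + 1) * (r + u0)) :=
      mul_pos (by linarith) (mul_pos (by linarith) (by linarith))
    linarith
  have hneg : ∀ t, -(x t).1 ≤ 0 → 0 < -(auxG α d r u0 (x t)).1 := by
    intro t ht
    simp only [auxG, auxF]
    rw [auxc_of_ge hu0.le (by linarith), ← neg_div]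
    refine div_pos ?_ (Dfun_pos hα _ _)
    rw [NU_eq]
    have : 0 < (α * (r - 1)) * Real.exp (x t).2 ^ 2 :=
      mul_pos (mul_pos hα (by linarith)) (by positivity)
    linarith
  have hlow : ∀ t, u0 < (x t).1 := by
    intro t
    by_contra! h
    have hall : ∀ s ≤ t, (x s).1 ≤ u0 := by
      intro s hs
      by_contra! h'
      exact absurd (aux_inv hU hpos hs h') (not_lt.2 h)
    have hmono : StrictMonoOn (fun t => (x t).1) (Iic t) := by
      refine strictMonoOn_of_deriv_pos (convex_Iic t)
        (fun s _ => (hU s).continuousAt.continuousWithinAt) ?_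
      intro s hs
      rw [interior_Iic] at hs
      rw [(hU s).deriv]
      exact hpos s (hall s (le_of_lt hs))
    have h1 : (x (t - 1)).1 < (x t).1 := hmono (by simp) self_mem_Iic (by linarith)
    have h2 : u0 ≤ (x (t - 1)).1 := by
      refine le_of_tendsto hUlim ?_
      filter_upwards [eventually_le_atBot (t - 1)] with s hs
      exact hmono.monotoneOn (by simp; linarith) (by simp) hs
    linarith
  have hhigh : ∀ t, (x t).1 < 0 := by
    intro t
    obtain ⟨s, hs1, hs2⟩ := ((hUlim.eventually (gt_mem_nhds hu0)).and (eventually_le_atBot t)).exists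
    have := aux_inv (f := fun t => -(x t).1) (fun t => (hU t).neg) hneg hs2 (by linarith)
    linarith
  refine ⟨fun t => (x t).1, fun t => (x t).2, fun t => ?_, hUlim, hZlim.congr' hevZ.symm⟩
  have hG : auxG α d r u0 (x t) = auxF α d r (x t) := by
    unfold auxG; rw [auxc_eq ⟨(hlow t).le, (hhigh t).le⟩]
  have h1 := hU t
  have h2 := hY t
  rw [hG] at h1 h2
  exact ⟨h1, h2, hlow t, hhigh t⟩

theorem aux_forward {α : ℝ} (hα : 0 < α) {d : ℕ} (hd : 1 ≤ d) {r u0 : ℝ} (h0 : α * d * u0 = -(r - 1))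
    (hr : 1 < r) (hu0 : u0 < 0) (hu1 : -1 < u0) {U Y : ℝ → ℝ} (h : ∀ ξ,
      HasDerivAt U (NU α d r (U ξ) (Real.exp (Y ξ)) / Dfun α (U ξ) (Real.exp (Y ξ))) ξ ∧
      HasDerivAt Y ((auxq α d r (U ξ) - α ^ 2 * (Real.exp (Y ξ)) ^ 2) /
        Dfun α (U ξ) (Real.exp (Y ξ))) ξ ∧ u0 < U ξ ∧ U ξ < 0) :
    Tendsto U atTop (𝓝 0) ∧ Tendsto (fun ξ => Real.exp (Y ξ)) atTop (𝓝 0) := by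
  have hd0 : (0:ℝ) < d := by exact_mod_cast hd
  have hr1 : 0 < r - 1 := by linarith
  have hm : ∀ t, U t ∈ Icc u0 0 := fun t => ⟨(h t).2.2.1.le, (h t).2.2.2.le⟩
  set A : ℝ → ℝ := fun t => α * d * U t + r - 1 with hAdef
  have hA0 : ∀ t, 0 < A t := by
    intro t
    have h1 : α * d * u0 < α * d * U t := mul_lt_mul_of_pos_left (h t).2.2.1 (by positivity)
    simp only [hAdef]; linarith
  have hA1 : ∀ t, A t ≤ r - 1 := fun t => (auxA_bounds hα h0 (hm t)).2
  obtain ⟨m, hmm, hmin⟩ := (isCompact_Icc (a := u0) (b := 0)).exists_isMinOn (nonempty_Icc.2 hu0.le)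
    (f := fun u => -(α * (u * (u + 1) * (r + u)) + auxq α d r u * (α * d * u + r - 1)))
    (by unfold auxq; fun_prop)
  set ε := -(α * (m * (m + 1) * (r + m)) + auxq α d r m * (α * d * m + r - 1)) with hε
  have hε0 : 0 < ε := auxE_pos hα hd h0 hr hu1 hmm
  have hE : ∀ t, ε ≤ -(α * (U t * (U t + 1) * (r + U t)) + auxq α d r (U t) * A t) :=
    fun t => hmin (hm t)
  set D : ℝ → ℝ := fun t => Dfun α (U t) (Real.exp (Y t)) with hDdef
  have hD0 : ∀ t, 0 < D t := fun t => Dfun_pos hα _ _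
  set Λ : ℝ → ℝ := fun t => d * Y t - Real.log (A t) with hΛ
  have hAd : ∀ t, HasDerivAt A (α * d * (NU α d r (U t) (Real.exp (Y t)) / D t)) t := fun t =>
    (((h t).1.const_mul (α * d)).add_const r).sub_const 1
  have hΛd : ∀ t, HasDerivAt Λ (-(d * (-(α * (U t * (U t + 1) * (r + U t)) + auxq α d r (U t) * A t)) /
      (A t * D t))) t := by
    intro t
    refine (((h t).2.1.const_mul (d:ℝ)).sub ((hAd t).log (hA0 t).ne')).congr_deriv ?_
    have a0 := (hA0 t).ne'
    have d0 := (hD0 t).ne'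
    change d * ((auxq α d r (U t) - α ^ 2 * (Real.exp (Y t)) ^ 2) / D t) - _ = _
    rw [NU_eq]
    change d * ((auxq α d r (U t) - α ^ 2 * (Real.exp (Y t)) ^ 2) / D t) -
      α * d * ((-(α * A t) * Real.exp (Y t) ^ 2 - U t * (U t + 1) * (r + U t)) / D t) / A t = _
    field_simp
    ring
  have hΛb : ∀ t, ∀ B, D t ≤ B → -(d * (-(α * (U t * (U t + 1) * (r + U t)) + auxq α d r (U t) * A t)) /
      (A t * D t)) ≤ -(d * ε / ((r - 1) * B)) := by
    intro t B hB
    refine neg_le_neg ?_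
    refine div_le_div₀ ?_ (mul_le_mul_of_nonneg_left (hE t) hd0.le) (mul_pos (hA0 t) (hD0 t))
      (mul_le_mul (hA1 t) hB (hD0 t).le hr1.le)
    exact mul_nonneg hd0.le (hε0.le.trans (hE t))
  have hanti : Antitone Λ := by
    refine antitone_of_deriv_nonpos (fun t => (hΛd t).differentiableAt) fun t => ?_
    rw [(hΛd t).deriv]
    refine (hΛb t _ le_rfl).trans ?_
    have := hD0 t
    have : 0 ≤ d * ε / ((r - 1) * D t) := by positivity
    linarith
  have hYle : ∀ t, Y t ≤ (Λ t + Real.log (r - 1)) / d := by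
    intro t
    rw [le_div_iff₀ hd0]
    have := Real.log_le_log (hA0 t) (hA1 t)
    simp only [hΛ]
    linarith
  set M := Real.exp ((Λ 0 + Real.log (r - 1)) / d) with hM
  have hSM : ∀ t, 0 ≤ t → Real.exp (Y t) ≤ M := by
    intro t ht
    refine Real.exp_le_exp.2 ((hYle t).trans ?_)
    refine div_le_div_of_nonneg_right ?_ hd0.le
    linarith [hanti ht]
  set B := 1 + α ^ 2 * M ^ 2 with hBdef
  have hB0 : 0 < B := by positivity
  have hDB : ∀ t, 0 ≤ t → D t ≤ B := by
    intro t ht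
    have h1 : (1 + U t) ^ 2 ≤ 1 := pow_le_one₀ (by linarith [(hm t).1]) (by linarith [(hm t).2])
    have h2 : Real.exp (Y t) ^ 2 ≤ M ^ 2 := pow_le_pow_left₀ (Real.exp_pos _).le (hSM t ht) 2
    have h3 := mul_le_mul_of_nonneg_left h2 (sq_nonneg α)
    simp only [hDdef, Dfun, hBdef]
    linarith
  set c := d * ε / ((r - 1) * B) with hc
  have hc0 : 0 < c := by positivity
  have hanti2 : AntitoneOn (fun t => Λ t + c * t) (Ici 0) := by
    have hder : ∀ t, HasDerivAt (fun t => Λ t + c * t) (_ + c * 1) t := fun t =>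
      (hΛd t).add ((hasDerivAt_id t).const_mul c)
    refine antitoneOn_of_deriv_nonpos (convex_Ici 0)
      (fun t _ => (hder t).continuousAt.continuousWithinAt)
      (fun t _ => (hder t).differentiableAt.differentiableWithinAt) ?_
    intro t ht
    rw [interior_Ici] at ht
    rw [(hder t).deriv]
    linarith [hΛb t B (hDB t (le_of_lt ht))]
  have hYlim : Tendsto Y atTop atBot := by
    have h1 : Tendsto (fun t : ℝ => (Λ 0 + Real.log (r - 1) + -(c * t)) / d) atTop atBot := by
      refine Tendsto.atBot_div_const hd0 ?_
      refine tendsto_atBot_add_const_left _ _ ?_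
      exact tendsto_neg_atTop_atBot.comp (tendsto_id.const_mul_atTop hc0)
    refine tendsto_atBot_mono' _ ?_ h1
    filter_upwards [eventually_ge_atTop 0] with t ht
    refine (hYle t).trans (div_le_div_of_nonneg_right ?_ hd0.le)
    have : Λ t + c * t ≤ Λ 0 + c * 0 := hanti2 self_mem_Ici ht ht
    linarith
  have hSlim : Tendsto (fun ξ => Real.exp (Y ξ)) atTop (𝓝 0) := Real.tendsto_exp_atBot.comp hYlim
  refine ⟨?_, hSlim⟩
  have h1u : 0 < 1 + u0 := by linarith
  have hW : Tendsto (fun t => -U t) atTop (𝓝 0) := by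
    refine aux_decay (c := (1 + u0) * (r - 1) / B)
      (g := fun t => α * (r - 1) / (1 + u0) ^ 2 * Real.exp (Y t) ^ 2) (by positivity)
      (fun t => by linarith [(hm t).2]) (fun t => (h t).1.neg) ?_ ?_
    · filter_upwards [eventually_ge_atTop 0] with t ht
      have hDl : (1 + u0) ^ 2 ≤ D t := by
        have h1 : (1 + u0) ^ 2 ≤ (1 + U t) ^ 2 := pow_le_pow_left₀ h1u.le (by linarith [(hm t).1]) 2
        simp only [hDdef, Dfun]
        nlinarith [sq_nonneg (α * Real.exp (Y t))]
      have hDt := hD0 t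
      have hw : 0 ≤ -U t := by linarith [(hm t).2]
      change -(NU α d r (U t) (Real.exp (Y t)) / D t) ≤ _
      rw [NU_eq]
      change -((-(α * A t) * Real.exp (Y t) ^ 2 - U t * (U t + 1) * (r + U t)) / D t) ≤ _
      have e1 : -((-(α * A t) * Real.exp (Y t) ^ 2 - U t * (U t + 1) * (r + U t)) / D t) =
          α * A t * Real.exp (Y t) ^ 2 / D t - (-U t) * ((1 + U t) * (r + U t)) / D t := by
        field_simp
        ring
      rw [e1]
      have e2 : α * A t * Real.exp (Y t) ^ 2 / D t ≤
          α * (r - 1) / (1 + u0) ^ 2 * Real.exp (Y t) ^ 2 := by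
        rw [div_mul_eq_mul_div]
        refine div_le_div₀ (by positivity) ?_ (by positivity) hDl
        exact mul_le_mul_of_nonneg_right (mul_le_mul_of_nonneg_left (hA1 t) hα.le) (sq_nonneg _)
      have e3 : (1 + u0) * (r - 1) / B * -U t ≤ (-U t) * ((1 + U t) * (r + U t)) / D t := by
        rw [div_mul_eq_mul_div, mul_comm _ (-U t)]
        have p1 : (1 + u0) * (r - 1) ≤ (1 + U t) * (r + U t) :=
          mul_le_mul (by linarith [(hm t).1]) (by linarith [(hm t).1]) hr1.le (by linarith [(hm t).1])
        have p2 : 0 ≤ (1 + u0) * (r - 1) := by positivity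
        exact div_le_div₀ (mul_nonneg hw (p2.trans p1)) (mul_le_mul_of_nonneg_left p1 hw) hDt (hDB t ht)
      linarith
    · simpa using (hSlim.pow 2).const_mul (α * (r - 1) / (1 + u0) ^ 2)
  simpa using hW.neg

/-- Existence of a globally defined `C^∞` solution of the autonomous system (⋆)
`Ū' = N_U(Ū,S̄)/D(Ū,S̄)`, `S̄' = N_S(Ū,S̄)/D(Ū,S̄)` with `S̄ > 0`, `-1 < Ū < 0`,
`e^ξ S̄(ξ) → 1` and `Ū(ξ) → -(r-1)/(αd)` as `ξ → -∞`, and `(Ū,S̄) → (0,0)` as `ξ → ∞`. -/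
theorem autonomous_system_global_solution
    (α : ℝ) (hα : 0 < α) (d : ℕ) (hd : 1 ≤ d)
    (r : ℝ) (hr : 1 < r) (hrd : α * d > r - 1) :
    ∃ U S : ℝ → ℝ,
      ContDiff ℝ (⊤ : ℕ∞) U ∧ ContDiff ℝ (⊤ : ℕ∞) S ∧
      (∀ ξ : ℝ,
        HasDerivAt U (NU α d r (U ξ) (S ξ) / Dfun α (U ξ) (S ξ)) ξ ∧
        HasDerivAt S (NS α d r (U ξ) (S ξ) / Dfun α (U ξ) (S ξ)) ξ) ∧
      (∀ ξ : ℝ, 0 < S ξ ∧ -1 < U ξ ∧ U ξ < 0) ∧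
      Filter.Tendsto (fun ξ => Real.exp ξ * S ξ) Filter.atBot (nhds 1) ∧
      Filter.Tendsto U Filter.atBot (nhds (-(r - 1) / (α * d))) ∧
      Filter.Tendsto (fun ξ => (U ξ, S ξ)) Filter.atTop (nhds ((0 : ℝ), (0 : ℝ))) := by
  have hd0 : (0:ℝ) < d := by exact_mod_cast hd
  have hαd : 0 < α * d := mul_pos hα hd0
  set u0 : ℝ := -(r - 1) / (α * d) with hu
  have h0 : α * d * u0 = -(r - 1) := by rw [hu]; field_simp
  have hu0 : u0 < 0 := div_neg_of_neg_of_pos (by linarith) hαd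
  have hu1 : -1 < u0 := by rw [hu, lt_div_iff₀ hαd]; linarith
  obtain ⟨U, Y, h, hl1, hl2⟩ := aux_main hα hd h0 hr hu0 hu1
  obtain ⟨hf1, hf2⟩ := aux_forward hα hd h0 hr hu0 hu1 h
  have hsol : ∀ ξ : ℝ,
      HasDerivAt U (NU α d r (U ξ) (Real.exp (Y ξ)) / Dfun α (U ξ) (Real.exp (Y ξ))) ξ ∧
      HasDerivAt (fun ξ => Real.exp (Y ξ))
        (NS α d r (U ξ) (Real.exp (Y ξ)) / Dfun α (U ξ) (Real.exp (Y ξ))) ξ := by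
    intro ξ
    refine ⟨(h ξ).1, (h ξ).2.1.exp.congr_deriv ?_⟩
    rw [NS_eq, mul_div_assoc]
  obtain ⟨hs1, hs2⟩ := aux_smooth hsol fun ξ => (Dfun_pos hα _ _).ne'
  refine ⟨U, fun ξ => Real.exp (Y ξ), hs1, hs2, hsol,
    fun ξ => ⟨Real.exp_pos _, hu1.trans (h ξ).2.2.1, (h ξ).2.2.2⟩, ?_, hl1, hf1.prodMk_nhds hf2⟩
  have := (Real.continuous_exp.tendsto 0).comp hl2
  rw [Real.exp_zero] at this
  refine this.congr fun ξ => ?_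
  simp [Real.exp_add]
end

section
/- Let α > 0, let d ≥ 1 be an integer, and let r be a real number with αd > r−1. Then there exist a constant M ≥ 8 and real sequences (a_n)_{n≥0} and (b_n)_{n≥−1} with b_{−1} = 1, a_n = 0 for all odd n, b_n = 0 for all even n, and |a_n| ≤ M^{n+1}, |b_n| ≤ M^{n+1} for all n, such that the functions Ū(ξ) = Σ_{n≥0} a_n e^{nξ} and S̄(ξ) = e^{−ξ} + Σ_{n≥1} b_n e^{nξ} converge absolutely for all ξ with e^{ξ} < 1/M and satisfy on that interval the system D(Ū(ξ), S̄(ξ))·Ū′(ξ) = N_U(Ū(ξ), S̄(ξ)) and D(Ū(ξ), S̄(ξ))·S̄′(ξ) = N_S(Ū(ξ), S̄(ξ)). -/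
open PowerSeries in
/-- truncated weighted `ℓ¹` norm of a power series -/
noncomputable def trN (ρ : ℝ) (n : ℕ) (f : PowerSeries ℝ) : ℝ :=
  ∑ k ∈ Finset.range n, |coeff k f| * ρ ^ k

namespace TaylorSol
open PowerSeries

lemma trN_add {ρ : ℝ} (hρ : 0 < ρ) (n : ℕ) (f g : PowerSeries ℝ) :
    trN ρ n (f + g) ≤ trN ρ n f + trN ρ n g := by
  unfold trN
  rw [← Finset.sum_add_distrib]
  refine Finset.sum_le_sum fun k _ => ?_
  rw [map_add, ← add_mul]
  exact mul_le_mul_of_nonneg_right (abs_add_le _ _) (by positivity)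

lemma trN_nonneg {ρ : ℝ} (hρ : 0 < ρ) (n : ℕ) (f : PowerSeries ℝ) : 0 ≤ trN ρ n f :=
  Finset.sum_nonneg fun k _ => by positivity

lemma trN_mul {ρ : ℝ} (hρ : 0 < ρ) (n : ℕ) (f g : PowerSeries ℝ) :
    trN ρ n (f * g) ≤ trN ρ n f * trN ρ n g := by
  unfold trN
  calc _ ≤ ∑ m ∈ Finset.range n, ∑ k ∈ Finset.range (m + 1),
        (|coeff k f| * ρ ^ k) * (|coeff (m - k) g| * ρ ^ (m - k)) := by
        refine Finset.sum_le_sum fun m _ => ?_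
        rw [coeff_mul, Finset.Nat.sum_antidiagonal_eq_sum_range_succ
          (fun i j => coeff i f * coeff j g)]
        refine (mul_le_mul_of_nonneg_right (Finset.abs_sum_le_sum_abs _ _)
          (by positivity)).trans (le_of_eq ?_)
        rw [Finset.sum_mul]
        refine Finset.sum_congr rfl fun k hk => ?_
        have hk' : k + (m - k) = m := by
          have := Finset.mem_range.1 hk; omega
        rw [abs_mul]
        nth_rewrite 2 [← hk']
        rw [pow_add]; ring
    _ = ∑ m ∈ Finset.range n, ∑ k ∈ Finset.range (n - m),
        (|coeff m f| * ρ ^ m) * (|coeff k g| * ρ ^ k) :=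
        Finset.sum_range_diag_flip n
          (fun i j => (|coeff i f| * ρ ^ i) * (|coeff j g| * ρ ^ j))
    _ ≤ _ := by
        rw [Finset.sum_mul_sum]
        refine Finset.sum_le_sum fun m _ => ?_
        refine Finset.sum_le_sum_of_subset_of_nonneg ?_ fun k _ _ => by positivity
        exact Finset.range_subset_range.2 (Nat.sub_le _ _)

lemma trN_C {ρ : ℝ} (n : ℕ) (c : ℝ) : trN ρ n (C c) ≤ |c| := by
  unfold trN
  cases n with
  | zero => simp
  | succ n =>
    rw [Finset.sum_range_succ']
    simp [coeff_C]

lemma trN_X {ρ : ℝ} (hρ : 0 < ρ) (n : ℕ) : trN ρ n X ≤ ρ := by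
  unfold trN
  rcases n with _ | _ | n
  · simpa using hρ.le
  · simpa using hρ.le
  · rw [Finset.sum_range_succ', Finset.sum_range_succ']
    simp [coeff_X]

/-- multiplier `q_n ↦ q_n / (2n+2+d)` -/
noncomputable def LL (d : ℕ) (f : PowerSeries ℝ) : PowerSeries ℝ :=
  mk fun n => coeff n f / (2 * n + 2 + d)

lemma trN_LL {ρ : ℝ} (hρ : 0 < ρ) (n d : ℕ) (f : PowerSeries ℝ) :
    trN ρ n (LL d f) ≤ trN ρ n f := by
  unfold trN LL
  refine Finset.sum_le_sum fun k _ => ?_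
  rw [coeff_mk, abs_div]
  refine mul_le_mul_of_nonneg_right (div_le_self (abs_nonneg _) ?_) (by positivity)
  rw [abs_of_nonneg (by positivity)]
  have : (0:ℝ) ≤ k := by positivity
  have : (0:ℝ) ≤ d := by positivity
  linarith

/-- Operators on pairs of power series which respect congruences and are bounded on balls. -/
def Good (F : PowerSeries ℝ → PowerSeries ℝ → PowerSeries ℝ) : Prop :=
  (∀ (n : ℕ) (f g f' g' : PowerSeries ℝ), (X : PowerSeries ℝ) ^ n ∣ f - f' →
    (X : PowerSeries ℝ) ^ n ∣ g - g' → (X : PowerSeries ℝ) ^ n ∣ F f g - F f' g') ∧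
  ∀ K : ℝ, ∃ B : ℝ, ∀ ρ : ℝ, 0 < ρ → ρ ≤ 1 → ∀ (n : ℕ) (f g : PowerSeries ℝ),
    trN ρ n f ≤ K → trN ρ n g ≤ K → trN ρ n (F f g) ≤ B

lemma Good.const (c : ℝ) : Good fun _ _ => C c :=
  ⟨fun _ _ _ _ _ _ _ => by simp, fun _ => ⟨|c|, fun _ _ _ n _ _ _ _ => trN_C n c⟩⟩

lemma Good.X : Good fun _ _ => X :=
  ⟨fun _ _ _ _ _ _ _ => by simp, fun _ => ⟨1, fun _ h h1 n _ _ _ _ => (trN_X h n).trans h1⟩⟩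

lemma Good.fst : Good fun f _ => f :=
  ⟨fun _ _ _ _ _ h _ => h, fun K => ⟨K, fun _ _ _ _ _ _ h _ => h⟩⟩

lemma Good.snd : Good fun _ g => g :=
  ⟨fun _ _ _ _ _ _ h => h, fun K => ⟨K, fun _ _ _ _ _ _ _ h => h⟩⟩

lemma Good.add {F G} (hF : Good F) (hG : Good G) : Good fun f g => F f g + G f g := by
  refine ⟨fun n f g f' g' h1 h2 => ?_, fun K => ?_⟩
  · rw [add_sub_add_comm]
    exact dvd_add (hF.1 n _ _ _ _ h1 h2) (hG.1 n _ _ _ _ h1 h2)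
  · obtain ⟨A, hA⟩ := hF.2 K
    obtain ⟨B, hB⟩ := hG.2 K
    exact ⟨A + B, fun ρ h h' n f g h1 h2 => (trN_add h n _ _).trans
      (add_le_add (hA ρ h h' n f g h1 h2) (hB ρ h h' n f g h1 h2))⟩

lemma Good.mul {F G} (hF : Good F) (hG : Good G) : Good fun f g => F f g * G f g := by
  refine ⟨fun n f g f' g' h1 h2 => ?_, fun K => ?_⟩
  · have : F f g * G f g - F f' g' * G f' g' =
      F f g * (G f g - G f' g') + (F f g - F f' g') * G f' g' := by ring
    rw [this]
    exact dvd_add (dvd_mul_of_dvd_right (hG.1 n _ _ _ _ h1 h2) _)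
      (dvd_mul_of_dvd_left (hF.1 n _ _ _ _ h1 h2) _)
  · obtain ⟨A, hA⟩ := hF.2 K
    obtain ⟨B, hB⟩ := hG.2 K
    exact ⟨A * B, fun ρ h h' n f g h1 h2 => (trN_mul h n _ _).trans
      (mul_le_mul (hA ρ h h' n f g h1 h2) (hB ρ h h' n f g h1 h2) (trN_nonneg h _ _)
        ((trN_nonneg h _ _).trans (hA ρ h h' n f g h1 h2)))⟩

lemma Good.LL {F} (d : ℕ) (hF : Good F) : Good fun f g => LL d (F f g) := by
  refine ⟨fun n f g f' g' h1 h2 => ?_, fun K => ?_⟩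
  · have := hF.1 n _ _ _ _ h1 h2
    rw [X_pow_dvd_iff] at this ⊢
    intro m hm
    have h := this m hm
    rw [map_sub] at h ⊢
    simp only [TaylorSol.LL, coeff_mk]
    rw [← sub_div, h, zero_div]
  · obtain ⟨A, hA⟩ := hF.2 K
    exact ⟨A, fun ρ h h' n f g h1 h2 => (trN_LL h n d _).trans (hA ρ h h' n f g h1 h2)⟩

lemma Good.sub {F G} (hF : Good F) (hG : Good G) : Good fun f g => F f g - G f g := by
  have := hF.add ((Good.const (-1)).mul hG)
  simpa [sub_eq_add_neg] using this

lemma trN_coeff {ρ K : ℝ} {f : PowerSeries ℝ} (hρ : 0 < ρ) (h : ∀ n, trN ρ n f ≤ K) (n : ℕ) :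
    |coeff n f| * ρ ^ n ≤ K := by
  refine le_trans ?_ (h (n + 1))
  exact Finset.single_le_sum (f := fun k => |coeff k f| * ρ ^ k)
    (fun i _ => by positivity) (Finset.self_mem_range_succ n)

theorem fixed_point {F G} (hF : Good F) (hG : Good G) (c e : ℝ) :
    ∃ (ρ K : ℝ) (f g : PowerSeries ℝ), 0 < ρ ∧ ρ ≤ 1 ∧
      f = C c + X * F f g ∧ g = C e + X * G f g ∧
      (∀ n, trN ρ n f ≤ K) ∧ (∀ n, trN ρ n g ≤ K) := by
  set K : ℝ := |c| + |e| + 1 with hK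
  obtain ⟨A, hA⟩ := hF.2 K
  obtain ⟨B, hB⟩ := hG.2 K
  set ρ : ℝ := 1 / (1 + |A| + |B|) with hρd
  have hden : 0 < 1 + |A| + |B| := by positivity
  have hρ : 0 < ρ := by positivity
  have hρ1 : ρ ≤ 1 := by
    rw [hρd, div_le_one hden]; nlinarith [abs_nonneg A, abs_nonneg B]
  have hρA : ρ * |A| ≤ 1 := by
    rw [hρd, one_div_mul_eq_div, div_le_one hden]; nlinarith [abs_nonneg A, abs_nonneg B]
  have hρB : ρ * |B| ≤ 1 := by
    rw [hρd, one_div_mul_eq_div, div_le_one hden]; nlinarith [abs_nonneg A, abs_nonneg B]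
  let Φ : PowerSeries ℝ × PowerSeries ℝ → PowerSeries ℝ × PowerSeries ℝ :=
    fun p => (C c + X * F p.1 p.2, C e + X * G p.1 p.2)
  let it : ℕ → PowerSeries ℝ × PowerSeries ℝ := fun n => Φ^[n] 0
  have its : ∀ n, it (n + 1) = Φ (it n) := fun n => Function.iterate_succ_apply' Φ n 0
  have step : ∀ (H : PowerSeries ℝ) (a D : ℝ) (n : ℕ), |a| ≤ |c| + |e| → ρ * |D| ≤ 1 →
      trN ρ n H ≤ D → trN ρ n (C a + X * H) ≤ K := by
    intro H a D n ha hD hH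
    have h1 := trN_add hρ n (C a) (X * H)
    have h2 := trN_mul hρ n X H
    have h3 := trN_C (ρ := ρ) n a
    have h4 := mul_le_mul (trN_X hρ n) (hH.trans (le_abs_self D)) (trN_nonneg hρ n H) hρ.le
    linarith
  have bd : ∀ k n, trN ρ n (it k).1 ≤ K ∧ trN ρ n (it k).2 ≤ K := by
    intro k
    induction k with
    | zero =>
      intro n
      have : (0:ℝ) ≤ K := by positivity
      simpa [it, trN] using this
    | succ k ih =>
      intro n
      rw [its]
      obtain ⟨h1, h2⟩ := ih n
      exact ⟨step _ c A n (by linarith [abs_nonneg e]) hρA (hA ρ hρ hρ1 n _ _ h1 h2),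
        step _ e B n (by linarith [abs_nonneg c]) hρB (hB ρ hρ hρ1 n _ _ h1 h2)⟩
  have Φc : ∀ (n : ℕ) (p p' : PowerSeries ℝ × PowerSeries ℝ),
      (X : PowerSeries ℝ) ^ n ∣ p.1 - p'.1 → (X : PowerSeries ℝ) ^ n ∣ p.2 - p'.2 →
      (X : PowerSeries ℝ) ^ (n + 1) ∣ (Φ p).1 - (Φ p').1 ∧
      (X : PowerSeries ℝ) ^ (n + 1) ∣ (Φ p).2 - (Φ p').2 := by
    intro n p p' h1 h2
    have e1 : (Φ p).1 - (Φ p').1 = X * (F p.1 p.2 - F p'.1 p'.2) := by simp only [Φ]; ring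
    have e2 : (Φ p).2 - (Φ p').2 = X * (G p.1 p.2 - G p'.1 p'.2) := by simp only [Φ]; ring
    rw [e1, e2, pow_succ']
    exact ⟨mul_dvd_mul_left _ (hF.1 n _ _ _ _ h1 h2), mul_dvd_mul_left _ (hG.1 n _ _ _ _ h1 h2)⟩
  have diff1 : ∀ k, (X : PowerSeries ℝ) ^ k ∣ (it (k + 1)).1 - (it k).1 ∧
      (X : PowerSeries ℝ) ^ k ∣ (it (k + 1)).2 - (it k).2 := by
    intro k
    induction k with
    | zero => simp
    | succ k ih =>
      rw [its (k + 1)]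
      nth_rewrite 2 [its k]
      nth_rewrite 3 [its k]
      exact Φc k _ _ ih.1 ih.2
  have diff : ∀ k m, (X : PowerSeries ℝ) ^ k ∣ (it (k + m)).1 - (it k).1 ∧
      (X : PowerSeries ℝ) ^ k ∣ (it (k + m)).2 - (it k).2 := by
    intro k m
    induction m with
    | zero => simp
    | succ m ih =>
      have h := diff1 (k + m)
      have hp : (X : PowerSeries ℝ) ^ k ∣ X ^ (k + m) := pow_dvd_pow _ (Nat.le_add_right _ _)
      constructor
      · have := dvd_add (hp.trans h.1) ih.1
        rwa [sub_add_sub_cancel] at this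
      · have := dvd_add (hp.trans h.2) ih.2
        rwa [sub_add_sub_cancel] at this
  have lim : ∀ s : ℕ → PowerSeries ℝ, (∀ k m, (X : PowerSeries ℝ) ^ k ∣ s (k + m) - s k) →
      ∃ f : PowerSeries ℝ, ∀ n, (X : PowerSeries ℝ) ^ n ∣ f - s n := by
    intro s hs
    refine ⟨mk fun n => coeff n (s (n + 1)), fun n => ?_⟩
    rw [X_pow_dvd_iff]
    intro m hm
    obtain ⟨j, rfl⟩ := Nat.exists_eq_add_of_le (Nat.succ_le_of_lt hm)
    have := (X_pow_dvd_iff.1 (hs (m + 1) j)) m (Nat.lt_succ_self m)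
    rw [map_sub, sub_eq_zero] at this
    rw [map_sub, coeff_mk, sub_eq_zero, ← this]
  obtain ⟨f, hf⟩ := lim (fun n => (it n).1) fun k m => (diff k m).1
  obtain ⟨g, hg⟩ := lim (fun n => (it n).2) fun k m => (diff k m).2
  have zero_of : ∀ h : PowerSeries ℝ, (∀ n, (X : PowerSeries ℝ) ^ n ∣ h) → h = 0 := by
    intro h hh
    ext n
    exact X_pow_dvd_iff.1 (hh (n + 1)) n (Nat.lt_succ_self n)
  have fx := fun n => Φc n (f, g) (it n) (hf n) (hg n)
  have bdl : ∀ (h : PowerSeries ℝ) (s : ℕ → PowerSeries ℝ),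
      (∀ n, (X : PowerSeries ℝ) ^ n ∣ h - s n) → (∀ k n, trN ρ n (s k) ≤ K) →
      ∀ n, trN ρ n h ≤ K := by
    intro h s hs hb n
    refine le_trans (le_of_eq ?_) (hb n n)
    refine Finset.sum_congr rfl fun k hk => ?_
    have := X_pow_dvd_iff.1 (hs n) k (Finset.mem_range.1 hk)
    rw [map_sub, sub_eq_zero] at this
    rw [this]
  refine ⟨ρ, K, f, g, hρ, hρ1, ?_, ?_, bdl f _ hf fun k n => (bd k n).1,
    bdl g _ hg fun k n => (bd k n).2⟩
  · refine sub_eq_zero.1 (zero_of _ fun n => ?_)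
    have h1 := (hf (n + 1))
    have h2 := (fx n).1
    simp only [its] at h1
    have := dvd_sub h1 h2
    refine (pow_dvd_pow _ (Nat.le_succ n)).trans ?_
    convert this using 1
    simp only [Φ]; ring
  · refine sub_eq_zero.1 (zero_of _ fun n => ?_)
    have h1 := (hg (n + 1))
    have h2 := (fx n).2
    simp only [its] at h1
    have := dvd_sub h1 h2
    refine (pow_dvd_pow _ (Nat.le_succ n)).trans ?_
    convert this using 1
    simp only [Φ]; ring

/-- the derivation `2 X d/dX` -/
noncomputable def th (f : PowerSeries ℝ) : PowerSeries ℝ := mk fun n => 2 * n * coeff n f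

lemma th_eq (c : ℝ) (d : ℕ) (f : PowerSeries ℝ) :
    th (C c + X * LL d f) = X * (f - C (d : ℝ) * LL d f) := by
  ext n
  cases n with
  | zero => simp [th]
  | succ n =>
    simp only [th, LL, coeff_mk, map_add, coeff_succ_X_mul, map_sub, coeff_C_mul, coeff_C]
    have : (2 * (n:ℝ) + 2 + d) ≠ 0 := by positivity
    simp only [Nat.add_eq_zero_iff, one_ne_zero, and_false, if_false]
    push_cast
    field_simp
    ring

theorem formal_solution (α : ℝ) (hα : 0 < α) (d : ℕ) (hd : 1 ≤ d) (r : ℝ) :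
    ∃ (ρ K : ℝ) (U T : PowerSeries ℝ), 0 < ρ ∧ ρ ≤ 1 ∧
      (∀ n, |coeff n U| * ρ ^ n ≤ K) ∧ (∀ n, |coeff n T| * ρ ^ n ≤ K) ∧
      coeff 0 T = 1 ∧
      C α * C α * (T * T) * th U + C α * C α * C (d : ℝ) * (T * T) * U
        + C α * (C r - C 1) * (T * T)
        + X * ((C 1 + U) * (C 1 + U) * th U + U * (U + C 1) * (C r + U)) = 0 ∧
      (X * ((C 1 + U) * (C 1 + U)) + C α * C α * (T * T)) * th T
        - X * T * ((C 1 + U) * (C 1 + U) + C (α * r - α * d - r - 1) * U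
          + C (α - α * d - 1) * (U * U) - C r) = 0 := by
  set u0 : ℝ := -(r - 1) / (α * d) with hu0
  have hd0 : (d : ℝ) ≠ 0 := by positivity
  set c1 : ℝ := α * r - α * d - r - 1 with hc1
  set c2 : ℝ := α - α * d - 1 with hc2
  set i : ℝ := 1 / α ^ 2 with hi
  set g0 : ℝ := u0 * (u0 + 1) * (r + u0) with hg0
  set h0 : ℝ := (1 + u0) * (1 + u0) + c1 * u0 + c2 * (u0 * u0) - r with hh0
  have gv : Good fun f _ => LL d f := Good.fst.LL d
  have gw : Good fun _ g => LL 0 g := Good.snd.LL 0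
  have gU : Good fun f _ => C u0 + X * LL d f := (Good.const u0).add (Good.X.mul gv)
  have gU1 : Good fun f _ => C 1 + (C u0 + X * LL d f) := (Good.const 1).add gU
  have gU2 := gU1.mul gU1
  have gt : Good fun _ g => C (α ^ 2) * (C 2 * LL 0 g + X * (LL 0 g * LL 0 g)) :=
    (Good.const (α ^ 2)).mul (((Good.const 2).mul gw).add (Good.X.mul (gw.mul gw)))
  have gF : Good fun f g => C (-i) * (C (α ^ 2) * (C 2 * LL 0 g + X * (LL 0 g * LL 0 g)) * f
      + (C 1 + (C u0 + X * LL d f)) * (C 1 + (C u0 + X * LL d f)) * (f - C (d : ℝ) * LL d f)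
      + (C (3 * u0 ^ 2 + 2 * (1 + r) * u0 + r) * LL d f
        + X * (C (3 * u0 + 1 + r) * (LL d f * LL d f) + X * (LL d f * LL d f * LL d f)))) :=
    (Good.const (-i)).mul (((gt.mul Good.fst).add (gU2.mul
      (Good.fst.sub ((Good.const (d : ℝ)).mul gv)))).add (((Good.const _).mul gv).add
        (Good.X.mul (((Good.const _).mul (gv.mul gv)).add (Good.X.mul ((gv.mul gv).mul gv))))))
  have gG : Good fun f g => C (-i) * (C (α ^ 2) * (C 2 * LL 0 g + X * (LL 0 g * LL 0 g)) * g
      + (C 1 + (C u0 + X * LL d f)) * (C 1 + (C u0 + X * LL d f)) * g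
      - (LL 0 g * ((C 1 + (C u0 + X * LL d f)) * (C 1 + (C u0 + X * LL d f))
          + C c1 * (C u0 + X * LL d f) + C c2 * ((C u0 + X * LL d f) * (C u0 + X * LL d f)) - C r)
        + (C (2 + c1 + 2 * (1 + c2) * u0) * LL d f + X * (C (1 + c2) * (LL d f * LL d f))))) :=
    (Good.const (-i)).mul (((gt.mul Good.snd).add (gU2.mul Good.snd)).sub
      ((gw.mul (((gU2.add ((Good.const c1).mul gU)).add ((Good.const c2).mul (gU.mul gU))).sub
        (Good.const r))).add (((Good.const _).mul gv).add (Good.X.mul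
          ((Good.const _).mul (gv.mul gv))))))
  obtain ⟨ρ, K, f, g, hρ, hρ1, hf, hg, bf, bg⟩ := fixed_point gF gG (-i * g0) (i * h0)
  have bnd : ∀ (c : ℝ) (k : ℕ) (h : PowerSeries ℝ), (∀ n, trN ρ n h ≤ K) →
      ∀ n, trN ρ n (C c + X * LL k h) ≤ |c| + K := by
    intro c k h hh n
    have h1 := trN_add hρ n (C c) (X * LL k h)
    have h2 := trN_mul hρ n X (LL k h)
    have h3 := trN_C (ρ := ρ) n c
    have h4 := mul_le_mul ((trN_X hρ n).trans hρ1) ((trN_LL hρ n k h).trans (hh n))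
      (trN_nonneg hρ n _) zero_le_one
    linarith
  refine ⟨ρ, max (|u0| + K) (|1| + K), C u0 + X * LL d f, C 1 + X * LL 0 g, hρ, hρ1,
    fun n => (trN_coeff hρ (bnd u0 d f bf) n).trans (le_max_left _ _),
    fun n => (trN_coeff hρ (bnd 1 0 g bg) n).trans (le_max_right _ _), by simp, ?_, ?_⟩
  · rw [th_eq]
    have e1 : C α * C α * C (-i) = (-1 : PowerSeries ℝ) := by
      rw [← map_mul, ← map_mul, hi]
      have : α * α * -(1 / α ^ 2) = -1 := by field_simp
      rw [this]; simp
    have e2 : C α * C α * C (d : ℝ) * C u0 = - (C α * (C r - C 1) : PowerSeries ℝ) := by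
      simp only [← map_mul, ← map_sub, ← map_neg]
      congr 1
      rw [hu0]; field_simp
    generalize LL d f = v at *
    generalize LL 0 g = w at *
    rw [hg0] at hf
    simp only [map_mul, map_add, map_pow, map_one, map_ofNat] at hf e1 e2 ⊢
    generalize (C u0 : PowerSeries ℝ) = u0' at *
    generalize (C α : PowerSeries ℝ) = a' at *
    generalize (C (d:ℝ) : PowerSeries ℝ) = d' at *
    generalize (C r : PowerSeries ℝ) = r' at *
    generalize (C (-i) : PowerSeries ℝ) = i' at *
    linear_combination a' ^ 2 * X * hf
      + X * (u0' * (u0' + 1) * (r' + u0') + X * (a' ^ 2 * (2 * w + X * (w * w)) * f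
        + (1 + (u0' + X * v)) * (1 + (u0' + X * v)) * (f - d' * v)
        + ((3 * u0' ^ 2 + 2 * (1 + r') * u0' + r') * v
          + X * ((3 * u0' + 1 + r') * (v * v) + X * (v * v * v))))) * e1
      + (1 + X * w) * (1 + X * w) * e2
  · rw [th_eq]
    have e1 : C α * C α * C (-i) = (-1 : PowerSeries ℝ) := by
      rw [← map_mul, ← map_mul, hi]
      have : α * α * -(1 / α ^ 2) = -1 := by field_simp
      rw [this]; simp
    have e3 : (C (i * h0) : PowerSeries ℝ) = - C (-i) * ((1 + C u0) * (1 + C u0) + C c1 * C u0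
        + C c2 * (C u0 * C u0) - C r) := by
      rw [hh0]; simp only [map_mul, map_add, map_sub, map_neg, map_one, neg_neg]
    rw [e3] at hg
    generalize LL d f = v at *
    generalize LL 0 g = w at *
    simp only [map_mul, map_add, map_pow, map_one, map_ofNat, Nat.cast_zero, map_zero,
      zero_mul, sub_zero] at hg e1 ⊢
    generalize (C u0 : PowerSeries ℝ) = u0' at *
    generalize (C α : PowerSeries ℝ) = a' at *
    generalize (C c1 : PowerSeries ℝ) = c1' at *
    generalize (C c2 : PowerSeries ℝ) = c2' at *
    generalize (C r : PowerSeries ℝ) = r' at *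
    generalize (C (-i) : PowerSeries ℝ) = i' at *
    linear_combination a' ^ 2 * X * hg
      + X * (-((1 + u0') * (1 + u0') + c1' * u0' + c2' * (u0' * u0') - r')
        + X * (a' ^ 2 * (2 * w + X * (w * w)) * g
        + (1 + (u0' + X * v)) * (1 + (u0' + X * v)) * g
        - (w * ((1 + (u0' + X * v)) * (1 + (u0' + X * v)) + c1' * (u0' + X * v)
            + c2' * ((u0' + X * v) * (u0' + X * v)) - r')
          + ((2 + c1' + 2 * (1 + c2') * u0') * v + X * ((1 + c2') * (v * v)))))) * e1

/-- absolutely convergent evaluation of a power series -/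
def Ev (y : ℝ) (f : PowerSeries ℝ) (v : ℝ) : Prop :=
  Summable (fun n => ‖coeff n f * y ^ n‖) ∧ ∑' n, coeff n f * y ^ n = v

lemma Ev.add {y f g v w} (hf : Ev y f v) (hg : Ev y g w) : Ev y (f + g) (v + w) := by
  refine ⟨?_, ?_⟩
  · refine Summable.of_nonneg_of_le (fun _ => norm_nonneg _) (fun n => ?_) (hf.1.add hg.1)
    rw [map_add, add_mul]; exact norm_add_le _ _
  · rw [← hf.2, ← hg.2, ← hf.1.of_norm.tsum_add hg.1.of_norm]
    simp only [map_add, add_mul]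

lemma Ev.C (y c : ℝ) : Ev y (C c) c := by
  have h : ∀ n ≠ 0, coeff n (PowerSeries.C c) * y ^ n = 0 := by
    intro n hn; simp [coeff_C, hn]
  refine ⟨?_, ?_⟩
  · refine summable_of_ne_finset_zero (s := {0}) fun n hn => ?_
    rw [h n (by simpa using hn), norm_zero]
  · rw [tsum_eq_single 0 h]; simp

lemma Ev.X (y : ℝ) : Ev y X y := by
  have h : ∀ n ≠ 1, coeff n (PowerSeries.X) * y ^ n = 0 := by
    intro n hn; simp [coeff_X, hn]
  refine ⟨?_, ?_⟩
  · refine summable_of_ne_finset_zero (s := {1}) fun n hn => ?_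
    rw [h n (by simpa using hn), norm_zero]
  · rw [tsum_eq_single 1 h]; simp

lemma Ev.mul {y f g v w} (hf : Ev y f v) (hg : Ev y g w) : Ev y (f * g) (v * w) := by
  have e : ∀ n, ∑ kl ∈ Finset.HasAntidiagonal.antidiagonal n, (coeff kl.1 f * y ^ kl.1) * (coeff kl.2 g * y ^ kl.2)
      = coeff n (f * g) * y ^ n := by
    intro n
    rw [coeff_mul, Finset.sum_mul]
    refine Finset.sum_congr rfl fun kl h => ?_
    rw [← Finset.HasAntidiagonal.mem_antidiagonal.1 h, pow_add]; ring
  refine ⟨?_, ?_⟩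
  · have := summable_norm_sum_mul_antidiagonal_of_summable_norm hf.1 hg.1
    simpa only [e] using this
  · rw [← hf.2, ← hg.2, tsum_mul_tsum_eq_tsum_sum_antidiagonal_of_summable_norm hf.1 hg.1]
    simp only [e]

lemma Ev.sub {y f g v w} (hf : Ev y f v) (hg : Ev y g w) : Ev y (f - g) (v - w) := by
  have := hf.add ((Ev.C y (-1)).mul hg)
  simpa [sub_eq_add_neg] using this

lemma Ev.eq_zero {y v} (h : Ev y 0 v) : v = 0 := by
  rw [← h.2]; simp

section deriv
variable {c : ℕ → ℝ} {ρ K : ℝ}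

lemma summable_aux (hρ : 0 < ρ) (h : ∀ n, |c n| * ρ ^ n ≤ K) {y : ℝ} (hy : 0 ≤ y) (hy1 : y < ρ)
    (k : ℕ) : Summable fun n : ℕ => (n : ℝ) ^ k * (|c n| * y ^ n) := by
  have hq : ‖y / ρ‖ < 1 := by
    rw [Real.norm_of_nonneg (by positivity), div_lt_one hρ]; exact hy1
  have := (summable_pow_mul_geometric_of_norm_lt_one k hq).mul_left K
  refine Summable.of_nonneg_of_le (fun n => by positivity) (fun n => ?_) this
  have : |c n| * y ^ n = |c n| * ρ ^ n * (y / ρ) ^ n := by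
    rw [div_pow]; field_simp
  rw [this]
  have h3 : 0 ≤ (n : ℝ) ^ k * (y / ρ) ^ n := by positivity
  nlinarith [mul_le_mul_of_nonneg_right (h n) h3]

lemma exp_aux (n : ℕ) (ξ : ℝ) : Real.exp (2 * n * ξ) = (Real.exp ξ ^ 2) ^ n := by
  rw [← pow_mul, ← Real.exp_nat_mul]; push_cast; rfl

lemma hasDerivAt_aux (hρ : 0 < ρ) (h : ∀ n, |c n| * ρ ^ n ≤ K) {ξ : ℝ}
    (hξ : Real.exp ξ ^ 2 < ρ) :
    HasDerivAt (fun ξ => ∑' n : ℕ, c n * Real.exp (2 * n * ξ))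
      (∑' n : ℕ, 2 * n * c n * (Real.exp ξ ^ 2) ^ n) ξ := by
  have hc : Filter.Tendsto (fun z => Real.exp z ^ 2) (nhds ξ) (nhds (Real.exp ξ ^ 2)) :=
    (Real.continuous_exp.pow 2).tendsto ξ
  obtain ⟨η, hη1, hη2⟩ : ∃ η, ξ < η ∧ Real.exp η ^ 2 < ρ := by
    have := (hc.eventually (gt_mem_nhds hξ))
    obtain ⟨ε, hε, hb⟩ := Metric.eventually_nhds_iff.1 this
    refine ⟨ξ + ε / 2, by linarith, hb ?_⟩
    rw [Real.dist_eq, add_sub_cancel_left, abs_of_pos (by positivity)]; linarith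
  have hs := (summable_aux hρ h (by positivity) hη2 1).mul_left 2
  have := hasDerivAt_tsum_of_isPreconnected (u := fun n : ℕ => 2 * ((n:ℝ) ^ 1 *
      (|c n| * (Real.exp η ^ 2) ^ n)))
    (g := fun (n : ℕ) z => c n * Real.exp (2 * n * z))
    (g' := fun (n : ℕ) z => 2 * n * c n * (Real.exp z ^ 2) ^ n) (t := Set.Iio η) (y₀ := ξ) (y := ξ)
    hs isOpen_Iio isPreconnected_Iio ?_ ?_ hη1 ?_ hη1
  · exact this
  · intro n z _
    have h1 : HasDerivAt (fun z : ℝ => 2 * (n:ℝ) * z) (2 * n) z := by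
      simpa using (hasDerivAt_id z).const_mul (2 * (n:ℝ))
    have := (h1.exp).const_mul (c n)
    refine this.congr_deriv ?_
    rw [exp_aux]; ring
  · intro n z hz
    rw [norm_mul, norm_mul, norm_mul, Real.norm_eq_abs (c n), Real.norm_of_nonneg zero_le_two,
      Real.norm_of_nonneg (Nat.cast_nonneg n), Real.norm_of_nonneg (by positivity), pow_one]
    have hz' : Real.exp z ≤ Real.exp η := Real.exp_le_exp.2 (le_of_lt hz)
    have : (Real.exp z ^ 2) ^ n ≤ (Real.exp η ^ 2) ^ n := by gcongr
    calc 2 * (n:ℝ) * |c n| * (Real.exp z ^ 2) ^ n ≤ 2 * (n:ℝ) * |c n| * (Real.exp η ^ 2) ^ n := by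
          gcongr
      _ = _ := by ring
  · have := summable_aux hρ h (by positivity) hξ 0
    refine Summable.of_norm ?_
    refine this.congr fun n => ?_
    rw [norm_mul, exp_aux, Real.norm_eq_abs, Real.norm_of_nonneg (by positivity), pow_zero, one_mul]

end deriv

lemma Ev.of_bound {ρ K y : ℝ} {f : PowerSeries ℝ} (hρ : 0 < ρ)
    (h : ∀ n, |coeff n f| * ρ ^ n ≤ K) (hy : 0 ≤ y) (hy1 : y < ρ) :
    Ev y f (∑' n, coeff n f * y ^ n) := by
  refine ⟨(summable_aux hρ h hy hy1 0).congr fun n => ?_, rfl⟩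
  rw [norm_mul, Real.norm_eq_abs, Real.norm_of_nonneg (by positivity), pow_zero, one_mul]

lemma Ev.th_of_bound {ρ K y : ℝ} {f : PowerSeries ℝ} (hρ : 0 < ρ)
    (h : ∀ n, |coeff n f| * ρ ^ n ≤ K) (hy : 0 ≤ y) (hy1 : y < ρ) :
    Ev y (th f) (∑' n : ℕ, 2 * n * coeff n f * y ^ n) := by
  refine ⟨((summable_aux hρ h hy hy1 1).mul_left 2).congr fun n => ?_, ?_⟩
  · rw [th, coeff_mk, norm_mul, norm_mul, norm_mul, Real.norm_eq_abs (coeff n f),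
      Real.norm_of_nonneg zero_le_two,
      Real.norm_of_nonneg (Nat.cast_nonneg n), Real.norm_of_nonneg (by positivity), pow_one]
    ring
  · simp only [th, coeff_mk]

end TaylorSol

/-- Existence of a convergent power series (in `e^ξ`) solution of the self-similar
profile ODE near `ξ = -∞`, normalized so that the leading coefficient of `S̄` is `1`:
`Ū(ξ) = Σ_{n≥0} a_n e^{nξ}` (with `a_n = 0` for odd `n`),
`S̄(ξ) = e^{-ξ} + Σ_{n≥1} b_n e^{nξ}` (with `b_{-1} = 1` and `b_n = 0` for even `n`),
with geometric bounds `|a_n|, |b_n| ≤ M^{n+1}`, converging absolutely for `e^ξ < 1/M`,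
and solving `D(Ū,S̄)·Ū' = N_U(Ū,S̄)`, `D(Ū,S̄)·S̄' = N_S(Ū,S̄)` there. -/
theorem taylor_series_solution
    (α : ℝ) (hα : 0 < α) (d : ℕ) (hd : 1 ≤ d)
    (r : ℝ) (hrd : α * d > r - 1) :
    ∃ (M : ℝ) (a : ℕ → ℝ) (b : ℤ → ℝ),
      8 ≤ M ∧
      b (-1) = 1 ∧
      (∀ n : ℕ, Odd n → a n = 0) ∧
      (∀ n : ℤ, -1 ≤ n → Even n → b n = 0) ∧
      (∀ n : ℕ, |a n| ≤ M ^ (n + 1)) ∧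
      (∀ n : ℤ, -1 ≤ n → |b n| ≤ M ^ (n + 1)) ∧
      (let U : ℝ → ℝ := fun ξ => ∑' n : ℕ, a n * Real.exp (n * ξ)
       let S : ℝ → ℝ := fun ξ => Real.exp (-ξ) + ∑' n : ℕ, b ((n : ℤ) + 1) * Real.exp (((n : ℝ) + 1) * ξ)
       ∀ ξ : ℝ, Real.exp ξ < 1 / M →
         Summable (fun n : ℕ => |a n| * Real.exp (n * ξ)) ∧
         Summable (fun n : ℕ => |b ((n : ℤ) + 1)| * Real.exp (((n : ℝ) + 1) * ξ)) ∧
         DifferentiableAt ℝ U ξ ∧ DifferentiableAt ℝ S ξ ∧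
         Dfun α (U ξ) (S ξ) * deriv U ξ = NU α d r (U ξ) (S ξ) ∧
         Dfun α (U ξ) (S ξ) * deriv S ξ = NS α d r (U ξ) (S ξ)) := by
  obtain ⟨ρ, K, U, T, hρ, hρ1, bU, bT, hT0, I1, I2⟩ := TaylorSol.formal_solution α hα d hd r
  have hK : 0 ≤ K := le_trans (by positivity) (bU 0)
  set M : ℝ := 8 + K + 1 / ρ with hM
  have hρi : 0 < 1 / ρ := by positivity
  have hM8 : 8 ≤ M := by linarith
  have hM0 : 0 < M := by linarith
  have hM1 : 1 ≤ M := by linarith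
  have hMK : K ≤ M := by linarith
  have hMρ : 1 / ρ ≤ M := by linarith
  -- coefficient bounds
  have cb : ∀ (f : PowerSeries ℝ), (∀ n, |PowerSeries.coeff n f| * ρ ^ n ≤ K) → ∀ n,
      |PowerSeries.coeff n f| ≤ M ^ (n + 1) := by
    intro f hf n
    have h1 : |PowerSeries.coeff n f| = |PowerSeries.coeff n f| * ρ ^ n * (1 / ρ) ^ n := by
      rw [mul_assoc, ← mul_pow, mul_one_div_cancel hρ.ne', one_pow, mul_one]
    rw [h1, pow_succ']
    exact mul_le_mul ((hf n).trans hMK) (pow_le_pow_left₀ hρi.le hMρ n) (by positivity) hM0.le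
  let a : ℕ → ℝ := fun n => if Even n then PowerSeries.coeff (n / 2) U else 0
  let b : ℤ → ℝ := fun n => if Even n then 0 else PowerSeries.coeff ((n + 1) / 2).toNat T
  have a_even : ∀ m : ℕ, a (2 * m) = PowerSeries.coeff m U := by
    intro m; simp [a]
  have b_odd : ∀ m : ℕ, b (((2 * m : ℕ) : ℤ) + 1) = PowerSeries.coeff (m + 1) T := by
    intro m
    have h1 : ¬ Even (((2 * m : ℕ) : ℤ) + 1) := by
      rw [Int.not_even_iff_odd]; exact ⟨m, by push_cast; ring⟩
    have h2 : ((((2 * m : ℕ) : ℤ) + 1 + 1) / 2).toNat = m + 1 := by omega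
    simp only [b, if_neg h1, h2]
  have inj : Function.Injective (fun m : ℕ => 2 * m) := fun x y h => by
    simpa using h
  have za : ∀ n : ℕ, n ∉ Set.range (fun m : ℕ => 2 * m) → a n = 0 := by
    intro n hn
    have : ¬ Even n := fun ⟨k, hk⟩ => hn ⟨k, by simp only; omega⟩
    simp [a, this]
  have zb : ∀ n : ℕ, n ∉ Set.range (fun m : ℕ => 2 * m) → b ((n : ℤ) + 1) = 0 := by
    intro n hn
    have h1 : ¬ Even n := fun ⟨k, hk⟩ => hn ⟨k, by simp only; omega⟩
    have : Even ((n : ℤ) + 1) := by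
      rw [Nat.not_even_iff_odd] at h1
      obtain ⟨k, hk⟩ := h1
      exact ⟨k + 1, by rw [hk]; push_cast; ring⟩
    simp [b, this]
  have small : ∀ ξ, Real.exp ξ < 1 / M → Real.exp ξ ^ 2 < ρ := by
    intro ξ hξ
    have h1 : 1 / M ≤ ρ := by
      rw [div_le_iff₀ hM0]
      have := mul_le_mul_of_nonneg_left hMρ hρ.le
      rwa [mul_one_div_cancel hρ.ne'] at this
    have h0 := Real.exp_pos ξ
    nlinarith
  -- `U` as a series in `e^{2ξ}`
  have Ueq : ∀ ξ : ℝ, ∑' n : ℕ, a n * Real.exp (n * ξ)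
      = ∑' m : ℕ, PowerSeries.coeff m U * Real.exp (2 * m * ξ) := by
    intro ξ
    rw [← inj.tsum_eq (f := fun n : ℕ => a n * Real.exp (n * ξ))]
    · refine tsum_congr fun m => ?_
      simp only [a_even]; push_cast; rfl
    · intro n hn
      by_contra h
      exact hn (by simp [za n h])
  have Ssum : ∀ ξ : ℝ, Real.exp ξ ^ 2 < ρ →
      Summable (fun m : ℕ => PowerSeries.coeff m T * Real.exp (2 * m * ξ)) := by
    intro ξ hξ
    refine ((TaylorSol.Ev.of_bound hρ bT (by positivity) hξ).1.of_norm).congr fun n => ?_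
    rw [TaylorSol.exp_aux]
  have expS : ∀ (m : ℕ) (ξ : ℝ), Real.exp ((((2 * m : ℕ) : ℝ) + 1) * ξ)
      = Real.exp (-ξ) * Real.exp (2 * ((m + 1 : ℕ) : ℝ) * ξ) := by
    intro m ξ
    rw [← Real.exp_add]; congr 1; push_cast; ring
  have Seq : ∀ ξ : ℝ, Real.exp ξ ^ 2 < ρ →
      Real.exp (-ξ) + ∑' n : ℕ, b ((n : ℤ) + 1) * Real.exp (((n : ℝ) + 1) * ξ)
      = Real.exp (-ξ) * ∑' m : ℕ, PowerSeries.coeff m T * Real.exp (2 * m * ξ) := by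
    intro ξ hξ
    rw [← inj.tsum_eq (f := fun n : ℕ => b ((n : ℤ) + 1) * Real.exp (((n : ℝ) + 1) * ξ)),
      (Ssum ξ hξ).tsum_eq_zero_add, hT0, mul_add, ← tsum_mul_left]
    · simp only [b_odd, expS]
      simp only [Nat.cast_zero, mul_zero, zero_mul, Real.exp_zero, mul_one]
      congr 1
      exact tsum_congr fun m => by ring
    · intro n hn
      by_contra h
      exact hn (by simp [zb n h])
  refine ⟨M, a, b, hM8, ?_, ?_, ?_, ?_, ?_, ?_⟩
  · have : ¬ Even (-1 : ℤ) := by decide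
    simp [b, hT0]
  · intro n hn
    simp [a, Nat.not_even_iff_odd.2 hn]
  · intro n _ hn
    simp [b, hn]
  · intro n
    by_cases h : n ∈ Set.range (fun m : ℕ => 2 * m)
    · obtain ⟨m, rfl⟩ := h
      simp only [a_even]
      exact (cb U bU m).trans (pow_le_pow_right₀ hM1 (by omega))
    · rw [za n h, abs_zero]; positivity
  · intro n hn
    by_cases h : Even n
    · have : b n = 0 := by simp [b, h]
      rw [this, abs_zero]; positivity
    · rw [Int.not_even_iff_odd] at h
      obtain ⟨k, hk⟩ := h
      rcases eq_or_lt_of_le hn with h1 | h1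
      · rw [← h1]
        simp [b, hT0]
      · obtain ⟨m, rfl⟩ : ∃ m : ℕ, k = m := ⟨k.toNat, by omega⟩
        have e : n = ((2 * m : ℕ) : ℤ) + 1 := by push_cast; exact hk
        rw [e, b_odd]
        have e2 : (((2 * m : ℕ) : ℤ) + 1 + 1) = ((2 * m + 2 : ℕ) : ℤ) := by push_cast; ring
        rw [e2, zpow_natCast]
        exact (cb T bT (m + 1)).trans (pow_le_pow_right₀ hM1 (by omega))
  · intro Uf Sf ξ hξ
    have hs := small ξ hξ
    have hev : ∀ᶠ z in nhds ξ, Real.exp z ^ 2 < ρ :=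
      ((Real.continuous_exp.pow 2).tendsto ξ).eventually (gt_mem_nhds hs)
    have dU := TaylorSol.hasDerivAt_aux hρ bU hs
    have dT := TaylorSol.hasDerivAt_aux hρ bT hs
    have hUf : Uf = fun ξ => ∑' m : ℕ, PowerSeries.coeff m U * Real.exp (2 * m * ξ) := funext Ueq
    rw [← hUf] at dU
    have dS0 := ((hasDerivAt_neg ξ).exp).mul dT
    have hSf : Sf =ᶠ[nhds ξ] (fun y => Real.exp (-y)) *
        fun ξ => ∑' m : ℕ, PowerSeries.coeff m T * Real.exp (2 * m * ξ) :=
      hev.mono fun z hz => Seq z hz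
    have dS := dS0.congr_of_eventuallyEq hSf
    have hSv := Seq ξ hs
    change Sf ξ = _ at hSv
    have hUv := Ueq ξ
    change Uf ξ = _ at hUv
    refine ⟨?_, ?_, dU.differentiableAt, dS.differentiableAt, ?_⟩
    · refine (inj.summable_iff ?_).1 ?_
      · intro n hn; simp [za n hn]
      · refine (TaylorSol.Ev.of_bound hρ bU (by positivity) hs).1.congr fun m => ?_
        simp only [Function.comp, a_even]
        rw [norm_mul, Real.norm_eq_abs, Real.norm_of_nonneg (by positivity),
          ← TaylorSol.exp_aux]
        push_cast; rfl
    · refine (inj.summable_iff ?_).1 ?_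
      · intro n hn; simp [zb n hn]
      · have h := (TaylorSol.Ev.of_bound hρ bT (by positivity) hs).1
        have h' := ((summable_nat_add_iff 1).2 h).mul_left (Real.exp (-ξ))
        refine h'.congr fun m => ?_
        simp only [Function.comp, b_odd, expS]
        rw [norm_mul, Real.norm_eq_abs, Real.norm_of_nonneg (by positivity),
          ← TaylorSol.exp_aux]
        ring
    · rw [dU.deriv, dS.deriv]
      simp only [TaylorSol.exp_aux] at hSv hUv ⊢
      have hy : 0 ≤ Real.exp ξ ^ 2 := by positivity
      have eU := TaylorSol.Ev.of_bound hρ bU hy hs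
      have eT := TaylorSol.Ev.of_bound hρ bT hy hs
      have eU' := TaylorSol.Ev.th_of_bound hρ bU hy hs
      have eT' := TaylorSol.Ev.th_of_bound hρ bT hy hs
      rw [← hUv] at eU
      generalize (∑' n : ℕ, PowerSeries.coeff n T * (Real.exp ξ ^ 2) ^ n) = t at *
      generalize (∑' n : ℕ, 2 * (n:ℝ) * PowerSeries.coeff n U * (Real.exp ξ ^ 2) ^ n) = u' at *
      generalize (∑' n : ℕ, 2 * (n:ℝ) * PowerSeries.coeff n T * (Real.exp ξ ^ 2) ^ n) = t' at *
      rw [hSv]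
      generalize Uf ξ = u at *
      have hx : Real.exp (-ξ) * Real.exp ξ = 1 := by rw [← Real.exp_add]; simp
      generalize Real.exp (-ξ) = z at *
      generalize Real.exp ξ = x at *
      have k := fun c => TaylorSol.Ev.C (x ^ 2) c
      have kX := TaylorSol.Ev.X (x ^ 2)
      have j1 := ((((((k α).mul (k α)).mul (eT.mul eT)).mul eU').add
        (((((k α).mul (k α)).mul (k d)).mul (eT.mul eT)).mul eU)).add
        (((k α).mul ((k r).sub (k 1))).mul (eT.mul eT))).add
        (kX.mul (((((k 1).add eU).mul ((k 1).add eU)).mul eU').add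
          ((eU.mul (eU.add (k 1))).mul ((k r).add eU))))
      have j2 := ((((kX.mul (((k 1).add eU).mul ((k 1).add eU))).add
        (((k α).mul (k α)).mul (eT.mul eT))).mul eT')).sub
        ((kX.mul eT).mul ((((((k 1).add eU).mul ((k 1).add eU)).add
          ((k (α * r - α * d - r - 1)).mul eU)).add
          ((k (α - α * d - 1)).mul (eU.mul eU))).sub (k r)))
      rw [I1] at j1
      rw [I2] at j2
      have i1 := j1.eq_zero
      have i2 := j2.eq_zero
      have hx2 : z ^ 2 * x ^ 2 = 1 := by rw [← mul_pow, hx, one_pow]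
      unfold Dfun NU NS
      constructor
      · linear_combination z ^ 2 * i1 - ((1 + u) ^ 2 * u' + u * (u + 1) * (r + u)) * hx2
      · linear_combination z ^ 3 * i2 - z * ((1 + u) ^ 2 * t'
          - t * ((1 + u) ^ 2 + (α * r - α * d - r - 1) * u + (α - α * d - 1) * u ^ 2 - r)) * hx2
end

section
/- Let α > 0, let d ≥ 1 be an integer, and let r be a real number with αd > r−1. Let ξ₀ < ξ₁ ≤ ∞ and let (Ū, S̄) : [ξ₀, ξ₁) → ℝ² be a C¹ solution of the system (⋆) with S̄(ξ) > 0 for all ξ ∈ [ξ₀, ξ₁). If Ū(ξ₀) > −1, then Ū(ξ) > −1 for all ξ ∈ [ξ₀, ξ₁). -/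
/-- Barrier `Ū = -1`: if `α d > r - 1`, a `C¹` solution of (⋆) on `[ξ₀, ξ₁)` (with
`ξ₁ ≤ ∞`) along which `S̄ > 0`, starting with `Ū(ξ₀) > -1`, satisfies `Ū > -1`
throughout. -/
theorem barrier_minus_one
    (α : ℝ) (hα : 0 < α) (d : ℕ) (hd : 1 ≤ d)
    (r : ℝ) (hrd : α * d > r - 1)
    (ξ₀ : ℝ) (ξ₁ : EReal) (hξ : (ξ₀ : EReal) < ξ₁)
    (U S : ℝ → ℝ)
    (hsol : ∀ ξ : ℝ, ξ₀ ≤ ξ → (ξ : EReal) < ξ₁ →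
      HasDerivAt U (NU α d r (U ξ) (S ξ) / Dfun α (U ξ) (S ξ)) ξ ∧
      HasDerivAt S (NS α d r (U ξ) (S ξ) / Dfun α (U ξ) (S ξ)) ξ)
    (hS : ∀ ξ : ℝ, ξ₀ ≤ ξ → (ξ : EReal) < ξ₁ → 0 < S ξ)
    (hinit : -1 < U ξ₀) :
    ∀ ξ : ℝ, ξ₀ ≤ ξ → (ξ : EReal) < ξ₁ → -1 < U ξ := by
  have key : ∀ x : ℝ, ξ₀ ≤ x → (x : EReal) < ξ₁ → U x = -1 →
      0 < NU α d r (U x) (S x) / Dfun α (U x) (S x) := by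
    intro x hx hx1 hU
    have hs := hS x hx hx1
    rw [hU]
    apply div_pos
    · have h1 : NU α d r (-1) (S x) = α * (α * d - (r - 1)) * S x ^ 2 := by
        unfold NU; ring
      rw [h1]
      have h2 : 0 < α * d - (r - 1) := by linarith
      positivity
    · unfold Dfun
      positivity
  intro ξ h0 h1
  have hlt : ∀ x : ℝ, x ≤ ξ → (x : EReal) < ξ₁ := fun x hx =>
    lt_of_le_of_lt (EReal.coe_le_coe_iff.2 hx) h1
  have hge : ∀ ⦃x⦄, x ∈ Set.Icc ξ₀ ξ → -U x ≤ 1 := by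
    apply image_le_of_deriv_right_lt_deriv_boundary
      (f' := fun x => -(NU α d r (U x) (S x) / Dfun α (U x) (S x)))
      (B := fun _ => 1) (B' := fun _ => 0)
    · intro x hx
      exact (hsol x hx.1 (hlt x hx.2)).1.neg.continuousAt.continuousWithinAt
    · intro x hx
      exact (hsol x hx.1 (hlt x hx.2.le)).1.neg.hasDerivWithinAt
    · linarith
    · intro x
      exact hasDerivAt_const x 1
    · intro x hx hc
      have := key x hx.1 (hlt x hx.2.le) (by linarith)
      linarith
  have hξU := hge ⟨h0, le_refl ξ⟩
  by_contra hcon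
  have hU : U ξ = -1 := by linarith
  have h0' : ξ₀ < ξ := by
    rcases h0.lt_or_eq with h | h
    · exact h
    · rw [h] at hinit; exact absurd hinit hcon
  have hder := (hasDerivAt_iff_tendsto_slope.1 (hsol ξ h0 h1).1).eventually
    (lt_mem_nhds (key ξ h0 h1 hU))
  have hleft : ∀ᶠ y in nhdsWithin ξ (Set.Iio ξ), 0 < slope U ξ y :=
    hder.filter_mono (nhdsWithin_mono ξ (fun y hy => ne_of_lt hy))
  obtain ⟨y, hy, hy2⟩ := (hleft.and (Ioo_mem_nhdsLT h0')).exists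
  have h3 := hge ⟨hy2.1.le, hy2.2.le⟩
  rw [slope_def_field] at hy
  have h4 : y - ξ < 0 := by linarith [hy2.2]
  have h5 : (U y - U ξ) / (y - ξ) ≤ 0 :=
    div_nonpos_of_nonneg_of_nonpos (by linarith) h4.le
  linarith
end

section
/- Let α > 0, let d ≥ 1 be an integer, and let r > 1 be a real number. Let ξ₀ < ξ₁ ≤ ∞ and let (Ū, S̄) : [ξ₀, ξ₁) → ℝ² be a C¹ solution of the system (⋆) with S̄(ξ) > 0 for all ξ ∈ [ξ₀, ξ₁). If Ū(ξ₀) < 0, then Ū(ξ) < 0 for all ξ ∈ [ξ₀, ξ₁). -/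
/-- Barrier `Ū = 0`: if `r > 1`, a `C¹` solution of (⋆) on `[ξ₀, ξ₁)` (with `ξ₁ ≤ ∞`)
along which `S̄ > 0`, starting with `Ū(ξ₀) < 0`, satisfies `Ū < 0` throughout. -/
theorem barrier_zero
    (α : ℝ) (hα : 0 < α) (d : ℕ) (hd : 1 ≤ d)
    (r : ℝ) (hr : 1 < r)
    (ξ₀ : ℝ) (ξ₁ : EReal) (hξ : (ξ₀ : EReal) < ξ₁)
    (U S : ℝ → ℝ)
    (hsol : ∀ ξ : ℝ, ξ₀ ≤ ξ → (ξ : EReal) < ξ₁ →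
      HasDerivAt U (NU α d r (U ξ) (S ξ) / Dfun α (U ξ) (S ξ)) ξ ∧
      HasDerivAt S (NS α d r (U ξ) (S ξ) / Dfun α (U ξ) (S ξ)) ξ)
    (hS : ∀ ξ : ℝ, ξ₀ ≤ ξ → (ξ : EReal) < ξ₁ → 0 < S ξ)
    (hinit : U ξ₀ < 0) :
    ∀ ξ : ℝ, ξ₀ ≤ ξ → (ξ : EReal) < ξ₁ → U ξ < 0 := by
  have hneg : ∀ ξ : ℝ, ξ₀ ≤ ξ → (ξ : EReal) < ξ₁ → U ξ = 0 →
      NU α d r (U ξ) (S ξ) / Dfun α (U ξ) (S ξ) < 0 := by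
    intro ξ h0 h1 hU
    have hs := hS ξ h0 h1
    rw [hU]
    apply div_neg_of_neg_of_pos
    · have : 0 < α * (r - 1) * S ξ ^ 2 :=
        mul_pos (mul_pos hα (sub_pos.mpr hr)) (pow_pos hs 2)
      unfold NU
      linarith
    · unfold Dfun
      positivity
  intro b hb0 hb1
  have hlt : ∀ x : ℝ, x ≤ b → (x : EReal) < ξ₁ := fun x hx =>
    lt_of_le_of_lt (EReal.coe_le_coe_iff.mpr hx) hb1
  have hle : ∀ x ∈ Set.Icc ξ₀ b, U x ≤ 0 := by
    intro x hx
    refine image_le_of_deriv_right_lt_deriv_boundary (f := U)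
      (f' := fun ξ => NU α d r (U ξ) (S ξ) / Dfun α (U ξ) (S ξ))
      (B := fun _ => (0 : ℝ)) (B' := fun _ => (0 : ℝ)) (a := ξ₀) (b := b)
      ?_ ?_ hinit.le ?_ ?_ hx
    · intro y hy
      exact (hsol y hy.1 (hlt y hy.2)).1.continuousAt.continuousWithinAt
    · intro y hy
      exact (hsol y hy.1 (hlt y hy.2.le)).1.hasDerivWithinAt
    · intro y
      exact hasDerivAt_const y 0
    · intro y hy h
      exact hneg y hy.1 (hlt y hy.2.le) h
  by_contra hcon
  have hUb : U b = 0 := le_antisymm (hle b ⟨hb0, le_rfl⟩) (not_lt.mp hcon)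
  have hlt0 : ξ₀ < b := by
    rcases hb0.lt_or_eq with h | h
    · exact h
    · rw [h] at hinit
      linarith
  have ht := (hasDerivAt_iff_tendsto_slope.mp (hsol b hb0 hb1).1).eventually_lt_const
    (hneg b hb0 hb1 hUb)
  have ht2 : ∀ᶠ y in nhdsWithin b (Set.Iio b), slope U b y < 0 :=
    ht.filter_mono (nhdsWithin_mono b fun y hy => ne_of_lt hy)
  obtain ⟨y, hy, hyI⟩ := (ht2.and (Ioo_mem_nhdsLT hlt0)).exists
  rw [slope_def_field, hUb, sub_zero] at hy
  have := div_nonneg_of_nonpos (hle y ⟨hyI.1.le, hyI.2.le⟩) (sub_nonpos.mpr hyI.2.le)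
  linarith
end

section
/- Let α > 0, let d ≥ 1 be an integer, and let r be a real number with r > 1 and αd > r−1. Let (Ū, S̄) be a maximal C¹ solution of the system (⋆) with initial data at some time ξ₀ satisfying −1 < Ū(ξ₀) < 0 and S̄(ξ₀) > 0. Then the solution is defined on all of [ξ₀, ∞), and for every ξ ≥ ξ₀ one has −1 < Ū(ξ) < 0 and S̄(ξ) > 0. -/
open Set Metric
open scoped NNReal

/-- Global existence for a bounded, globally Lipschitz autonomous field. -/
theorem exists_global_of_lipschitz_bounded {E : Type*} [NormedAddCommGroup E] [NormedSpace ℝ E]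
    [CompleteSpace E] (G : E → E) (K L : ℝ≥0) (hK : LipschitzWith K G) (hL : ∀ x, ‖G x‖ ≤ L)
    (t₀ : ℝ) (x₀ : E) :
    ∃ γ : ℝ → E, γ t₀ = x₀ ∧ ∀ t, HasDerivAt γ (G (γ t)) t := by
  have key : ∀ T : ℝ, 0 < T → ∃ γ : ℝ → E, γ t₀ = x₀ ∧
      ∀ t ∈ Ioo (t₀ - T) (t₀ + T), HasDerivAt γ (G (γ t)) t := by
    intro T hT
    have hmem : t₀ ∈ Icc (t₀ - T) (t₀ + T) := ⟨by linarith, by linarith⟩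
    have hPL : IsPicardLindelof (fun _ : ℝ => G) (tmin := t₀ - T) (tmax := t₀ + T)
        ⟨t₀, hmem⟩ x₀ (L * T.toNNReal) 0 L K :=
      { lipschitzOnWith := fun t _ => hK.lipschitzOnWith
        continuousOn := fun x _ => continuousOn_const
        norm_le := fun t _ x _ => hL x
        mul_max_le := by
          simp [hT.le] }
    obtain ⟨γ, h0, hγ⟩ := hPL.exists_eq_forall_mem_Icc_hasDerivWithinAt₀
    exact ⟨γ, h0, fun t ht => (hγ t (Ioo_subset_Icc_self ht)).hasDerivAt (Icc_mem_nhds ht.1 ht.2)⟩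
  choose! g hg0 hg using key
  have huniq : ∀ T T' : ℝ, 0 < T → T ≤ T' → EqOn (g T) (g T') (Ioo (t₀ - T) (t₀ + T)) := by
    intro T T' hT hTT'
    refine ODE_solution_unique_of_mem_Ioo (v := fun _ => G) (s := fun _ => univ) (K := K)
      (t₀ := t₀)
      (fun t _ => hK.lipschitzOnWith) ⟨by linarith, by linarith⟩
      (fun t ht => ⟨hg T hT t ht, mem_univ _⟩)
      (fun t ht => ⟨hg T' (by linarith) t ⟨by linarith [ht.1], by linarith [ht.2]⟩, mem_univ _⟩) ?_
    rw [hg0 T hT, hg0 T' (by linarith)]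
  refine ⟨fun t => g (|t - t₀| + 1) t, ?_, fun t => ?_⟩
  · simpa using hg0 (|t₀ - t₀| + 1) (by positivity)
  · have hT : 0 < |t - t₀| + 2 := by positivity
    have hin : ∀ τ ∈ Ioo (t - 1) (t + 1), g (|τ - t₀| + 1) τ = g (|t - t₀| + 2) τ := by
      intro τ hτ
      have h1 : |τ - t₀| + 1 ≤ |t - t₀| + 2 := by
        have h2 := abs_sub_abs_le_abs_sub (τ - t₀) (t - t₀)
        have h3 : |τ - t₀ - (t - t₀)| ≤ 1 := by
          rw [abs_le]; constructor <;> linarith [hτ.1, hτ.2]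
        linarith
      refine huniq _ _ (by positivity) h1 ⟨?_, ?_⟩
      · linarith [neg_abs_le (τ - t₀)]
      · linarith [le_abs_self (τ - t₀)]
    have hd := hg (|t - t₀| + 2) hT t
      ⟨by linarith [neg_abs_le (t - t₀)], by linarith [le_abs_self (t - t₀)]⟩
    have hE : (fun t => g (|t - t₀| + 1) t) =ᶠ[nhds t] g (|t - t₀| + 2) := by
      filter_upwards [Ioo_mem_nhds (show t - 1 < t by linarith) (show t < t + 1 by linarith)]
        with τ hτ using hin τ hτ
    have h4 := hd.congr_of_eventuallyEq hE
    simpa only [← hin t ⟨by linarith, by linarith⟩] using h4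

/-- A barrier argument on a half line. -/
theorem barrier_le {f f' B B' : ℝ → ℝ} {a : ℝ} (hf : ∀ x, HasDerivAt f (f' x) x)
    (hB : ∀ x, HasDerivAt B (B' x) x) (ha : f a ≤ B a)
    (bound : ∀ x, a ≤ x → f x = B x → f' x < B' x) : ∀ x, a ≤ x → f x ≤ B x := by
  intro x hx
  exact image_le_of_deriv_right_lt_deriv_boundary (a := a) (b := x)
    (fun y _ => (hf y).continuousAt.continuousWithinAt) (fun y _ => (hf y).hasDerivWithinAt) ha hB
    (fun y hy => bound y hy.1) ⟨hx, le_rfl⟩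

/-- A `C¹` function is Lipschitz on compact convex subsets of an open set. -/
theorem lipschitz_on_compact_convex {E : Type*} [NormedAddCommGroup E] [NormedSpace ℝ E]
    {f : E → E} {O C : Set E} (hO : IsOpen O) (hf : ContDiffOn ℝ 1 f O) (hC : IsCompact C)
    (hconv : Convex ℝ C) (hCO : C ⊆ O) : ∃ K : ℝ≥0, LipschitzOnWith K f C := by
  have hc : ContinuousOn (fderiv ℝ f) C := (hf.continuousOn_fderiv_of_isOpen hO le_rfl).mono hCO
  obtain ⟨K, hK⟩ := hC.exists_bound_of_continuousOn hc
  refine ⟨K.toNNReal, hconv.lipschitzOnWith_of_nnnorm_fderiv_le (𝕜 := ℝ) (fun x hx => ?_)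
    (fun x hx => ?_)⟩
  · exact (hf.contDiffAt (hO.mem_nhds (hCO hx))).differentiableAt (by norm_num)
  · rw [← NNReal.coe_le_coe]
    exact (hK x hx).trans (Real.le_coe_toNNReal K)

/-- Truncation to `[a, b]`. -/
noncomputable def clampR (a b x : ℝ) : ℝ := max a (min b x)

theorem clampR_lip (a b : ℝ) : LipschitzWith 1 (clampR a b) :=
  (LipschitzWith.id.const_min b).const_max a

theorem clampR_mem {a b : ℝ} (h : a ≤ b) (x : ℝ) : clampR a b x ∈ Icc a b :=
  ⟨le_max_left _ _, max_le h (min_le_left _ _)⟩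

theorem clampR_eq {a b x : ℝ} (h : x ∈ Icc a b) : clampR a b x = x := by
  simp [clampR, h.1, h.2]

/-- The vector field. -/
noncomputable def fieldF (α : ℝ) (d : ℕ) (r : ℝ) (p : ℝ × ℝ) : ℝ × ℝ :=
  (NU α d r p.1 p.2 / Dfun α p.1 p.2, NS α d r p.1 p.2 / Dfun α p.1 p.2)

theorem D_ge {α δ u s : ℝ} (hδ : 0 < δ) (hu : -1 + δ ≤ u) : δ ^ 2 ≤ Dfun α u s := by
  unfold Dfun
  nlinarith [sq_nonneg (α * s)]

/-- Global solutions of the truncated system. -/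
theorem truncated_solution (α : ℝ) (d : ℕ) (r δ M t₀ u₀ s₀ : ℝ) (hδ : 0 < δ) (hδ1 : δ ≤ 1)
    (hM : 0 ≤ M) :
    ∃ γ : ℝ → ℝ × ℝ, γ t₀ = (u₀, s₀) ∧ ∀ t, HasDerivAt γ
      (fieldF α d r (clampR (-1 + δ) 0 (γ t).1, clampR 0 M (γ t).2)) t := by
  have hO : IsOpen {p : ℝ × ℝ | Dfun α p.1 p.2 ≠ 0} := by
    refine isOpen_ne_fun ?_ continuous_const
    unfold Dfun; fun_prop
  have hf : ContDiffOn ℝ 1 (fieldF α d r) {p : ℝ × ℝ | Dfun α p.1 p.2 ≠ 0} := by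
    unfold fieldF
    refine ContDiffOn.prodMk (ContDiffOn.div ?_ ?_ fun p hp => hp)
      (ContDiffOn.div ?_ ?_ fun p hp => hp)
    all_goals
      apply ContDiff.contDiffOn
      first
        | (unfold NU; fun_prop)
        | (unfold NS; fun_prop)
        | (unfold Dfun; fun_prop)
  have hCO : (Icc (-1 + δ) 0 ×ˢ Icc 0 M : Set (ℝ × ℝ)) ⊆ {p : ℝ × ℝ | Dfun α p.1 p.2 ≠ 0} := by
    rintro ⟨u, s⟩ ⟨hu, hs⟩
    have := D_ge (α := α) (s := s) hδ hu.1
    have h2 : 0 < δ ^ 2 := by positivity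
    exact (lt_of_lt_of_le h2 this).ne'
  have hcpt : IsCompact (Icc (-1 + δ) 0 ×ˢ Icc 0 M : Set (ℝ × ℝ)) := isCompact_Icc.prod isCompact_Icc
  obtain ⟨K, hK⟩ := lipschitz_on_compact_convex hO hf hcpt
    ((convex_Icc _ _).prod (convex_Icc _ _)) hCO
  obtain ⟨L, hL⟩ := hcpt.exists_bound_of_continuousOn (hf.continuousOn.mono hCO)
  have hP : LipschitzWith 1 (fun p : ℝ × ℝ => (clampR (-1 + δ) 0 p.1, clampR 0 M p.2)) := by
    have := ((clampR_lip (-1 + δ) 0).comp LipschitzWith.prod_fst).prodMk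
      ((clampR_lip 0 M).comp LipschitzWith.prod_snd)
    simpa using this
  have hmem : ∀ p : ℝ × ℝ, (clampR (-1 + δ) 0 p.1, clampR 0 M p.2) ∈
      (Icc (-1 + δ) 0 ×ˢ Icc 0 M : Set (ℝ × ℝ)) := fun p =>
    ⟨clampR_mem (by linarith) _, clampR_mem hM _⟩
  have hG := hK.comp (hP.lipschitzOnWith (s := univ)) (fun p _ => hmem p)
  rw [lipschitzOnWith_univ] at hG
  exact exists_global_of_lipschitz_bounded _ _ L.toNNReal hG
    (fun p => (hL _ (hmem p)).trans (Real.le_coe_toNNReal L)) t₀ (u₀, s₀)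

theorem NU_pos_left {α r δ s : ℝ} {d : ℕ} (hα : 0 < α) (hr : 1 < r) (hδ : 0 < δ) (hδ1 : δ < 1)
    (hδd : α * d * δ ≤ α * d - (r - 1)) : 0 < NU α d r (-1 + δ) s := by
  have h1 : 0 ≤ α * s ^ 2 * (α * d - (r - 1) - α * d * δ) :=
    mul_nonneg (by positivity) (by linarith)
  have h2 : 0 < (1 - δ) * δ * (r - 1 + δ) :=
    mul_pos (mul_pos (by linarith) hδ) (by linarith)
  unfold NU
  nlinarith

theorem poly_bound (a b r u : ℝ) (hr : 0 ≤ r) (hu : -1 ≤ u) (hu' : u ≤ 0) :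
    |a * u + b * u ^ 2 - r| ≤ |a| + |b| + r := by
  have h1 : |a * u| ≤ |a| := by
    rw [abs_mul]
    exact mul_le_of_le_one_right (abs_nonneg _) (abs_le.2 ⟨by linarith, by linarith⟩)
  have h2 : |b * u ^ 2| ≤ |b| := by
    rw [abs_mul]
    exact mul_le_of_le_one_right (abs_nonneg _) (abs_le.2 ⟨by nlinarith, by nlinarith⟩)
  rw [abs_le] at *
  constructor <;> linarith [h1.1, h1.2, h2.1, h2.2]

theorem NS_factor (α : ℝ) (d : ℕ) (r u s : ℝ) : NS α d r u s =
    s * (-(α * s) ^ 2 + ((α * r - α * d - r - 1) * u + (α - α * d - 1) * u ^ 2 - r)) := by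
  unfold NS; ring

/-- Global forward existence in the invariant region: if `r > 1` and `α d > r - 1`,
then the (maximal) solution of (⋆) starting at time `ξ₀` from data
`-1 < Ū(ξ₀) < 0`, `S̄(ξ₀) > 0` is defined on all of `[ξ₀, ∞)` and satisfies
`-1 < Ū(ξ) < 0` and `S̄(ξ) > 0` for every `ξ ≥ ξ₀`. -/
theorem global_solution_invariant_region
    (α : ℝ) (hα : 0 < α) (d : ℕ) (hd : 1 ≤ d)
    (r : ℝ) (hr : 1 < r) (hrd : α * d > r - 1)
    (ξ₀ u₀ s₀ : ℝ) (hu₀ : -1 < u₀) (hu₀' : u₀ < 0) (hs₀ : 0 < s₀) :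
    ∃ U S : ℝ → ℝ,
      U ξ₀ = u₀ ∧ S ξ₀ = s₀ ∧
      ∀ ξ : ℝ, ξ₀ ≤ ξ →
        HasDerivAt U (NU α d r (U ξ) (S ξ) / Dfun α (U ξ) (S ξ)) ξ ∧
        HasDerivAt S (NS α d r (U ξ) (S ξ) / Dfun α (U ξ) (S ξ)) ξ ∧
        -1 < U ξ ∧ U ξ < 0 ∧ 0 < S ξ := by
  -- parameters
  have hd0 : 0 < α * d := by linarith
  obtain ⟨δ, hδ, hδu, hδd⟩ : ∃ δ : ℝ, 0 < δ ∧ δ ≤ 1 + u₀ ∧ α * d * δ ≤ α * d - (r - 1) := by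
    refine ⟨min (1 + u₀) ((α * d - (r - 1)) / (α * d)), lt_min (by linarith)
      (div_pos (by linarith) hd0), min_le_left _ _, ?_⟩
    calc α * d * min (1 + u₀) ((α * d - (r - 1)) / (α * d))
        ≤ α * d * ((α * d - (r - 1)) / (α * d)) :=
          mul_le_mul_of_nonneg_left (min_le_right _ _) hd0.le
      _ = α * d - (r - 1) := by field_simp
  have hδ1 : δ < 1 := by linarith
  have hδ2 : 0 < δ ^ 2 := by positivity
  obtain ⟨Q, hQ0, hQ⟩ : ∃ Q : ℝ, 0 ≤ Q ∧ ∀ u : ℝ, -1 ≤ u → u ≤ 0 →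
      |(α * r - α * d - r - 1) * u + (α - α * d - 1) * u ^ 2 - r| ≤ Q :=
    ⟨_, by positivity, fun u hu hu' => poly_bound _ _ r u (by linarith) hu hu'⟩
  obtain ⟨M, hM, hsM, hMQ⟩ : ∃ M : ℝ, 0 < M ∧ s₀ ≤ M ∧ Q < (α * M) ^ 2 := by
    refine ⟨s₀ + (Q + 1) / α, by positivity, by linarith [show 0 < (Q + 1) / α by positivity], ?_⟩
    have h1 : α * (s₀ + (Q + 1) / α) = α * s₀ + (Q + 1) := by field_simp
    rw [h1]
    nlinarith [mul_pos hα hs₀]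
  obtain ⟨γ, hγ0, hγ⟩ := truncated_solution α d r δ M ξ₀ u₀ s₀ hδ hδ1.le hM.le
  have hU : ∀ t, HasDerivAt (fun t => (γ t).1) _ t := fun t => (hγ t).fst
  have hS : ∀ t, HasDerivAt (fun t => (γ t).2) _ t := fun t => (hγ t).snd
  simp only [fieldF] at hU hS
  have cU : ∀ t, clampR (-1 + δ) 0 (γ t).1 ∈ Icc (-1 + δ) 0 := fun t => clampR_mem (by linarith) _
  have cS : ∀ t, clampR 0 M (γ t).2 ∈ Icc 0 M := fun t => clampR_mem hM.le _
  have hU0 : (γ ξ₀).1 = u₀ := by rw [hγ0]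
  have hS0 : (γ ξ₀).2 = s₀ := by rw [hγ0]
  -- lower bound for U
  have b1 : ∀ t, ξ₀ ≤ t → -1 + δ ≤ (γ t).1 := by
    intro t ht
    have := barrier_le (a := ξ₀) (fun t => (hU t).neg) (fun t => hasDerivAt_const t (-(-1 + δ)))
      (by simp only [Pi.neg_apply, hU0]; linarith) (fun x hx hxe => ?_) t ht
    · simp only [Pi.neg_apply] at this; linarith
    · simp only [Pi.neg_apply, neg_inj] at hxe
      rw [hxe, clampR_eq (x := -1 + δ) ⟨le_rfl, by linarith⟩, neg_lt_zero]
      exact div_pos (NU_pos_left hα hr hδ hδ1 hδd) (hδ2.trans_le (D_ge hδ le_rfl))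
  -- upper bound for S
  have b2 : ∀ t, ξ₀ ≤ t → (γ t).2 ≤ M := by
    refine barrier_le (a := ξ₀) hS (fun t => hasDerivAt_const t M) (by simpa [hS0] using hsM)
      (fun x hx hxe => ?_)
    rw [hxe, clampR_eq (x := M) ⟨hM.le, le_rfl⟩]
    refine div_neg_of_neg_of_pos ?_ (hδ2.trans_le (D_ge hδ (cU x).1))
    rw [NS_factor]
    have := (abs_le.1 (hQ _ (by linarith [(cU x).1]) (cU x).2)).2
    exact mul_neg_of_pos_of_neg hM (by linarith)
  -- exponential barriers
  have hexp : ∀ (c C t : ℝ), HasDerivAt (fun t => c * Real.exp (-C * (t - ξ₀)))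
      (-C * (c * Real.exp (-C * (t - ξ₀)))) t := by
    intro c C t
    have h1 : HasDerivAt (fun t => -C * (t - ξ₀)) (-C) t := by
      simpa using ((hasDerivAt_id t).sub_const ξ₀).const_mul (-C)
    have h2 := h1.exp.const_mul c
    rwa [show c * (Real.exp (-C * (t - ξ₀)) * -C) = -C * (c * Real.exp (-C * (t - ξ₀))) by ring] at h2
  have hexp1 : ∀ (C t : ℝ), 0 ≤ C → ξ₀ ≤ t → Real.exp (-C * (t - ξ₀)) ≤ 1 := by
    intro C t hC ht
    rw [Real.exp_le_one_iff]
    nlinarith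
  -- positivity of S
  have b3 : ∀ t, ξ₀ ≤ t → 0 < (γ t).2 := by
    intro t ht
    set C : ℝ := ((α * M) ^ 2 + Q + 1) / δ ^ 2 with hCdef
    have hC0 : 0 ≤ C := by positivity
    have := barrier_le (a := ξ₀) (fun t => (hS t).neg) (fun t => hexp (-s₀) C t)
      (by simp [hS0]) (fun x hx hxe => ?_) t ht
    · simp only [Pi.neg_apply] at this
      have h5 : 0 < s₀ * Real.exp (-C * (t - ξ₀)) := by positivity
      linarith
    · rw [← hxe]
      simp only [Pi.neg_apply] at hxe ⊢
      have h5 : 0 < s₀ * Real.exp (-C * (x - ξ₀)) := by positivity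
      have h6 : 0 < (γ x).2 := by linarith
      have h7 : (γ x).2 ≤ M := b2 x hx
      rw [clampR_eq (x := (γ x).2) ⟨h6.le, h7⟩]
      have hD := D_ge (α := α) (s := (γ x).2) hδ (cU x).1
      have hDp := hδ2.trans_le hD
      suffices h : -C * (γ x).2 < NS α d r (clampR (-1 + δ) 0 (γ x).1) (γ x).2 /
          Dfun α (clampR (-1 + δ) 0 (γ x).1) (γ x).2 by linarith
      rw [lt_div_iff₀ hDp, NS_factor]
      have h8 := (abs_le.1 (hQ _ (by linarith [(cU x).1]) (cU x).2)).1
      have h9 : (α * (γ x).2) ^ 2 ≤ (α * M) ^ 2 := by gcongr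
      have h10 : (α * M) ^ 2 + Q + 1 ≤ C * Dfun α (clampR (-1 + δ) 0 (γ x).1) (γ x).2 := by
        calc (α * M) ^ 2 + Q + 1 = C * δ ^ 2 := by rw [hCdef]; field_simp
          _ ≤ _ := mul_le_mul_of_nonneg_left hD hC0
      calc -C * (γ x).2 * Dfun α (clampR (-1 + δ) 0 (γ x).1) (γ x).2
          = (γ x).2 * (-(C * Dfun α (clampR (-1 + δ) 0 (γ x).1) (γ x).2)) := by ring
        _ < _ := mul_lt_mul_of_pos_left (by linarith) h6
  -- negativity of U
  have b4 : ∀ t, ξ₀ ≤ t → (γ t).1 < 0 := by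
    intro t ht
    set C : ℝ := (α ^ 2 * d * M ^ 2 + r) / δ ^ 2 with hCdef
    have hC0 : 0 ≤ C := by positivity
    have := barrier_le (a := ξ₀) hU (fun t => hexp u₀ C t)
      (by simp [hU0]) (fun x hx hxe => ?_) t ht
    · have h5 : u₀ * Real.exp (-C * (t - ξ₀)) < 0 :=
        mul_neg_of_neg_of_pos hu₀' (Real.exp_pos _)
      linarith
    · rw [← hxe]
      have h5 : u₀ * Real.exp (-C * (x - ξ₀)) < 0 :=
        mul_neg_of_neg_of_pos hu₀' (Real.exp_pos _)
      have h6 : (γ x).1 < 0 := by linarith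
      have h7 := b1 x hx
      have hs := b3 x hx
      have hs' := b2 x hx
      rw [clampR_eq (x := (γ x).1) ⟨h7, h6.le⟩, clampR_eq (x := (γ x).2) ⟨hs.le, hs'⟩]
      have hD := D_ge (α := α) (s := (γ x).2) hδ h7
      have hDp := hδ2.trans_le hD
      rw [div_lt_iff₀ hDp]
      generalize (γ x).1 = u at *
      generalize (γ x).2 = s at *
      have h10 : α ^ 2 * d * M ^ 2 + r ≤ C * Dfun α u s := by
        calc α ^ 2 * d * M ^ 2 + r = C * δ ^ 2 := by rw [hCdef]; field_simp
          _ ≤ _ := mul_le_mul_of_nonneg_left hD hC0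
      have h11 : α ^ 2 * d * s ^ 2 ≤ α ^ 2 * d * M ^ 2 := by gcongr
      have h12 : (u + 1) * (r + u) ≤ r := by nlinarith
      have h13 : 0 < α * (r - 1) * s ^ 2 := by
        have : 0 < r - 1 := by linarith
        positivity
      have h14 : (-u) * (α ^ 2 * d * s ^ 2 + (u + 1) * (r + u)) ≤ (-u) * (C * Dfun α u s) :=
        mul_le_mul_of_nonneg_left (by linarith) (by linarith)
      unfold NU
      nlinarith
  refine ⟨fun t => (γ t).1, fun t => (γ t).2, hU0, hS0, fun t ht => ?_⟩
  have e1 : clampR (-1 + δ) 0 (γ t).1 = (γ t).1 := clampR_eq ⟨b1 t ht, (b4 t ht).le⟩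
  have e2 : clampR 0 M (γ t).2 = (γ t).2 := clampR_eq ⟨(b3 t ht).le, b2 t ht⟩
  have hUt := hU t
  have hSt := hS t
  rw [e1, e2] at hUt hSt
  exact ⟨hUt, hSt, by linarith [b1 t ht], b4 t ht, b3 t ht⟩
end

section
/- Let α > 0, let d ≥ 1 be an integer, and let r be a real number. Let ξ₀ ∈ ℝ and let (Ū, S̄) : (−∞, ξ₀) → ℝ² be a C¹ solution of the system (⋆) such that Ū is bounded, e^{ξ}S̄(ξ) → 1 as ξ → −∞, and Ū(ξ) converges to a limit L as ξ → −∞. Then L = −(r−1)/(αd). -/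
/-- Identification of the limit at `ξ → -∞`: if `(Ū, S̄)` solves (⋆) on `(-∞, ξ₀)`,
`Ū` is bounded, `e^ξ S̄(ξ) → 1` as `ξ → -∞`, and `Ū(ξ) → L` as `ξ → -∞`, then
`L = -(r-1)/(αd)`. -/
theorem limit_at_minus_infinity
    (α : ℝ) (hα : 0 < α) (d : ℕ) (hd : 1 ≤ d) (r : ℝ)
    (ξ₀ : ℝ) (U S : ℝ → ℝ)
    (hsol : ∀ ξ : ℝ, ξ < ξ₀ →
      HasDerivAt U (NU α d r (U ξ) (S ξ) / Dfun α (U ξ) (S ξ)) ξ ∧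
      HasDerivAt S (NS α d r (U ξ) (S ξ) / Dfun α (U ξ) (S ξ)) ξ)
    (hbdd : ∃ C : ℝ, ∀ ξ : ℝ, ξ < ξ₀ → |U ξ| ≤ C)
    (hStend : Filter.Tendsto (fun ξ => Real.exp ξ * S ξ) Filter.atBot (nhds 1))
    (L : ℝ) (hUtend : Filter.Tendsto U Filter.atBot (nhds L)) :
    L = -(r - 1) / (α * d) := by
  have hd' : (0 : ℝ) < d := by exact_mod_cast hd
  set F : ℝ → ℝ := fun ξ => NU α d r (U ξ) (S ξ) / Dfun α (U ξ) (S ξ) with hF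
  -- the inverse of `S` tends to zero
  have hT : Filter.Tendsto (fun ξ => (S ξ)⁻¹) Filter.atBot (nhds 0) := by
    have h1 : Filter.Tendsto (fun ξ => Real.exp ξ * (Real.exp ξ * S ξ)⁻¹)
        Filter.atBot (nhds (0 * (1 : ℝ)⁻¹)) :=
      Real.tendsto_exp_atBot.mul (hStend.inv₀ one_ne_zero)
    rw [zero_mul] at h1
    refine h1.congr fun ξ => ?_
    rw [mul_inv, ← mul_assoc, mul_inv_cancel₀ (Real.exp_ne_zero ξ), one_mul]
  have hS0 : ∀ᶠ ξ in Filter.atBot, S ξ ≠ 0 := by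
    filter_upwards [hStend.eventually_ne one_ne_zero] with ξ h
    exact right_ne_zero_of_mul h
  -- limit of the right-hand side
  have hlim : Filter.Tendsto F Filter.atBot
      (nhds ((-α ^ 2 * d * L - α * (r - 1) - L * (L + 1) * (r + L) * 0 ^ 2) /
        ((1 + L) ^ 2 * 0 ^ 2 + α ^ 2))) := by
    have hg : Filter.Tendsto (fun ξ =>
        (-α ^ 2 * d * U ξ - α * (r - 1) - U ξ * (U ξ + 1) * (r + U ξ) * (S ξ)⁻¹ ^ 2) /
        ((1 + U ξ) ^ 2 * (S ξ)⁻¹ ^ 2 + α ^ 2)) Filter.atBot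
        (nhds ((-α ^ 2 * d * L - α * (r - 1) - L * (L + 1) * (r + L) * 0 ^ 2) /
        ((1 + L) ^ 2 * 0 ^ 2 + α ^ 2))) := by
      refine Filter.Tendsto.div ?_ ?_ (by positivity)
      · exact ((hUtend.const_mul _).sub_const _).sub
          (((hUtend.mul (hUtend.add_const 1)).mul (hUtend.const_add r)).mul (hT.pow 2))
      · exact (((hUtend.const_add 1).pow 2).mul (hT.pow 2)).add_const _
    refine hg.congr' ?_
    filter_upwards [hS0] with ξ h
    have h2 : (0 : ℝ) < S ξ ^ 2 := by positivity
    have hD1 : (1 + U ξ) ^ 2 * (S ξ)⁻¹ ^ 2 + α ^ 2 ≠ 0 := by positivity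
    have hD2 : (1 + U ξ) ^ 2 + α ^ 2 * S ξ ^ 2 ≠ 0 := by positivity
    simp only [hF, NU, Dfun]
    rw [div_eq_div_iff hD1 hD2]
    field_simp
  -- mean value theorem
  have hmvt : ∀ x, ∃ c, c ≤ x ∧ (x < ξ₀ → F c = U x - U (x - 1)) := by
    intro x
    by_cases hx : x < ξ₀
    · obtain ⟨c, hc, h⟩ := exists_hasDerivAt_eq_slope U F (show x - 1 < x by linarith)
        (fun y hy => (hsol y (lt_of_le_of_lt hy.2 hx)).1.continuousAt.continuousWithinAt)
        (fun y hy => (hsol y (hy.2.trans hx)).1)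
      exact ⟨c, hc.2.le, fun _ => by rw [h]; simp⟩
    · exact ⟨x, le_rfl, fun h => absurd h hx⟩
  choose c hc hFc using hmvt
  have hcb : Filter.Tendsto c Filter.atBot Filter.atBot :=
    Filter.tendsto_atBot_mono hc Filter.tendsto_id
  have hdiff : Filter.Tendsto (fun x => U x - U (x - 1)) Filter.atBot (nhds (L - L)) :=
    hUtend.sub (hUtend.comp (Filter.tendsto_atBot_add_const_right _ (-1) Filter.tendsto_id))
  have hFc0 : Filter.Tendsto (fun x => F (c x)) Filter.atBot (nhds (L - L)) := by
    refine hdiff.congr' ?_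
    filter_upwards [Filter.eventually_lt_atBot ξ₀] with x hx
    exact (hFc x hx).symm
  have heq := tendsto_nhds_unique (hlim.comp hcb) hFc0
  rw [sub_self, div_eq_zero_iff] at heq
  have hα2 : (1 + L) ^ 2 * 0 ^ 2 + α ^ 2 ≠ 0 := by positivity
  have h0 := heq.resolve_right hα2
  rw [eq_div_iff (by positivity)]
  have h3 : α * (L * (α * d) + (r - 1)) = 0 := by linarith
  have h4 := (mul_eq_zero.mp h3).resolve_left hα.ne'
  linarith
end

section
/- Let α > 0, let d ≥ 1 be an integer, and let r be a real number. The map F : ℝ² \ {(−1, 0)} → ℝ² defined by F(u, s) = (N_U(u,s)/D(u,s), N_S(u,s)/D(u,s)) is differentiable at the point (0, 0), and its Fréchet derivative at (0, 0) equals −r times the identity map of ℝ². -/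
/-- The vector field `F(u,s) = (N_U/D, N_S/D)` of the autonomous system (⋆) is
differentiable at the origin `(0,0)` and its Fréchet derivative there is `-r · Id`:
the linearization at the focus has double eigenvalue `-r`. -/
theorem field_derivative_at_origin
    (α : ℝ) (hα : 0 < α) (d : ℕ) (hd : 1 ≤ d) (r : ℝ) :
    HasFDerivAt
      (fun p : ℝ × ℝ => (NU α d r p.1 p.2 / Dfun α p.1 p.2, NS α d r p.1 p.2 / Dfun α p.1 p.2))
      ((-r) • ContinuousLinearMap.id ℝ (ℝ × ℝ))
      ((0, 0) : ℝ × ℝ) := by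
  have h1 : HasFDerivAt (fun p : ℝ × ℝ => p.1) (ContinuousLinearMap.fst ℝ ℝ ℝ) ((0, 0) : ℝ × ℝ) :=
    hasFDerivAt_fst
  have h2 : HasFDerivAt (fun p : ℝ × ℝ => p.2) (ContinuousLinearMap.snd ℝ ℝ ℝ) ((0, 0) : ℝ × ℝ) :=
    hasFDerivAt_snd
  have h3 : HasFDerivAt (fun p : ℝ × ℝ => 1 + p.1) (ContinuousLinearMap.fst ℝ ℝ ℝ)
      ((0, 0) : ℝ × ℝ) := h1.const_add 1
  have hD := (HasFDerivAt.pow h3 2).fun_add ((HasFDerivAt.pow h2 2).const_mul (α ^ 2))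
  have hU := HasFDerivAt.fun_sub (HasFDerivAt.fun_sub
    (HasFDerivAt.fun_mul ((HasFDerivAt.pow h2 2).const_mul (-α ^ 2 * d)) h1)
    ((HasFDerivAt.pow h2 2).const_mul (α * (r - 1))))
    (HasFDerivAt.fun_mul (HasFDerivAt.fun_mul h1 (h1.add_const 1)) (h1.const_add r))
  have hS := HasFDerivAt.fun_sub (HasFDerivAt.fun_add (HasFDerivAt.fun_add
    ((HasFDerivAt.pow h2 3).const_mul (-α ^ 2))
    (HasFDerivAt.fun_mul (h2.const_mul (α * r - α * d - r - 1)) h1))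
    (HasFDerivAt.fun_mul (h2.const_mul (α - α * d - 1)) (HasFDerivAt.pow h1 2)))
    (h2.const_mul r)
  have hI := HasDerivAt.comp_hasFDerivAt ((0, 0) : ℝ × ℝ) (hasDerivAt_inv (by norm_num)) hD
  have h := HasFDerivAt.prodMk (HasFDerivAt.fun_mul hU hI) (HasFDerivAt.fun_mul hS hI)
  simp only [NU, NS, Dfun, div_eq_mul_inv]
  refine HasFDerivAt.congr_fderiv h ?_
  ext <;> simp
end
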